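/- Let n ≥ 2, 1 ≤ k < n/2, and let Λ_m be the n-linear form associated to a bounded function m on Γ, smooth away from a k-dimensional non-degenerate subspace Γ′ ⊆ Γ, satisfying |∂_ξ^a m(ξ)| ≤ B·dist(ξ,Γ′)^{−|a|} for all derivatives along Γ up to a sufficiently large finite order. Then Λ_m is of restricted type α for every bad tuple α satisfying α_{i₁} + ⋯ + α_{i_r} < (n−2k+r)/2 for all 1 ≤ i₁ < ⋯ < i_r ≤ n and 1 ≤ r ≤ n, with constant depending only on n, k, α, Γ′ and B. -/

import Mathlib

open MeasureTheory Real Complex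
open scoped FourierTransform ENNReal NNReal Classical
noncomputable section

def GammaSet (n : ℕ) : Set (Fin n → ℝ) := {ξ | ∑ i, ξ i = 0}

def gammaParam (n : ℕ) (η : Fin (n - 1) → ℝ) : Fin n → ℝ := fun i =>
  if h : (i : ℕ) < n - 1 then η ⟨i, h⟩ else -(∑ j, η j)

def Lam (n : ℕ) (m : (Fin n → ℝ) → ℂ) (f : Fin n → ℝ → ℂ) : ℂ :=
  ∫ η : Fin (n - 1) → ℝ, m (gammaParam n η) * ∏ i, 𝓕 (f i) (gammaParam n η i)

def Tm (n : ℕ) (m : (Fin n → ℝ) → ℂ) (f : Fin (n - 1) → ℝ → ℂ) (x : ℝ) : ℂ :=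
  ∫ η : Fin (n - 1) → ℝ, m (gammaParam n η) * (∏ i, 𝓕 (f i) (η i)) *
    Complex.exp (2 * Real.pi * Complex.I * x * (∑ i, η i))

def NonDegenerate (n k : ℕ) (Γ' : Submodule ℝ (Fin n → ℝ)) : Prop :=
  ∀ ι : Fin k → Fin n, StrictMono ι →
    Function.Bijective (fun (ξ : Γ') (s : Fin k) => (ξ : Fin n → ℝ) (ι s))

def SymbolEst (n : ℕ) (Γ' : Submodule ℝ (Fin n → ℝ)) (M : ℕ) (B : ℝ)
    (m : (Fin n → ℝ) → ℂ) : Prop :=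
  (∀ ξ ∈ GammaSet n, ‖m ξ‖ ≤ B) ∧
  ContDiffOn ℝ (M : ℕ∞) m ((Γ' : Set (Fin n → ℝ))ᶜ) ∧
  ∀ a : ℕ, a ≤ M → ∀ ξ ∈ ((Γ' : Set (Fin n → ℝ))ᶜ), ∀ v : Fin a → (Fin n → ℝ),
    (∀ s, v s ∈ GammaSet n) → (∀ s, ‖v s‖ ≤ 1) →
    ‖iteratedFDerivWithin ℝ a m ((Γ' : Set (Fin n → ℝ))ᶜ) ξ v‖ ≤
      B / Metric.infDist ξ (Γ' : Set (Fin n → ℝ)) ^ a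

def Admissible (n : ℕ) (a : Fin n → ℝ) : Prop :=
  (∀ i, a i < 1) ∧ ∑ i, a i = 1 ∧ ∀ i j, a i < 0 → a j < 0 → i = j

def RestrictedType (n : ℕ) (Λ : (Fin n → ℝ → ℂ) → ℂ) (a : Fin n → ℝ) (C : ℝ) : Prop :=
  ∀ E : Fin n → Set ℝ, (∀ i, MeasurableSet (E i)) → (∀ i, volume (E i) < ⊤) →
    ∃ E' : Fin n → Set ℝ, (∀ i, MeasurableSet (E' i)) ∧ (∀ i, E' i ⊆ E i) ∧
      (∀ i, 0 ≤ a i → E' i = E i) ∧ (∀ i, volume (E i) ≤ 2 * volume (E' i)) ∧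
      ∀ F : Fin n → ℝ → ℂ, (∀ i, Measurable (F i)) →
        (∀ i x, ‖F i x‖ ≤ 1) → (∀ i x, x ∉ E' i → F i x = 0) →
        ‖Λ F‖ ≤ C * ∏ i, (volume (E i)).toReal ^ a i

noncomputable section

/-! ### Basic weight -/
def bw (t : ℝ) : ℝ := 1 + t ^ 2

lemma bw_pos (t : ℝ) : 0 < bw t := by unfold bw; positivity
lemma one_le_bw (t : ℝ) : 1 ≤ bw t := by unfold bw; nlinarith [sq_nonneg t]
lemma bw_ne (t : ℝ) : bw t ≠ 0 := (bw_pos t).ne'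
lemma bw_neg (t : ℝ) : bw (-t) = bw t := by unfold bw; ring
lemma bw_sub_comm (a b : ℝ) : bw (a - b) = bw (b - a) := by unfold bw; ring
lemma bw_mono {a b : ℝ} (h : |a| ≤ |b|) : bw a ≤ bw b := by
  unfold bw; linarith [sq_le_sq.mpr h]
lemma bw_peetre (a b : ℝ) : bw (a + b) ≤ 2 * bw a * bw b := by
  unfold bw; nlinarith [sq_nonneg (a - b), sq_nonneg (a * b)]
lemma bw_cont : Continuous bw := by unfold bw; fun_prop
lemma bw_meas : Measurable bw := bw_cont.measurable

lemma bw_inv_integrable : Integrable (fun x : ℝ => (bw x)⁻¹) := by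
  simpa [bw] using integrable_inv_one_add_sq
lemma bw_inv_integral : ∫ x : ℝ, (bw x)⁻¹ = π := by
  simp [bw]

lemma bw_inv_scaled_integrable {r : ℝ} (hr : 0 < r) (c : ℝ) :
    Integrable (fun x : ℝ => (bw (r * (x - c)))⁻¹) := by
  have h := (bw_inv_integrable.comp_mul_left' hr.ne').comp_sub_right c
  simpa using h

lemma bw_inv_scaled_integral {r : ℝ} (hr : 0 < r) (c : ℝ) :
    ∫ x : ℝ, (bw (r * (x - c)))⁻¹ = π / r := by
  rw [integral_sub_right_eq_self (fun x : ℝ => (bw (r * x))⁻¹) c,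
    Measure.integral_comp_mul_left (fun x : ℝ => (bw x)⁻¹) r, bw_inv_integral]
  rw [abs_of_pos (inv_pos.mpr hr), smul_eq_mul]; field_simp

lemma bw_inv_pow_le (t : ℝ) {N : ℕ} (hN : 1 ≤ N) : (bw t ^ N)⁻¹ ≤ (bw t)⁻¹ := by
  apply inv_anti₀ (bw_pos t)
  exact le_self_pow₀ (one_le_bw t) (by omega)

lemma bw_pow_inv_scaled_integrable {r : ℝ} (hr : 0 < r) (c : ℝ) {N : ℕ} (hN : 1 ≤ N) :
    Integrable (fun x : ℝ => (bw (r * (x - c)) ^ N)⁻¹) := by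
  refine (bw_inv_scaled_integrable hr c).mono' ?_ ?_
  · exact (((bw_meas.comp (by fun_prop)).pow_const N).inv).aestronglyMeasurable
  · refine Filter.Eventually.of_forall fun x => ?_
    rw [Real.norm_of_nonneg (inv_nonneg.mpr (pow_nonneg (bw_pos _).le _))]
    exact bw_inv_pow_le _ hN

/-- Sum over integers is bounded. -/
lemma bw_sum_int (x : ℝ) (S : Finset ℤ) : ∑ p ∈ S, (bw ((p : ℝ) - x))⁻¹ ≤ 13 := by
  have key : ∀ p ∈ S, (bw ((p : ℝ) - x))⁻¹ ≤
      4 * ∫ y in Set.Ioc (p : ℝ) (p + 1), (bw (1 * (y - x)))⁻¹ := by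
    intro p _
    have h1 : ∫ y in Set.Ioc (p : ℝ) (p + 1), (bw ((p : ℝ) - x))⁻¹ / 4 ≤
        ∫ y in Set.Ioc (p : ℝ) (p + 1), (bw (1 * (y - x)))⁻¹ := by
      apply setIntegral_mono_on
      · exact integrableOn_const (by simp)
      · exact (bw_inv_scaled_integrable one_pos x).integrableOn
      · exact measurableSet_Ioc
      · intro y hy
        have h2 := bw_peetre (y - p) ((p : ℝ) - x)
        have h3 : bw (y - p) ≤ 2 := by
          unfold bw; nlinarith [hy.1, hy.2]
        have h4 : bw (1 * (y - x)) ≤ 4 * bw ((p : ℝ) - x) := by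
          rw [show 1 * (y - x) = (y - p) + ((p : ℝ) - x) by ring]
          nlinarith [bw_pos ((p : ℝ) - x)]
        rw [div_eq_mul_inv, ← mul_inv]
        apply inv_anti₀ (bw_pos _); linarith
    rw [setIntegral_const] at h1
    simp only [Measure.real, Real.volume_Ioc] at h1
    simp at h1 ⊢
    linarith
  refine (Finset.sum_le_sum key).trans ?_
  rw [← Finset.mul_sum, ← integral_biUnion_finset]
  · calc 4 * ∫ y in ⋃ p ∈ S, Set.Ioc (p : ℝ) (p + 1), (bw (1 * (y - x)))⁻¹
        ≤ 4 * ∫ y : ℝ, (bw (1 * (y - x)))⁻¹ := by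
          gcongr
          · exact Filter.Eventually.of_forall fun y => (inv_nonneg.mpr (bw_pos _).le)
          · exact bw_inv_scaled_integrable one_pos x
          · exact Measure.restrict_le_self
      _ ≤ 13 := by
          rw [bw_inv_scaled_integral one_pos]; nlinarith [Real.pi_lt_d2]
  · intro p _; exact measurableSet_Ioc
  · intro p _ q _ hpq
    have := Set.pairwise_disjoint_Ioc_intCast (α := ℝ) hpq
    exact this
  · intro p _; exact (bw_inv_scaled_integrable one_pos x).integrableOn

/-! ### Powers of two -/
def pw (s : ℤ) : ℝ := (2 : ℝ) ^ s
lemma pw_pos (s : ℤ) : 0 < pw s := by unfold pw; positivity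
lemma pw_ne (s : ℤ) : pw s ≠ 0 := (pw_pos s).ne'
lemma pw_add (s t : ℤ) : pw (s + t) = pw s * pw t := by
  unfold pw; exact zpow_add₀ (by norm_num) s t
lemma pw_neg (s : ℤ) : pw (-s) = (pw s)⁻¹ := by unfold pw; exact zpow_neg _ _
lemma pw_zero : pw 0 = 1 := by simp [pw]
lemma pw_one : pw 1 = 2 := by simp [pw]
lemma pw_natCast (d : ℕ) : pw d = 2 ^ d := by simp [pw]
lemma pw_mono {s t : ℤ} (h : s ≤ t) : pw s ≤ pw t := by
  unfold pw; exact zpow_le_zpow_right₀ (by norm_num) h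
lemma pw_lt {s t : ℤ} (h : s < t) : pw s < pw t := by
  unfold pw; exact zpow_lt_zpow_right₀ (by norm_num) h
lemma pw_le_iff {s t : ℤ} : pw s ≤ pw t ↔ s ≤ t := by
  unfold pw; exact zpow_le_zpow_iff_right₀ (by norm_num)
lemma pw_mul_neg (s : ℤ) : pw s * pw (-s) = 1 := by
  rw [← pw_add]; simp [pw_zero]
lemma pw_neg_mul (s : ℤ) : pw (-s) * pw s = 1 := by
  rw [← pw_add]; simp [pw_zero]

/-- finite geometric sums -/
lemma pw_sum_le (S : Finset ℤ) (s₀ : ℤ) (h : ∀ s ∈ S, s₀ ≤ s) :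
    ∑ s ∈ S, pw (-s) ≤ 2 * pw (-s₀) := by
  have hinj : Set.InjOn (fun s : ℤ => (s - s₀).toNat) S := by
    intro a ha b hb hab
    have := h a ha; have := h b hb
    simp only at hab; omega
  have h1 : ∑ s ∈ S, pw (-s) = ∑ d ∈ S.image (fun s : ℤ => (s - s₀).toNat),
      pw (-s₀) * (1 / 2 : ℝ) ^ d := by
    rw [Finset.sum_image hinj]
    refine Finset.sum_congr rfl fun s hs => ?_
    have h2 : s = s₀ + ((s - s₀).toNat : ℤ) := by have := h s hs; omega
    conv_lhs => rw [h2, neg_add, pw_add, pw_neg ((s - s₀).toNat : ℤ), pw_natCast]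
    simp
  rw [h1, ← Finset.mul_sum, mul_comm]
  gcongr
  · exact (pw_pos _).le
  · refine (Summable.sum_le_tsum _ (fun _ _ => by positivity)
      (summable_geometric_two)).trans ?_
    rw [tsum_geometric_two]

/-! ### Dyadic intervals -/
abbrev Dy := ℤ × ℤ
def len (I : Dy) : ℝ := pw (-I.1)
def dI (I : Dy) : Set ℝ := Set.Ico (I.2 * len I) ((I.2 + 1) * len I)
def cen (I : Dy) : ℝ := (I.2 + 1 / 2) * len I

lemma len_pos (I : Dy) : 0 < len I := pw_pos _
lemma mem_dI {I : Dy} {x : ℝ} : x ∈ dI I ↔ ⌊x * pw I.1⌋ = I.2 := by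
  rw [Int.floor_eq_iff]
  have h := pw_pos I.1
  unfold dI len
  rw [pw_neg, Set.mem_Ico, ← div_eq_mul_inv, ← div_eq_mul_inv, div_le_iff₀ h, lt_div_iff₀ h]

lemma dI_nonempty (I : Dy) : (dI I).Nonempty :=
  ⟨I.2 * len I, by
    unfold dI; constructor
    · exact le_rfl
    · nlinarith [len_pos I]⟩

lemma cen_mem (I : Dy) : cen I ∈ dI I := by
  have := len_pos I
  unfold cen dI; constructor <;> nlinarith

lemma dI_meas (I : Dy) : MeasurableSet (dI I) := measurableSet_Ico

lemma dI_vol (I : Dy) : volume (dI I) = ENNReal.ofReal (len I) := by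
  unfold dI; rw [Real.volume_Ico]; congr 1; ring
lemma dI_vol_real (I : Dy) : volume.real (dI I) = len I := by
  unfold Measure.real; rw [dI_vol, ENNReal.toReal_ofReal (len_pos I).le]

lemma floor_scale {x y : ℝ} {s t : ℤ} (h : t ≤ s) (hxy : ⌊x * pw s⌋ = ⌊y * pw s⌋) :
    ⌊x * pw t⌋ = ⌊y * pw t⌋ := by
  obtain ⟨d, rfl⟩ : ∃ d : ℕ, s = t + d := ⟨(s - t).toNat, by omega⟩
  have h1 : ∀ x : ℝ, x * pw t = (x * pw (t + d)) / ((2 ^ d : ℕ) : ℝ) := by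
    intro x; rw [pw_add, pw_natCast]; push_cast; field_simp
  rw [h1 x, h1 y, Int.floor_div_natCast, Int.floor_div_natCast, hxy]

lemma dI_sub_of_mem {I J : Dy} (h : J.1 ≤ I.1) {x : ℝ} (hx : x ∈ dI I) (hx' : x ∈ dI J) :
    dI I ⊆ dI J := by
  intro y hy
  rw [mem_dI] at *
  rw [← hx']
  exact floor_scale h (hy.trans hx.symm)

lemma dI_sub_or_disj {I J : Dy} (h : J.1 ≤ I.1) : dI I ⊆ dI J ∨ Disjoint (dI I) (dI J) := by
  by_cases hd : Disjoint (dI I) (dI J)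
  · exact Or.inr hd
  · rw [Set.not_disjoint_iff] at hd
    obtain ⟨x, hx, hx'⟩ := hd
    exact Or.inl (dI_sub_of_mem h hx hx')

lemma len_le_of_sub {I J : Dy} (h : dI I ⊆ dI J) : len I ≤ len J := by
  have := measureReal_mono h (by rw [dI_vol]; simp)
  rwa [dI_vol_real, dI_vol_real] at this

lemma scale_le_of_sub {I J : Dy} (h : dI I ⊆ dI J) : J.1 ≤ I.1 := by
  have := len_le_of_sub h
  unfold len at this; rw [pw_le_iff] at this; omega

lemma dy_eq_of_mem {I J : Dy} (h : I.1 = J.1) {x : ℝ} (hx : x ∈ dI I) (hx' : x ∈ dI J) :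
    I = J := by
  rw [mem_dI] at hx hx'
  rw [h] at hx
  exact Prod.ext h (hx.symm.trans hx')

lemma dist_cen_le {I : Dy} {x : ℝ} (hx : x ∈ dI I) : |x - cen I| ≤ len I / 2 := by
  unfold dI at hx
  obtain ⟨h1, h2⟩ := hx
  unfold cen
  rw [abs_le]; constructor <;> nlinarith

lemma pw_mul_len (I : Dy) : pw I.1 * len I = 1 := pw_mul_neg _
lemma len_mul_pw (I : Dy) : len I * pw I.1 = 1 := pw_neg_mul _
lemma pw_eq_inv_len (I : Dy) : pw I.1 = (len I)⁻¹ := by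
  unfold len; rw [pw_neg, inv_inv]

/-! ### Tiles -/
structure Tile where
  I : Dy
  v : ℤ

/-- frequency of a tile -/
def Tile.fr (Q : Tile) : ℝ := pw Q.I.1 * Q.v

@[ext] lemma Tile.ext2 {Q R : Tile} (h : Q.I = R.I) (h' : Q.v = R.v) : Q = R := by
  cases Q; cases R; simp_all

/-- Separated frequency supports. -/
def FSep (Q R : Tile) : Prop := 2 * (pw Q.I.1 + pw R.I.1) < |Q.fr - R.fr|

/-- sparseness -/
def Sparse (L s₀ r : ℤ) (Q : Tile) : Prop := L ∣ Q.I.1 - s₀ ∧ 16 ∣ Q.v - r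

/-- `Q` belongs to the tree with top interval `J`, frequency `ξ` and offset `κ`. -/
def InTree (J : Dy) (ξ : ℝ) (κ : ℤ) (Q : Tile) : Prop :=
  dI Q.I ⊆ dI J ∧ Q.v = ⌊pw (-Q.I.1) * ξ⌋ + κ

end

noncomputable section

/-! ### Wave packets -/
def ex (ξ y : ℝ) : ℂ := Complex.exp (2 * Real.pi * ξ * y * Complex.I)

lemma ex_norm (ξ y : ℝ) : ‖ex ξ y‖ = 1 := by
  unfold ex
  rw [show (2 * Real.pi * ξ * y * Complex.I : ℂ) = ((2 * Real.pi * ξ * y : ℝ) : ℂ) * Complex.I by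
    push_cast; ring]
  exact Complex.norm_exp_ofReal_mul_I _
lemma ex_cont (ξ : ℝ) : Continuous (ex ξ) := by unfold ex; fun_prop
lemma ex_mul_neg (ξ y : ℝ) : ex ξ y * ex (-ξ) y = 1 := by
  unfold ex; rw [← Complex.exp_add]; simp

structure WP (N : ℕ) (K : ℝ) (φ : Tile → ℝ → ℂ) : Prop where
  cont : ∀ Q, Continuous (φ Q)
  bd : ∀ Q y, ‖φ Q y‖ ≤ pw Q.I.1 * (bw (pw Q.I.1 * (y - cen Q.I)) ^ N)⁻¹
  orth : ∀ Q R, FSep Q R → ∀ (c r : ℝ) (q : ℕ),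
    ∫ y, ((bw (r * (y - c)) ^ q : ℝ) : ℂ) * (φ Q y * (starRingEnd ℂ) (φ R y)) = 0
  lip : ∀ Q ξ, |Q.fr - ξ| ≤ K * pw Q.I.1 → ∀ y y', |y - y'| ≤ len Q.I →
    ‖φ Q y * ex ξ y - φ Q y' * ex ξ y'‖ ≤
      pw Q.I.1 * |y - y'| * (pw Q.I.1 * (bw (pw Q.I.1 * (y - cen Q.I)) ^ N)⁻¹)

/-- wave packet coefficient -/
def wu (f : ℝ → ℂ) (φ : Tile → ℝ → ℂ) (Q : Tile) : ℂ := ∫ y, f y * φ Q y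
def wc (f : ℝ → ℂ) (φ : Tile → ℝ → ℂ) (Q : Tile) : ℝ := ‖wu f φ Q‖

lemma wc_nonneg (f : ℝ → ℂ) (φ : Tile → ℝ → ℂ) (Q : Tile) : 0 ≤ wc f φ Q := norm_nonneg _

lemma cs_integral {f g : ℝ → ℝ} (hf0 : ∀ x, 0 ≤ f x) (hg0 : ∀ x, 0 ≤ g x)
    (hfm : Measurable f) (hgm : Measurable g)
    (hf : Integrable (fun x => f x ^ 2)) (hg : Integrable (fun x => g x ^ 2)) :
    (∫ x, f x * g x) ^ 2 ≤ (∫ x, f x ^ 2) * ∫ x, g x ^ 2 := by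
  have h := integral_mul_le_Lp_mul_Lq_of_nonneg (μ := volume) (p := 2) (q := 2)
    Real.HolderConjugate.two_two
    (Filter.Eventually.of_forall hf0) (Filter.Eventually.of_forall hg0)
    (f := f) (g := g)
    (by rw [show ENNReal.ofReal 2 = 2 by simp]
        exact (memLp_two_iff_integrable_sq hfm.aestronglyMeasurable).mpr hf)
    (by rw [show ENNReal.ofReal 2 = 2 by simp]
        exact (memLp_two_iff_integrable_sq hgm.aestronglyMeasurable).mpr hg)
  simp only [Real.rpow_two] at h
  have h0 : 0 ≤ ∫ x, f x * g x := integral_nonneg fun x => mul_nonneg (hf0 x) (hg0 x)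
  have hF : 0 ≤ ∫ x, f x ^ 2 := integral_nonneg fun x => sq_nonneg _
  have hG : 0 ≤ ∫ x, g x ^ 2 := integral_nonneg fun x => sq_nonneg _
  calc (∫ x, f x * g x) ^ 2 ≤ ((∫ x, f x ^ 2) ^ (1 / 2 : ℝ) * (∫ x, g x ^ 2) ^ (1 / 2 : ℝ)) ^ 2 := by
        gcongr
    _ = _ := by
        rw [mul_pow, ← Real.sqrt_eq_rpow, ← Real.sqrt_eq_rpow, Real.sq_sqrt hF, Real.sq_sqrt hG]

section bessel
variable {N q : ℕ} {KK : ℝ} {φ : Tile → ℝ → ℂ}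

/-- weight adapted to the interval `K` -/
def wt (K : Dy) (y : ℝ) : ℝ := bw (pw K.1 * (y - cen K))

lemma wt_pos (K : Dy) (y : ℝ) : 0 < wt K y := bw_pos _
lemma one_le_wt (K : Dy) (y : ℝ) : 1 ≤ wt K y := one_le_bw _
lemma wt_cont (K : Dy) : Continuous (wt K) := by
  unfold wt; exact bw_cont.comp (by fun_prop)

lemma wt_le_of_sub {I K : Dy} (h : dI I ⊆ dI K) (y : ℝ) : wt K y ≤ 4 * wt I y := by
  have h1 : |pw K.1 * (cen I - cen K)| ≤ 1 := by
    rw [abs_mul, abs_of_pos (pw_pos _)]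
    calc pw K.1 * |cen I - cen K| ≤ pw K.1 * (len K / 2) := by
          gcongr
          · exact (pw_pos _).le
          · exact dist_cen_le (h (cen_mem I))
      _ ≤ 1 := by nlinarith [pw_mul_len K]
  have h2 : bw (pw K.1 * (cen I - cen K)) ≤ 2 := by
    calc bw (pw K.1 * (cen I - cen K)) ≤ bw 1 := bw_mono (by simpa using h1)
      _ = 2 := by norm_num [bw]
  have h3 : bw (pw K.1 * (y - cen I)) ≤ bw (pw I.1 * (y - cen I)) := by
    apply bw_mono
    rw [abs_mul, abs_mul, abs_of_pos (pw_pos _), abs_of_pos (pw_pos _)]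
    gcongr
    exact pw_mono (scale_le_of_sub h)
  unfold wt
  have h4 := bw_peetre (pw K.1 * (cen I - cen K)) (pw K.1 * (y - cen I))
  rw [show pw K.1 * (cen I - cen K) + pw K.1 * (y - cen I) = pw K.1 * (y - cen K) by ring] at h4
  nlinarith [bw_pos (pw K.1 * (y - cen I)), bw_pos (pw K.1 * (cen I - cen K))]

lemma WP.bd' (hφ : WP N KK φ) (Q : Tile) (y : ℝ) : ‖φ Q y‖ ≤ pw Q.I.1 * (wt Q.I y ^ N)⁻¹ :=
  hφ.bd Q y

lemma WP.weighted (hφ : WP N KK φ) (hN : q + 3 ≤ N) {K : Dy} {Q : Tile} (h : dI Q.I ⊆ dI K)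
    (y : ℝ) : wt K y ^ q * ‖φ Q y‖ ≤ 4 ^ q * (pw Q.I.1 * (wt Q.I y ^ 3)⁻¹) := by
  have hp := wt_pos Q.I y
  have h1 : wt K y ^ q ≤ 4 ^ q * wt Q.I y ^ q := by
    rw [← mul_pow]; gcongr
    · exact (wt_pos _ _).le
    · exact wt_le_of_sub h y
  calc wt K y ^ q * ‖φ Q y‖ ≤ (4 ^ q * wt Q.I y ^ q) * (pw Q.I.1 * (wt Q.I y ^ N)⁻¹) := by
        gcongr
        exact hφ.bd' Q y
    _ ≤ (4 ^ q * wt Q.I y ^ q) * (pw Q.I.1 * (wt Q.I y ^ (q + 3))⁻¹) := by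
        have := pw_pos Q.I.1
        gcongr
        exact one_le_wt _ _
    _ = _ := by rw [pow_add]; field_simp

lemma wt_pow_inv_integrable (I : Dy) {N : ℕ} (hN : 1 ≤ N) :
    Integrable (fun y => (wt I y ^ N)⁻¹) := bw_pow_inv_scaled_integrable (pw_pos _) _ hN
lemma wt_inv_integrable (I : Dy) :
    Integrable (fun y => (wt I y)⁻¹) := bw_inv_scaled_integrable (pw_pos _) _
lemma wt_inv_integral (I : Dy) : ∫ y, (wt I y)⁻¹ = π * len I := by
  unfold wt; rw [bw_inv_scaled_integral (pw_pos _), pw_eq_inv_len]; field_simp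

lemma wt_prod {I J : Dy} (hs : I.1 ≤ J.1) (y : ℝ) :
    bw (pw I.1 * (cen I - cen J)) ≤ 2 * wt I y * wt J y := by
  have h4 := bw_peetre (-(pw I.1 * (y - cen I))) (pw I.1 * (y - cen J))
  rw [show -(pw I.1 * (y - cen I)) + pw I.1 * (y - cen J) = pw I.1 * (cen I - cen J) by ring,
    bw_neg] at h4
  refine h4.trans ?_
  unfold wt
  gcongr
  · have := bw_pos (pw I.1 * (y - cen I)); positivity
  · apply bw_mono
    rw [abs_mul, abs_mul, abs_of_pos (pw_pos _), abs_of_pos (pw_pos _)]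
    gcongr
    exact pw_mono hs

/-- Gram bound -/
def gk (I J : Dy) : ℝ := pw I.1 * (bw (pw I.1 * (cen I - cen J)) ^ 2)⁻¹

lemma gk_nonneg (I J : Dy) : 0 ≤ gk I J := by
  unfold gk; have := pw_pos I.1; have := bw_pos (pw I.1 * (cen I - cen J)); positivity

lemma wprod_meas (hφ : WP N KK φ) (K : Dy) (Q R : Tile) : Continuous (fun y =>
    ((wt K y ^ (2 * q) : ℝ) : ℂ) * (φ Q y * (starRingEnd ℂ) (φ R y))) := by
  have h1 := hφ.cont Q; have h2 := hφ.cont R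
  have h3 := wt_cont K
  fun_prop

lemma wprod_bound (hφ : WP N KK φ) (hN : q + 3 ≤ N) {K : Dy} {Q R : Tile}
    (hQ : dI Q.I ⊆ dI K) (hR : dI R.I ⊆ dI K) (hs : Q.I.1 ≤ R.I.1) (y : ℝ) :
    ‖((wt K y ^ (2 * q) : ℝ) : ℂ) * (φ Q y * (starRingEnd ℂ) (φ R y))‖ ≤
      4 * 16 ^ q * gk Q.I R.I * (pw R.I.1 * (wt R.I y)⁻¹) := by
  have hK := wt_pos K y
  have hA := wt_pos Q.I y
  have hB := wt_pos R.I y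
  have hC := bw_pos (pw Q.I.1 * (cen Q.I - cen R.I))
  have p1 := pw_pos Q.I.1
  have p2 := pw_pos R.I.1
  rw [norm_mul, norm_mul, RCLike.norm_conj, Complex.norm_real, Real.norm_of_nonneg (by positivity)]
  calc wt K y ^ (2 * q) * (‖φ Q y‖ * ‖φ R y‖)
      = (wt K y ^ q * ‖φ Q y‖) * (wt K y ^ q * ‖φ R y‖) := by rw [two_mul, pow_add]; ring
    _ ≤ (4 ^ q * (pw Q.I.1 * (wt Q.I y ^ 3)⁻¹)) * (4 ^ q * (pw R.I.1 * (wt R.I y ^ 3)⁻¹)) := by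
        exact mul_le_mul (hφ.weighted hN hQ y) (hφ.weighted hN hR y) (by positivity)
          (by positivity)
    _ = 16 ^ q * pw Q.I.1 * pw R.I.1 * (((wt Q.I y * wt R.I y) ^ 2)⁻¹ * (wt Q.I y)⁻¹
          * (wt R.I y)⁻¹) := by
        rw [show (16 : ℝ) = 4 * 4 by norm_num, mul_pow (4 : ℝ)]; field_simp
    _ ≤ 16 ^ q * pw Q.I.1 * pw R.I.1 *
          ((4 * (bw (pw Q.I.1 * (cen Q.I - cen R.I)) ^ 2)⁻¹) * 1 * (wt R.I y)⁻¹) := by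
        gcongr
        · have h := wt_prod hs y
          have h2 : bw (pw Q.I.1 * (cen Q.I - cen R.I)) ^ 2 ≤ 4 * (wt Q.I y * wt R.I y) ^ 2 := by
            calc _ ≤ (2 * wt Q.I y * wt R.I y) ^ 2 := by gcongr
              _ = _ := by ring
          rw [inv_le_iff_one_le_mul₀ (by positivity)]
          rw [← div_eq_mul_inv, div_mul_eq_mul_div, le_div_iff₀ (by positivity)]
          linarith
        · exact inv_le_one_of_one_le₀ (one_le_wt _ _)
    _ = _ := by unfold gk; ring

lemma wprod_integrable (hφ : WP N KK φ) (hN : q + 3 ≤ N) {K : Dy} {Q R : Tile}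
    (hQ : dI Q.I ⊆ dI K) (hR : dI R.I ⊆ dI K) : Integrable (fun y =>
      ((wt K y ^ (2 * q) : ℝ) : ℂ) * (φ Q y * (starRingEnd ℂ) (φ R y))) := by
  rcases le_total Q.I.1 R.I.1 with hs | hs
  · exact ((wt_inv_integrable R.I).const_mul _ |>.const_mul _).mono'
      (wprod_meas hφ K Q R).aestronglyMeasurable
      (Filter.Eventually.of_forall (wprod_bound hφ hN hQ hR hs))
  · refine ((wt_inv_integrable Q.I).const_mul (pw Q.I.1)
        |>.const_mul (4 * 16 ^ q * gk R.I Q.I)).mono'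
      (wprod_meas hφ K Q R).aestronglyMeasurable
      (Filter.Eventually.of_forall (fun y => ?_))
    · refine le_trans (le_of_eq ?_) (wprod_bound hφ hN hR hQ hs y)
      simp only [norm_mul, RCLike.norm_conj]; ring

lemma gram_bound (hφ : WP N KK φ) (hN : q + 3 ≤ N) {K : Dy} {Q R : Tile}
    (hQ : dI Q.I ⊆ dI K) (hR : dI R.I ⊆ dI K) (hs : Q.I.1 ≤ R.I.1) :
    ‖∫ y, ((wt K y ^ (2 * q) : ℝ) : ℂ) * (φ Q y * (starRingEnd ℂ) (φ R y))‖ ≤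
      16 * 16 ^ q * gk Q.I R.I := by
  refine (norm_integral_le_of_norm_le ((wt_inv_integrable R.I).const_mul _ |>.const_mul _)
    (Filter.Eventually.of_forall (wprod_bound hφ hN hQ hR hs))).trans ?_
  rw [integral_const_mul, integral_const_mul, wt_inv_integral]
  have h1 : pw R.I.1 * (π * len R.I) = π := by rw [mul_left_comm, pw_mul_len, mul_one]
  rw [h1]
  have := gk_nonneg Q.I R.I
  have h2 := Real.pi_le_four
  have : 0 ≤ 16 ^ q * gk Q.I R.I := by positivity
  nlinarith

lemma wu_integrable (hφ : WP N KK φ) (hN : 1 ≤ N) {f : ℝ → ℂ} (hfm : Measurable f) {Cf : ℝ}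
    (hfb : ∀ x, ‖f x‖ ≤ Cf) (Q : Tile) : Integrable (fun y => f y * φ Q y) := by
  have h1 : Integrable (φ Q) := by
    refine ((wt_pow_inv_integrable Q.I hN).const_mul (pw Q.I.1)).mono'
      (hφ.cont Q).aestronglyMeasurable (Filter.Eventually.of_forall (hφ.bd' Q))
  exact h1.bdd_mul hfm.aestronglyMeasurable (Filter.Eventually.of_forall hfb)

/-- weighted local square mass -/
def lm (f : ℝ → ℂ) (K : Dy) (q : ℕ) : ℝ := ∫ y, ‖f y‖ ^ 2 * (wt K y ^ (2 * q))⁻¹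

lemma lm_nonneg (f : ℝ → ℂ) (K : Dy) (q : ℕ) : 0 ≤ lm f K q :=
  integral_nonneg fun y => by have := wt_pos K y; positivity

def gkm (I J : Dy) : ℝ := if I.1 ≤ J.1 then gk I J else gk J I

lemma gram_bound' (hφ : WP N KK φ) (hN : q + 3 ≤ N) {K : Dy} {Q R : Tile}
    (hQ : dI Q.I ⊆ dI K) (hR : dI R.I ⊆ dI K) :
    ‖∫ y, ((wt K y ^ (2 * q) : ℝ) : ℂ) * (φ Q y * (starRingEnd ℂ) (φ R y))‖ ≤
      if FSep Q R then 0 else 16 * 16 ^ q * gkm Q.I R.I := by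
  split_ifs with h
  · have := hφ.orth Q R h (cen K) (pw K.1) (2 * q)
    unfold wt
    rw [this]; simp
  · unfold gkm
    split_ifs with hs
    · exact gram_bound hφ hN hQ hR hs
    · refine le_trans (le_of_eq ?_) (gram_bound hφ hN hR hQ (by omega))
      rw [← RCLike.norm_conj, ← integral_conj]
      congr 2; ext y
      simp only [map_mul, Complex.conj_conj, Complex.conj_ofReal]; ring

lemma bessel_core (hφ : WP N KK φ) (hq : 1 ≤ q) (hN : q + 3 ≤ N) {f : ℝ → ℂ} (hfm : Measurable f)
    {Cf : ℝ} (hfb : ∀ x, ‖f x‖ ≤ Cf) (K : Dy) (T : Finset Tile) (hT : ∀ Q ∈ T, dI Q.I ⊆ dI K) :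
    (∑ Q ∈ T, len Q.I * wc f φ Q ^ 2) ^ 2 ≤ lm f K q *
      ∑ Q ∈ T, ∑ R ∈ T, if FSep Q R then 0 else
        len Q.I * len R.I * wc f φ Q * wc f φ R * (16 * 16 ^ q * gkm Q.I R.I) := by
  set h : ℝ → ℂ := fun y => ∑ Q ∈ T, ((len Q.I : ℂ) * (starRingEnd ℂ) (wu f φ Q)) *
    ((wt K y ^ q : ℝ) * φ Q y) with hh
  have hwc := wt_cont K
  have hhc : Continuous h := by
    refine continuous_finsetSum _ fun Q _ => ?_
    have := hφ.cont Q
    fun_prop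
  have hK : ∀ y, (0 : ℝ) < wt K y ^ q := fun y => pow_pos (wt_pos K y) q
  -- pairing
  have hpair : ((∑ Q ∈ T, len Q.I * wc f φ Q ^ 2 : ℝ) : ℂ) =
      ∫ y, (f y * ((wt K y ^ q)⁻¹ : ℝ)) * h y := by
    have : ∀ y, (f y * ((wt K y ^ q)⁻¹ : ℝ)) * h y =
        ∑ Q ∈ T, ((len Q.I : ℂ) * (starRingEnd ℂ) (wu f φ Q)) * (f y * φ Q y) := by
      intro y
      simp only [hh]
      rw [Finset.mul_sum]
      refine Finset.sum_congr rfl fun Q _ => ?_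
      have : ((wt K y ^ q : ℝ) : ℂ) ≠ 0 := by exact_mod_cast (hK y).ne'
      rw [Complex.ofReal_inv]
      field_simp
    simp only [this]
    rw [integral_finsetSum]
    · push_cast
      refine Finset.sum_congr rfl fun Q _ => ?_
      rw [integral_const_mul]
      change _ = _ * wu f φ Q
      unfold wc
      rw [mul_assoc, mul_comm ((starRingEnd ℂ) _), Complex.mul_conj, Complex.normSq_eq_norm_sq]
      push_cast; rfl
    · intro Q _
      exact (wu_integrable hφ (by omega) hfm hfb Q).const_mul _
  -- norm of h
  have hexp : ∀ y, ((‖h y‖ ^ 2 : ℝ) : ℂ) = ∑ Q ∈ T, ∑ R ∈ T,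
      ((len Q.I : ℂ) * (starRingEnd ℂ) (wu f φ Q)) * ((len R.I : ℂ) * (wu f φ R)) *
      (((wt K y ^ (2 * q) : ℝ) : ℂ) * (φ Q y * (starRingEnd ℂ) (φ R y))) := by
    intro y
    rw [← Complex.normSq_eq_norm_sq, ← Complex.mul_conj]
    simp only [hh, map_sum, Finset.sum_mul_sum]
    refine Finset.sum_congr rfl fun Q _ => Finset.sum_congr rfl fun R _ => ?_
    simp only [map_mul, Complex.conj_conj, Complex.conj_ofReal]
    rw [two_mul, pow_add]; push_cast; ring
  have hhint : Integrable (fun y => ((‖h y‖ ^ 2 : ℝ) : ℂ)) := by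
    simp only [hexp]
    refine integrable_finsetSum _ fun Q hQ => integrable_finsetSum _ fun R hR => ?_
    exact (wprod_integrable hφ hN (hT Q hQ) (hT R hR)).const_mul _
  have hhint' : Integrable (fun y => ‖h y‖ ^ 2) := by
    have := hhint.re
    exact this
  have hnorm : ∫ y, ‖h y‖ ^ 2 ≤ ∑ Q ∈ T, ∑ R ∈ T, if FSep Q R then 0 else
        len Q.I * len R.I * wc f φ Q * wc f φ R * (16 * 16 ^ q * gkm Q.I R.I) := by
    have h0 : 0 ≤ ∫ y, ‖h y‖ ^ 2 := integral_nonneg fun y => by positivity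
    have h1 : ((∫ y, ‖h y‖ ^ 2 : ℝ) : ℂ) = ∑ Q ∈ T, ∑ R ∈ T,
      ((len Q.I : ℂ) * (starRingEnd ℂ) (wu f φ Q)) * ((len R.I : ℂ) * (wu f φ R)) *
      ∫ y, (((wt K y ^ (2 * q) : ℝ) : ℂ) * (φ Q y * (starRingEnd ℂ) (φ R y))) := by
      rw [← integral_complex_ofReal]
      simp only [hexp]
      rw [integral_finsetSum]
      · refine Finset.sum_congr rfl fun Q hQ => ?_
        rw [integral_finsetSum]
        · refine Finset.sum_congr rfl fun R hR => ?_
          rw [integral_const_mul]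
        · intro R hR
          exact (wprod_integrable hφ hN (hT Q hQ) (hT R hR)).const_mul _
      · intro Q hQ
        refine integrable_finsetSum _ fun R hR => ?_
        exact (wprod_integrable hφ hN (hT Q hQ) (hT R hR)).const_mul _
    have h2 : ∫ y, ‖h y‖ ^ 2 = ‖((∫ y, ‖h y‖ ^ 2 : ℝ) : ℂ)‖ := by
      rw [Complex.norm_real, Real.norm_of_nonneg h0]
    rw [h2, h1]
    refine (norm_sum_le _ _).trans (Finset.sum_le_sum fun Q hQ => ?_)
    refine (norm_sum_le _ _).trans (Finset.sum_le_sum fun R hR => ?_)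
    rw [norm_mul, norm_mul, norm_mul, norm_mul, RCLike.norm_conj, Complex.norm_real,
      Complex.norm_real, Real.norm_of_nonneg (len_pos _).le, Real.norm_of_nonneg (len_pos _).le]
    have hg := gram_bound' hφ hN (hT Q hQ) (hT R hR)
    have l1 := len_pos Q.I
    have l2 := len_pos R.I
    calc _ ≤ len Q.I * ‖wu f φ Q‖ * (len R.I * ‖wu f φ R‖) *
          (if FSep Q R then 0 else 16 * 16 ^ q * gkm Q.I R.I) := by gcongr
      _ = _ := by unfold wc; split_ifs <;> ring
  -- conclude
  have hS : (∑ Q ∈ T, len Q.I * wc f φ Q ^ 2) ≤ ∫ y, (‖f y‖ * (wt K y ^ q)⁻¹) * ‖h y‖ := by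
    have h0 : 0 ≤ ∑ Q ∈ T, len Q.I * wc f φ Q ^ 2 :=
      Finset.sum_nonneg fun Q _ => mul_nonneg (len_pos _).le (sq_nonneg _)
    rw [← Real.norm_of_nonneg h0, ← Complex.norm_real, hpair]
    refine (norm_integral_le_integral_norm _).trans (le_of_eq ?_)
    congr 1; ext y
    rw [norm_mul, norm_mul, Complex.norm_real, Real.norm_of_nonneg (inv_nonneg.mpr (hK y).le)]
  have hfm' : Measurable (fun y => ‖f y‖ * (wt K y ^ q)⁻¹) :=
    hfm.norm.mul ((hwc.measurable.pow_const q).inv)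
  have hsqeq : ∀ y, (‖f y‖ * (wt K y ^ q)⁻¹) ^ 2 = ‖f y‖ ^ 2 * (wt K y ^ (2 * q))⁻¹ := by
    intro y; rw [mul_pow, inv_pow, ← pow_mul, mul_comm q 2]
  have hfi : Integrable (fun y => (‖f y‖ * (wt K y ^ q)⁻¹) ^ 2) := by
    simp only [hsqeq]
    refine ((wt_pow_inv_integrable K (N := 2 * q) (by omega)).bdd_mul (c := Cf ^ 2)
      (hfm.norm.pow_const 2).aestronglyMeasurable (Filter.Eventually.of_forall fun y => ?_))
    rw [norm_pow, norm_norm]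
    gcongr; exact hfb y
  have hcs := cs_integral (f := fun y => ‖f y‖ * (wt K y ^ q)⁻¹) (g := fun y => ‖h y‖)
    (fun y => mul_nonneg (norm_nonneg _) (inv_nonneg.mpr (hK y).le)) (fun y => norm_nonneg _)
    hfm' hhc.measurable.norm hfi hhint'
  simp only [hsqeq] at hcs
  calc _ ≤ (∫ y, (‖f y‖ * (wt K y ^ q)⁻¹) * ‖h y‖) ^ 2 := by
        gcongr
        exact Finset.sum_nonneg fun Q _ => mul_nonneg (len_pos _).le (sq_nonneg _)
    _ ≤ _ := hcs
    _ ≤ _ := mul_le_mul_of_nonneg_left hnorm (lm_nonneg f K q)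

end bessel
end

noncomputable section

lemma FSep_symm {Q R : Tile} : FSep Q R ↔ FSep R Q := by
  unfold FSep; rw [abs_sub_comm, add_comm]

lemma gkm_symm (I J : Dy) : gkm I J = gkm J I := by
  unfold gkm
  split_ifs with h1 h2 h2
  · have h : I.1 = J.1 := le_antisymm h1 h2
    unfold gk
    rw [h]; congr 3
    rw [← bw_neg]; congr 1; ring
  · rfl
  · rfl
  · omega

lemma cen_diff (I J : Dy) (h : I.1 = J.1) : pw I.1 * (cen I - cen J) = (I.2 : ℝ) - J.2 := by
  have hl : len I = len J := by unfold len; rw [h]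
  unfold cen
  rw [← hl, ← sub_mul, mul_comm, mul_assoc, len_mul_pw]; ring

def offd (T : Finset Tile) (a : Tile → ℝ) : ℝ := ∑ Q ∈ T, ∑ R ∈ T,
  if (¬ FSep Q R ∧ Q.I.1 < R.I.1) then len Q.I * len R.I * a Q * a R * gk Q.I R.I else 0

lemma same_sum (T : Finset Tile) (Q : Tile) :
    ∑ R ∈ T, (if (Q.I.1 = R.I.1 ∧ Q.v = R.v) then (bw ((R.I.2 : ℝ) - Q.I.2))⁻¹ else 0) ≤ 13 := by
  rw [← Finset.sum_filter]
  have hinj : Set.InjOn (fun R : Tile => R.I.2) (T.filter fun R => Q.I.1 = R.I.1 ∧ Q.v = R.v) := by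
    intro R hR R' hR' h
    simp only [Finset.coe_filter, Set.mem_ofPred_eq] at hR hR'
    apply Tile.ext2
    · exact Prod.ext (hR.2.1.symm.trans hR'.2.1) h
    · exact hR.2.2.symm.trans hR'.2.2
  rw [← Finset.sum_image (f := fun p : ℤ => (bw ((p : ℝ) - Q.I.2))⁻¹) hinj]
  exact bw_sum_int _ _

lemma sparse_eq {L s₀ r : ℤ} {Q R : Tile} (hQ : Sparse L s₀ r Q) (hR : Sparse L s₀ r R)
    (hs : Q.I.1 = R.I.1) (h : ¬ FSep Q R) : Q.v = R.v := by
  unfold FSep Tile.fr at h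
  rw [hs] at h
  have hp := pw_pos R.I.1
  rw [← mul_sub, abs_mul, abs_of_pos hp] at h
  have h1 : |(Q.v : ℝ) - R.v| ≤ 4 := by
    by_contra h2
    push Not at h2
    apply h; nlinarith
  have h3 : |Q.v - R.v| ≤ 4 := by exact_mod_cast h1
  have h4 := hQ.2
  have h5 := hR.2
  rw [abs_le] at h3
  omega

section
variable {N q : ℕ} {KK : ℝ} {φ : Tile → ℝ → ℂ} {L s₀ r : ℤ}

lemma diag_bound (T : Finset Tile) (a : Tile → ℝ) :
    ∑ Q ∈ T, ∑ R ∈ T, (if (Q.I.1 = R.I.1 ∧ Q.v = R.v) then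
      len Q.I * ((a Q ^ 2 + a R ^ 2) / 2) * (bw ((R.I.2 : ℝ) - Q.I.2))⁻¹ else 0) ≤
    13 * ∑ Q ∈ T, len Q.I * a Q ^ 2 := by
  set D1 := ∑ Q ∈ T, ∑ R ∈ T, (if (Q.I.1 = R.I.1 ∧ Q.v = R.v) then
      len Q.I * a Q ^ 2 * (bw ((R.I.2 : ℝ) - Q.I.2))⁻¹ else 0) with hD1
  have h1 : D1 ≤ 13 * ∑ Q ∈ T, len Q.I * a Q ^ 2 := by
    rw [hD1, Finset.mul_sum]
    refine Finset.sum_le_sum fun Q _ => ?_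
    have h := same_sum T Q
    have h0 : 0 ≤ len Q.I * a Q ^ 2 := mul_nonneg (len_pos _).le (sq_nonneg _)
    calc _ = (len Q.I * a Q ^ 2) * ∑ R ∈ T, (if (Q.I.1 = R.I.1 ∧ Q.v = R.v) then
          (bw ((R.I.2 : ℝ) - Q.I.2))⁻¹ else 0) := by
          rw [Finset.mul_sum]
          refine Finset.sum_congr rfl fun R _ => ?_
          split_ifs <;> ring
      _ ≤ _ := by nlinarith
  have h2 : ∑ Q ∈ T, ∑ R ∈ T, (if (Q.I.1 = R.I.1 ∧ Q.v = R.v) then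
      len Q.I * a R ^ 2 * (bw ((R.I.2 : ℝ) - Q.I.2))⁻¹ else 0) = D1 := by
    rw [hD1, Finset.sum_comm]
    refine Finset.sum_congr rfl fun R _ => Finset.sum_congr rfl fun Q _ => ?_
    by_cases h : R.I.1 = Q.I.1 ∧ R.v = Q.v
    · rw [if_pos h, if_pos ⟨h.1.symm, h.2.symm⟩, bw_sub_comm]
      have : len R.I = len Q.I := by unfold len; rw [h.1]
      rw [this]
    · rw [if_neg h, if_neg (fun h' => h ⟨h'.1.symm, h'.2.symm⟩)]
  calc _ = (D1 + D1) / 2 := by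
        conv_rhs => enter [1, 2]; rw [← h2]
        rw [hD1, ← Finset.sum_add_distrib, Finset.sum_div]
        refine Finset.sum_congr rfl fun Q _ => ?_
        rw [← Finset.sum_add_distrib, Finset.sum_div]
        refine Finset.sum_congr rfl fun R _ => ?_
        split_ifs <;> ring
    _ ≤ _ := by linarith

lemma bessel_main (hφ : WP N KK φ) (hq : 1 ≤ q) (hN : q + 3 ≤ N) {f : ℝ → ℂ} (hfm : Measurable f)
    {Cf : ℝ} (hfb : ∀ x, ‖f x‖ ≤ Cf) (K : Dy) (T : Finset Tile) (hT : ∀ Q ∈ T, dI Q.I ⊆ dI K)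
    (hsp : ∀ Q ∈ T, Sparse L s₀ r Q) {Co : ℝ} (hCo : 0 ≤ Co)
    (hoff : offd T (wc f φ) ≤ Co * ∑ Q ∈ T, len Q.I * wc f φ Q ^ 2) :
    ∑ Q ∈ T, len Q.I * wc f φ Q ^ 2 ≤ (16 * 16 ^ q * (13 + 2 * Co)) * lm f K q := by
  set S := ∑ Q ∈ T, len Q.I * wc f φ Q ^ 2 with hS
  have hS0 : 0 ≤ S := Finset.sum_nonneg fun Q _ => mul_nonneg (len_pos _).le (sq_nonneg _)
  set a := wc f φ with ha
  have ha0 : ∀ Q, 0 ≤ a Q := fun Q => wc_nonneg f φ Q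
  have hcore := bessel_core hφ hq hN hfm hfb K T hT
  have hdbl : (∑ Q ∈ T, ∑ R ∈ T, if FSep Q R then 0 else
        len Q.I * len R.I * a Q * a R * (16 * 16 ^ q * gkm Q.I R.I)) ≤
        16 * 16 ^ q * ((13 * S) + (Co * S) + (Co * S)) := by
    have hpt : ∀ Q ∈ T, ∀ R ∈ T, (if FSep Q R then 0 else
        len Q.I * len R.I * a Q * a R * (16 * 16 ^ q * gkm Q.I R.I)) ≤
        16 * 16 ^ q * ((if (Q.I.1 = R.I.1 ∧ Q.v = R.v) then
      len Q.I * ((a Q ^ 2 + a R ^ 2) / 2) * (bw ((R.I.2 : ℝ) - Q.I.2))⁻¹ else 0) +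
        (if (¬ FSep Q R ∧ Q.I.1 < R.I.1) then len Q.I * len R.I * a Q * a R * gk Q.I R.I else 0) +
        (if (¬ FSep R Q ∧ R.I.1 < Q.I.1) then len R.I * len Q.I * a R * a Q * gk R.I Q.I else 0))
        := by
      intro Q hQ R hR
      have l1 := len_pos Q.I
      have l2 := len_pos R.I
      have a1 := ha0 Q
      have a2 := ha0 R
      have p0 := bw_pos ((R.I.2 : ℝ) - Q.I.2)
      by_cases hsep : FSep Q R
      · have hsep' : FSep R Q := FSep_symm.mpr hsep
        simp only [hsep, hsep', not_true_eq_false, false_and, if_true, if_false, add_zero]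
        split_ifs <;> positivity
      · rw [if_neg hsep]
        have hsep' : ¬ FSep R Q := fun h => hsep (FSep_symm.mp h)
        rcases lt_trichotomy Q.I.1 R.I.1 with h | h | h
        · rw [if_neg (fun h' => by omega), if_pos ⟨hsep, h⟩, if_neg (fun h' => by omega)]
          unfold gkm; rw [if_pos h.le]
          apply le_of_eq; ring
        · rw [if_pos ⟨h, sparse_eq (hsp Q hQ) (hsp R hR) h hsep⟩, if_neg (fun h' => by omega),
            if_neg (fun h' => by omega)]
          unfold gkm; rw [if_pos h.le]
          unfold gk
          rw [cen_diff _ _ h, bw_sub_comm]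
          have hl : len R.I = len Q.I := by unfold len; rw [h]
          rw [hl]
          have e1 : len Q.I * len Q.I * a Q * a R * (16 * 16 ^ q * (pw Q.I.1 *
              (bw ((R.I.2 : ℝ) - Q.I.2) ^ 2)⁻¹)) = 16 * 16 ^ q * (len Q.I * (a Q * a R) *
              (bw ((R.I.2 : ℝ) - Q.I.2) ^ 2)⁻¹) * (len Q.I * pw Q.I.1) := by ring
          rw [e1, len_mul_pw, mul_one, add_zero, add_zero]
          gcongr
          · nlinarith [sq_nonneg (a Q - a R)]
          · exact le_self_pow₀ (one_le_bw _) (by norm_num)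
        · rw [if_neg (fun h' => by omega), if_neg (fun h' => by omega), if_pos ⟨hsep', h⟩]
          unfold gkm; rw [if_neg (by omega)]
          apply le_of_eq; ring
    refine (Finset.sum_le_sum fun Q hQ => Finset.sum_le_sum fun R hR => hpt Q hQ R hR).trans ?_
    simp only [← Finset.mul_sum, Finset.sum_add_distrib]
    gcongr
    · exact diag_bound T a
    · exact hoff
    · rw [Finset.sum_comm]; exact hoff
  have hl := lm_nonneg f K q
  have h2 : S ^ 2 ≤ lm f K q * (16 * 16 ^ q * ((13 * S) + (Co * S) + (Co * S))) :=
    hcore.trans (mul_le_mul_of_nonneg_left hdbl hl)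
  rcases hS0.eq_or_lt with h | h
  · rw [← h]
    positivity
  · have h3 : S * S ≤ ((16 * 16 ^ q * (13 + 2 * Co)) * lm f K q) * S := by nlinarith
    exact le_of_mul_le_mul_right h3 h

lemma fr_intree {J : Dy} {ξ : ℝ} {κ : ℤ} {Q : Tile} (h : InTree J ξ κ Q) :
    pw Q.I.1 * (κ - 1) ≤ Q.fr - ξ ∧ Q.fr - ξ ≤ pw Q.I.1 * κ := by
  have h1 := Int.floor_le (pw (-Q.I.1) * ξ)
  have h2 := Int.lt_floor_add_one (pw (-Q.I.1) * ξ)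
  have hp := pw_pos Q.I.1
  have e : pw Q.I.1 * (pw (-Q.I.1) * ξ) = ξ := by rw [← mul_assoc, pw_mul_neg, one_mul]
  have h3 := mul_le_mul_of_nonneg_left h1 hp.le
  have h4 := mul_le_mul_of_nonneg_left h2.le hp.le
  rw [e] at h3 h4
  unfold Tile.fr
  rw [h.2]; push_cast
  constructor <;> nlinarith

lemma sparse_lt {Q R : Tile} (hQ : Sparse L s₀ r Q) (hR : Sparse L s₀ r R)
    (h : Q.I.1 < R.I.1) : pw L * pw Q.I.1 ≤ pw R.I.1 := by
  rw [← pw_add]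
  apply pw_mono
  have h1 : L ∣ R.I.1 - Q.I.1 := by
    have := dvd_sub hR.1 hQ.1; rwa [sub_sub_sub_cancel_right] at this
  have := Int.le_of_dvd (by omega) h1
  omega

lemma sparse_lt4 {Q R : Tile} (hL : 2 ≤ L) (hQ : Sparse L s₀ r Q) (hR : Sparse L s₀ r R)
    (h : Q.I.1 < R.I.1) : 4 * pw Q.I.1 ≤ pw R.I.1 := by
  have h1 := sparse_lt hQ hR h
  have h2 : (4 : ℝ) ≤ pw L := by
    have : pw 2 = 4 := by norm_num [pw]
    rw [← this]; exact pw_mono hL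
  nlinarith [pw_pos Q.I.1]

/-- Bessel inequality for a lacunary tree. -/
lemma bessel_tree (hφ : WP N KK φ) (hq : 1 ≤ q) (hN : q + 3 ≤ N) {f : ℝ → ℂ} (hfm : Measurable f)
    {Cf : ℝ} (hfb : ∀ x, ‖f x‖ ≤ Cf) (T : Finset Tile) {J : Dy} {ξ : ℝ} {κ : ℤ} (hL : 2 ≤ L)
    (hT : ∀ Q ∈ T, InTree J ξ κ Q) (hκ : 7 ≤ |κ|)
    (hsp : ∀ Q ∈ T, Sparse L s₀ r Q) :
    ∑ Q ∈ T, len Q.I * wc f φ Q ^ 2 ≤ (16 * 16 ^ q * 13) * lm f J q := by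
  have h := bessel_main (Co := 0) hφ hq hN hfm hfb J T (fun Q hQ => (hT Q hQ).1) hsp le_rfl (by
    rw [zero_mul]
    unfold offd
    refine Finset.sum_nonpos fun Q hQ => Finset.sum_nonpos fun R hR => ?_
    rw [if_neg]
    rintro ⟨h1, h2⟩
    apply h1
    have h3 := sparse_lt4 hL (hsp Q hQ) (hsp R hR) h2
    have f1 := fr_intree (hT Q hQ)
    have f2 := fr_intree (hT R hR)
    have p1 := pw_pos Q.I.1
    unfold FSep
    rcases le_abs.mp hκ with hk | hk
    · have hk' : (7 : ℝ) ≤ κ := by exact_mod_cast hk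
      rw [lt_abs]; right
      nlinarith
    · have hk' : (κ : ℝ) ≤ -7 := by
        have : κ ≤ -7 := by omega
        exact_mod_cast this
      rw [lt_abs]; left
      nlinarith)
  simpa using h
end
end

noncomputable section

/-- A selected tree. -/
structure Tre where
  J : Dy
  ξ : ℝ
  κ : ℤ
  T : Finset Tile

/-- Strongly disjoint forest at level `lam`. -/
structure SDF (a : Tile → ℝ) (lam : ℝ) (W : Finset Tre) : Prop where
  tree : ∀ t ∈ W, ∀ Q ∈ t.T, InTree t.J t.ξ t.κ Q
  disj : ∀ t ∈ W, ∀ t' ∈ W, t ≠ t' → Disjoint t.T t'.T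
  big : ∀ t ∈ W, lam ^ 2 * len t.J ≤ ∑ Q ∈ t.T, len Q.I * a Q ^ 2
  small : ∀ t ∈ W, ∀ Q ∈ t.T, a Q ≤ 2 * lam
  sd : ∀ t ∈ W, ∀ t' ∈ W, ∀ Q ∈ t.T, ∀ R ∈ t'.T, Q.I.1 < R.I.1 →
    |Q.fr - R.fr| ≤ 4 * pw R.I.1 → Disjoint (dI R.I) (dI t.J)

lemma tree_decay_sum {J : Dy} {ξ : ℝ} {κ : ℤ} (T : Finset Tile) (hT : ∀ Q ∈ T, InTree J ξ κ Q)
    (e : ℝ) : ∑ Q ∈ T, len Q.I * (bw (pw Q.I.1 * (cen Q.I - e)))⁻¹ ≤ 26 * len J := by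
  rw [← Finset.sum_fiberwise_of_maps_to (g := fun Q : Tile => Q.I.1) (t := T.image fun Q => Q.I.1)
    (fun Q hQ => Finset.mem_image_of_mem _ hQ)]
  have h1 : ∀ s ∈ T.image (fun Q : Tile => Q.I.1),
      ∑ Q ∈ T with Q.I.1 = s, len Q.I * (bw (pw Q.I.1 * (cen Q.I - e)))⁻¹ ≤ 13 * pw (-s) := by
    intro s _
    have hinj : Set.InjOn (fun Q : Tile => Q.I.2) (T.filter fun Q => Q.I.1 = s) := by
      intro R hR R' hR' h
      simp only [Finset.coe_filter, Set.mem_ofPred_eq] at hR hR'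
      apply Tile.ext2
      · exact Prod.ext (hR.2.trans hR'.2.symm) h
      · rw [(hT R hR.1).2, (hT R' hR'.1).2, hR.2, hR'.2]
    calc _ = ∑ Q ∈ T with Q.I.1 = s, pw (-s) * (bw ((Q.I.2 : ℝ) - (pw s * e - 1 / 2)))⁻¹ := by
          refine Finset.sum_congr rfl fun Q hQ => ?_
          have hs := (Finset.mem_filter.mp hQ).2
          congr 1
          · unfold len; rw [hs]
          · congr 2
            unfold cen
            rw [mul_sub, mul_comm (pw Q.I.1), mul_assoc, len_mul_pw, hs]; ring
      _ = pw (-s) * ∑ p ∈ (T.filter fun Q => Q.I.1 = s).image (fun Q : Tile => Q.I.2),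
            (bw ((p : ℝ) - (pw s * e - 1 / 2)))⁻¹ := by
          rw [← Finset.mul_sum, Finset.sum_image hinj]
      _ ≤ pw (-s) * 13 := by
          gcongr
          · exact (pw_pos _).le
          · exact bw_sum_int _ _
      _ = _ := mul_comm _ _
  refine (Finset.sum_le_sum h1).trans ?_
  rw [← Finset.mul_sum]
  have h2 := pw_sum_le (T.image fun Q : Tile => Q.I.1) J.1 (by
    intro s hs
    obtain ⟨Q, hQ, rfl⟩ := Finset.mem_image.mp hs
    exact scale_le_of_sub (hT Q hQ).1)
  unfold len; linarith

/-- Sum over disjoint small intervals outside `J`. -/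
lemma outside_sum {I J : Dy} (hI : dI I ⊆ dI J) (S : Finset Dy) (hS : ∀ R ∈ S, I.1 ≤ R.1)
    (hd : ∀ R ∈ S, ∀ R' ∈ S, R ≠ R' → Disjoint (dI R) (dI R'))
    (hout : ∀ R ∈ S, Disjoint (dI R) (dI J)) :
    ∑ R ∈ S, len R * gk I R ≤ 64 * ((bw (pw I.1 * (cen I - J.2 * len J)))⁻¹ +
      (bw (pw I.1 * (cen I - (J.2 + 1) * len J)))⁻¹) := by
  set b := (bw (pw I.1 * (cen I - J.2 * len J)))⁻¹ +
      (bw (pw I.1 * (cen I - (J.2 + 1) * len J)))⁻¹ with hb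
  have hb0 : 0 ≤ b := add_nonneg (inv_nonneg.mpr (bw_pos _).le) (inv_nonneg.mpr (bw_pos _).le)
  have pI := pw_pos I.1
  have hc := hI (cen_mem I)
  have key : ∀ R ∈ S, len R * gk I R ≤ ∫ y in dI R, (16 * b * pw I.1) * (wt I y)⁻¹ := by
    intro R hR
    have h1 : ∫ y in dI R, gk I R ≤ ∫ y in dI R, (16 * b * pw I.1) * (wt I y)⁻¹ := by
      apply setIntegral_mono_on
      · exact integrableOn_const (by rw [dI_vol]; simp)
      · exact ((wt_inv_integrable I).const_mul _).integrableOn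
      · exact dI_meas R
      · intro y hy
        have hyJ : y ∉ dI J := fun h => Set.disjoint_left.mp (hout R hR) hy h
        have w0 := wt_pos I y
        have hC := bw_pos (pw I.1 * (cen I - cen R))
        -- compare with centre of R
        have e1 : wt I y ≤ 4 * bw (pw I.1 * (cen I - cen R)) := by
          have h4 := bw_peetre (pw I.1 * (y - cen R)) (pw I.1 * (cen R - cen I))
          rw [show pw I.1 * (y - cen R) + pw I.1 * (cen R - cen I) = pw I.1 * (y - cen I) by ring]
            at h4
          have h5 : bw (pw I.1 * (y - cen R)) ≤ 2 := by
            calc bw (pw I.1 * (y - cen R)) ≤ bw 1 := by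
                  apply bw_mono
                  rw [abs_mul, abs_of_pos pI, abs_one]
                  have h6 := dist_cen_le hy
                  have h7 := pw_mono (hS R hR)
                  have h8 := pw_mul_len R
                  have h9 := len_pos R
                  have : pw I.1 * |y - cen R| ≤ pw R.1 * len R :=
                    mul_le_mul h7 (by linarith) (abs_nonneg _) (pw_pos _).le
                  linarith
              _ = 2 := by norm_num [bw]
          have h6 : bw (pw I.1 * (cen R - cen I)) = bw (pw I.1 * (cen I - cen R)) := by
            rw [← bw_neg]; congr 1; ring
          rw [h6] at h4
          unfold wt
          nlinarith
        have e2 : (wt I y)⁻¹ ≤ b := by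
          unfold dI at hyJ hc
          rw [Set.mem_Ico, not_and_or, not_le, not_lt] at hyJ
          rw [Set.mem_Ico] at hc
          rcases hyJ with h | h
          · have : (wt I y)⁻¹ ≤ (bw (pw I.1 * (cen I - J.2 * len J)))⁻¹ := by
              apply inv_anti₀ (bw_pos _)
              unfold wt
              apply bw_mono
              rw [abs_mul, abs_mul, abs_of_pos pI]
              refine mul_le_mul_of_nonneg_left ?_ pI.le
              obtain ⟨hc1, hc2⟩ := hc
              rw [abs_of_nonneg (show 0 ≤ cen I - ↑J.2*len J by linarith), abs_of_nonpos (show y - cen I ≤ 0 by linarith)]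
              linarith
            have h0 := inv_nonneg.mpr (bw_pos (pw I.1 * (cen I - (J.2 + 1) * len J))).le
            linarith
          · have : (wt I y)⁻¹ ≤ (bw (pw I.1 * (cen I - (J.2 + 1) * len J)))⁻¹ := by
              apply inv_anti₀ (bw_pos _)
              unfold wt
              apply bw_mono
              rw [abs_mul, abs_mul, abs_of_pos pI]
              refine mul_le_mul_of_nonneg_left ?_ pI.le
              obtain ⟨hc1, hc2⟩ := hc
              rw [abs_of_nonpos (show cen I - (↑J.2+1)*len J ≤ 0 by linarith), abs_of_nonneg (show 0 ≤ y - cen I by linarith)]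
              linarith
            have h0 := inv_nonneg.mpr (bw_pos (pw I.1 * (cen I - J.2 * len J))).le
            linarith
        unfold gk
        have e3 : (bw (pw I.1 * (cen I - cen R)))⁻¹ ≤ 4 * (wt I y)⁻¹ := by
          rw [← div_eq_mul_inv, le_div_iff₀ w0, inv_mul_le_iff₀ hC]; linarith
        have e4 : (bw (pw I.1 * (cen I - cen R)) ^ 2)⁻¹ ≤ 16 * b * (wt I y)⁻¹ := by
          rw [← inv_pow]
          calc (bw (pw I.1 * (cen I - cen R)))⁻¹ ^ 2 ≤ (4 * (wt I y)⁻¹) ^ 2 := by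
                gcongr
            _ = 16 * ((wt I y)⁻¹ * (wt I y)⁻¹) := by ring
            _ ≤ 16 * (b * (wt I y)⁻¹) := by gcongr
            _ = _ := by ring
        calc _ ≤ pw I.1 * (16 * b * (wt I y)⁻¹) := by gcongr
          _ = _ := by ring
    rw [setIntegral_const, dI_vol_real, smul_eq_mul] at h1
    exact h1
  refine (Finset.sum_le_sum key).trans ?_
  rw [← integral_biUnion_finset]
  · calc _ ≤ ∫ y : ℝ, (16 * b * pw I.1) * (wt I y)⁻¹ := by
          gcongr
          · exact Filter.Eventually.of_forall fun y =>
              mul_nonneg (by positivity) (inv_nonneg.mpr (wt_pos _ _).le)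
          · exact (wt_inv_integrable I).const_mul _
          · exact Measure.restrict_le_self
      _ ≤ _ := by
          rw [integral_const_mul, wt_inv_integral]
          have : 16 * b * pw I.1 * (π * len I) = 16 * b * π * (pw I.1 * len I) := by ring
          rw [this, pw_mul_len]
          nlinarith [Real.pi_le_four]
  · intro R _; exact dI_meas R
  · intro R hR R' hR' hne
    exact hd R hR R' hR' hne
  · intro R _; exact ((wt_inv_integrable I).const_mul _).integrableOn

section
variable {N q : ℕ} {KK : ℝ} {φ : Tile → ℝ → ℂ} {L s₀ r : ℤ}

lemma nonsep_near {Q R : Tile} (hL : 2 ≤ L) (hQ : Sparse L s₀ r Q) (hR : Sparse L s₀ r R)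
    (h : Q.I.1 < R.I.1) (hs : ¬ FSep Q R) : |Q.fr - R.fr| ≤ 5 / 2 * pw R.I.1 := by
  have := sparse_lt4 hL hQ hR h
  unfold FSep at hs
  push Not at hs
  linarith

lemma forest_off {a : Tile → ℝ} (ha : ∀ Q, 0 ≤ a Q) {lam : ℝ} (hlam : 0 < lam) {W : Finset Tre}
    (hW : SDF a lam W) (hL : 2 ≤ L) (hsp : ∀ t ∈ W, ∀ Q ∈ t.T, Sparse L s₀ r Q) :
    offd (W.biUnion (·.T)) a ≤ 13312 * ∑ Q ∈ W.biUnion (·.T), len Q.I * a Q ^ 2 := by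
  set T := W.biUnion (·.T) with hT
  have hmem : ∀ Q ∈ T, ∃ t ∈ W, Q ∈ t.T := fun Q hQ => by simpa [hT] using hQ
  have hspT : ∀ Q ∈ T, Sparse L s₀ r Q := fun Q hQ => by
    obtain ⟨t, ht, h⟩ := hmem Q hQ; exact hsp t ht Q h
  have hsmallT : ∀ Q ∈ T, a Q ≤ 2 * lam := fun Q hQ => by
    obtain ⟨t, ht, h⟩ := hmem Q hQ; exact hW.small t ht Q h
  have hpd : (W : Set Tre).PairwiseDisjoint (·.T) := fun t ht t' ht' h => hW.disj t ht t' ht' h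
  have inner : ∀ t ∈ W, ∀ Q ∈ t.T, (∑ R ∈ T, if (¬ FSep Q R ∧ Q.I.1 < R.I.1) then
      len Q.I * len R.I * a Q * a R * gk Q.I R.I else 0) ≤
      256 * lam ^ 2 * (len Q.I * (bw (pw Q.I.1 * (cen Q.I - t.J.2 * len t.J)))⁻¹ +
      len Q.I * (bw (pw Q.I.1 * (cen Q.I - (t.J.2 + 1) * len t.J)))⁻¹) := by
    intro t ht Q hQ
    have hQT : Q ∈ T := Finset.mem_biUnion.mpr ⟨t, ht, hQ⟩
    rw [← Finset.sum_filter]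
    set S := T.filter fun R => ¬ FSep Q R ∧ Q.I.1 < R.I.1 with hS
    have hdisj : ∀ R ∈ S, ∀ R' ∈ S, R.I.1 < R'.I.1 → Disjoint (dI R.I) (dI R'.I) := by
      intro R hR R' hR' hlt
      rw [hS, Finset.mem_filter] at hR hR'
      obtain ⟨hRT, hR1, hR2⟩ := hR
      obtain ⟨hRT', hR1', hR2'⟩ := hR'
      obtain ⟨u, hu, hRu⟩ := hmem R hRT
      obtain ⟨u', hu', hRu'⟩ := hmem R' hRT'
      have n1 := nonsep_near hL (hspT Q hQT) (hspT R hRT) hR2 hR1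
      have n2 := nonsep_near hL (hspT Q hQT) (hspT R' hRT') hR2' hR1'
      have n3 := sparse_lt4 hL (hspT R hRT) (hspT R' hRT') hlt
      have p1 := pw_pos R'.I.1
      have n4 : |R.fr - R'.fr| ≤ 4 * pw R'.I.1 := by
        have := abs_sub_le R.fr Q.fr R'.fr
        rw [abs_sub_comm R.fr Q.fr] at this
        linarith
      have := hW.sd u hu u' hu' R hRu R' hRu' hlt n4
      exact (this.mono_right (hW.tree u hu R hRu).1).symm
    have hinj : Set.InjOn (fun R : Tile => R.I) S := by
      intro R hR R' hR' h
      rw [hS, Finset.mem_coe, Finset.mem_filter] at hR hR'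
      apply Tile.ext2 h
      have h : R.I = R'.I := h
      have n1 := nonsep_near hL (hspT Q hQT) (hspT R hR.1) hR.2.2 hR.2.1
      have n2 := nonsep_near hL (hspT Q hQT) (hspT R' hR'.1) hR'.2.2 hR'.2.1
      have p1 := pw_pos R'.I.1
      have n4 : |R.fr - R'.fr| ≤ 5 * pw R'.I.1 := by
        have := abs_sub_le R.fr Q.fr R'.fr
        rw [abs_sub_comm R.fr Q.fr] at this
        rw [h] at n1
        linarith
      unfold Tile.fr at n4
      rw [h, ← mul_sub, abs_mul, abs_of_pos p1, mul_comm] at n4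
      have n5 := le_of_mul_le_mul_right n4 p1
      have n6 : |R.v - R'.v| ≤ 5 := by exact_mod_cast n5
      have h4 := (hspT R hR.1).2
      have h5 := (hspT R' hR'.1).2
      rw [abs_le] at n6
      omega
    have h1 := outside_sum (hW.tree t ht Q hQ).1 (S.image fun R : Tile => R.I) (by
      intro R hR
      obtain ⟨R', hR', rfl⟩ := Finset.mem_image.mp hR
      exact (Finset.mem_filter.mp hR').2.2.le) (by
      intro R hR R' hR' hne
      obtain ⟨R1, hR1, rfl⟩ := Finset.mem_image.mp hR
      obtain ⟨R2, hR2, rfl⟩ := Finset.mem_image.mp hR'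
      rcases lt_trichotomy R1.I.1 R2.I.1 with h | h | h
      · exact hdisj R1 hR1 R2 hR2 h
      · rcases dI_sub_or_disj (I := R1.I) (J := R2.I) h.ge with h' | h'
        · exact absurd (dy_eq_of_mem h (cen_mem _) (h' (cen_mem _))) hne
        · exact h'
      · exact (hdisj R2 hR2 R1 hR1 h).symm) (by
      intro R hR
      obtain ⟨R1, hR1, rfl⟩ := Finset.mem_image.mp hR
      obtain ⟨hRT, hR1, hR2⟩ := Finset.mem_filter.mp hR1
      obtain ⟨u, hu, hRu⟩ := hmem R1 hRT
      have n1 := nonsep_near hL (hspT Q hQT) (hspT R1 hRT) hR2 hR1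
      have p1 := pw_pos R1.I.1
      exact hW.sd t ht u hu Q hQ R1 hRu hR2 (by linarith))
    rw [Finset.sum_image hinj] at h1
    have l1 := len_pos Q.I
    calc ∑ R ∈ S, len Q.I * len R.I * a Q * a R * gk Q.I R.I
        ≤ ∑ R ∈ S, (4 * lam ^ 2 * len Q.I) * (len R.I * gk Q.I R.I) := by
          refine Finset.sum_le_sum fun R hR => ?_
          have hRT := (Finset.mem_filter.mp hR).1
          have b1 := hsmallT Q hQT
          have b2 := hsmallT R hRT
          have l2 := len_pos R.I
          have g0 := gk_nonneg Q.I R.I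
          have : a Q * a R ≤ (2 * lam) * (2 * lam) :=
            mul_le_mul b1 b2 (ha R) (by positivity)
          calc _ = (a Q * a R) * (len Q.I * (len R.I * gk Q.I R.I)) := by ring
            _ ≤ ((2 * lam) * (2 * lam)) * (len Q.I * (len R.I * gk Q.I R.I)) := by gcongr
            _ = _ := by ring
      _ = (4 * lam ^ 2 * len Q.I) * ∑ R ∈ S, len R.I * gk Q.I R.I := by rw [Finset.mul_sum]
      _ ≤ (4 * lam ^ 2 * len Q.I) * _ := mul_le_mul_of_nonneg_left h1 (by positivity)
      _ = _ := by ring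
  unfold offd
  rw [hT, Finset.sum_biUnion hpd, Finset.sum_biUnion hpd, Finset.mul_sum]
  refine Finset.sum_le_sum fun t ht => ?_
  refine (Finset.sum_le_sum fun Q hQ => inner t ht Q hQ).trans ?_
  rw [← Finset.mul_sum, Finset.sum_add_distrib]
  have d1 := tree_decay_sum t.T (hW.tree t ht) (t.J.2 * len t.J)
  have d2 := tree_decay_sum t.T (hW.tree t ht) ((t.J.2 + 1) * len t.J)
  have d3 := hW.big t ht
  have : 0 < lam ^ 2 := by positivity
  nlinarith

/-- Bessel inequality for strongly disjoint forests. -/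
lemma bessel_forest (hφ : WP N KK φ) (hq : 1 ≤ q) (hN : q + 3 ≤ N) {f : ℝ → ℂ} (hfm : Measurable f)
    {Cf : ℝ} (hfb : ∀ x, ‖f x‖ ≤ Cf) (hL : 2 ≤ L) {lam : ℝ} (hlam : 0 < lam) {W : Finset Tre}
    (hW : SDF (wc f φ) lam W) (hsp : ∀ t ∈ W, ∀ Q ∈ t.T, Sparse L s₀ r Q) (K : Dy)
    (hK : ∀ t ∈ W, dI t.J ⊆ dI K) :
    lam ^ 2 * ∑ t ∈ W, len t.J ≤ (16 * 16 ^ q * (13 + 2 * 13312)) * lm f K q := by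
  have hpd : (W : Set Tre).PairwiseDisjoint (·.T) := fun t ht t' ht' h => hW.disj t ht t' ht' h
  have h := bessel_main hφ hq hN hfm hfb K (W.biUnion (·.T)) (by
    intro Q hQ
    obtain ⟨t, ht, h⟩ := Finset.mem_biUnion.mp hQ
    exact (hW.tree t ht Q h).1.trans (hK t ht)) (by
    intro Q hQ
    obtain ⟨t, ht, h⟩ := Finset.mem_biUnion.mp hQ
    exact hsp t ht Q h) (by norm_num) (forest_off (wc_nonneg f φ) hlam hW hL hsp)
  refine le_trans ?_ h
  rw [Finset.sum_biUnion hpd, Finset.mul_sum]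
  exact Finset.sum_le_sum hW.big
end
end

noncomputable section

section
variable {L s₀ r : ℤ} {a : Tile → ℝ} {D : Finset Dy} {C2 : ℤ}

def kf (ε : ℤ) (Q : Tile) : ℝ := ε * Q.fr - 6 * pw Q.I.1

def key (ε : ℤ) (T : Finset Tile) : WithTop ℝ := T.inf fun Q => (kf ε Q : WithTop ℝ)

lemma key_lt {ε : ℤ} (hε : ε = 1 ∨ ε = -1) {J : Dy} {ξ : ℝ} {κ : ℤ} {T T' : Finset Tile}
    (hT : ∀ Q ∈ T, InTree J ξ κ Q) (hκ : 7 ≤ ε * κ) (hκ2 : ε * κ ≤ C2)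
    (hL : (C2 : ℝ) + 1 < pw L) {Q R : Tile} (hQ : Q ∈ T) (hR : R ∈ T')
    (sQ : Sparse L s₀ r Q) (sR : Sparse L s₀ r R) (hs : Q.I.1 < R.I.1)
    (hn : |Q.fr - R.fr| ≤ 4 * pw R.I.1) : key ε T' < key ε T := by
  have h1 : key ε T' ≤ (kf ε R : WithTop ℝ) := Finset.inf_le hR
  have hp := pw_pos Q.I.1
  have hp' := pw_pos R.I.1
  have h2 := sparse_lt sQ sR hs
  have e1 : ((C2 : ℝ) + 1) * pw Q.I.1 < pw R.I.1 := by nlinarith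
  have hb : ∀ Q ∈ T, ((ε : ℝ) * ξ) ≤ kf ε Q ∧ ε * Q.fr ≤ ε * ξ + (C2 + 1) * pw Q.I.1 := by
    intro Q hQ
    have f := fr_intree (hT Q hQ)
    have hp := pw_pos Q.I.1
    unfold kf
    rcases hε with rfl | rfl
    · have k1 : (7 : ℝ) ≤ κ := by exact_mod_cast (by omega : 7 ≤ κ)
      have k2 : (κ : ℝ) ≤ C2 := by exact_mod_cast (by omega : κ ≤ C2)
      push_cast
      constructor <;> nlinarith
    · have k1 : (7 : ℝ) ≤ -κ := by exact_mod_cast (by omega : 7 ≤ -κ)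
      have k2 : (-κ : ℝ) ≤ C2 := by exact_mod_cast (by omega : -κ ≤ C2)
      push_cast
      constructor <;> nlinarith
  have h3 : kf ε R < ε * ξ := by
    have := (hb Q hQ).2
    have h4 : (ε : ℝ) * R.fr ≤ ε * Q.fr + 4 * pw R.I.1 := by
      rw [abs_le] at hn
      rcases hε with rfl | rfl <;> push_cast <;> linarith
    unfold kf
    linarith
  refine lt_of_le_of_lt h1 ?_
  unfold key
  obtain ⟨Q', hQ', e⟩ := Finset.exists_mem_eq_inf T ⟨Q, hQ⟩ fun Q => (kf ε Q : WithTop ℝ)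
  rw [e, WithTop.coe_lt_coe]
  exact lt_of_lt_of_le h3 (hb Q' hQ').1

/-- violating sub-collection -/
def Viol (D : Finset Dy) (a : Tile → ℝ) (C2 ε : ℤ) (lam : ℝ) (T : Finset Tile) (J : Dy) (ξ : ℝ)
    (κ : ℤ) : Prop := J ∈ D ∧ 7 ≤ ε * κ ∧ ε * κ ≤ C2 ∧ (∀ Q ∈ T, InTree J ξ κ Q) ∧
      lam ^ 2 * len J ≤ ∑ Q ∈ T, len Q.I * a Q ^ 2

lemma greedy {ε : ℤ} (hε : ε = 1 ∨ ε = -1) (hL : (C2 : ℝ) + 1 < pw L) (hC : 7 ≤ C2) {lam : ℝ}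
    (hlam : 0 < lam) : ∀ (N : ℕ) (𝒬 : Finset Tile), 𝒬.card ≤ N → (∀ Q ∈ 𝒬, Sparse L s₀ r Q) →
    (∀ Q ∈ 𝒬, a Q ≤ 2 * lam) →
    ∃ (W : Finset Tre) (𝒬' : Finset Tile), 𝒬' ⊆ 𝒬 ∧ SDF a lam W ∧
      (∀ t ∈ W, t.T ⊆ 𝒬 ∧ Viol D a C2 ε lam t.T t.J t.ξ t.κ) ∧
      (∀ T ⊆ 𝒬', ∀ J ξ κ, ¬ Viol D a C2 ε lam T J ξ κ) ∧
      (∀ Q ∈ 𝒬, Q ∉ 𝒬' → ∃ t ∈ W, ∃ κ : ℤ, |κ| ≤ C2 ∧ InTree t.J t.ξ κ Q) := by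
  intro N
  induction N with
  | zero =>
    intro 𝒬 h0 _ _
    have : 𝒬 = ∅ := by simpa using h0
    subst this
    refine ⟨∅, ∅, le_rfl, ⟨by simp, by simp, by simp, by simp, by simp⟩, by simp, ?_, by simp⟩
    intro T hT J ξ κ hv
    have : T = ∅ := by simpa using hT
    subst this
    have h1 := hv.2.2.2.2
    have := len_pos J
    simp at h1
    nlinarith [mul_pos (pow_pos hlam 2) this]
  | succ N ih =>
    intro 𝒬 hcard hsp hsm
    set S := 𝒬.powerset.filter fun T => ∃ J ξ κ, Viol D a C2 ε lam T J ξ κ with hS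
    by_cases hne : S.Nonempty
    swap
    · refine ⟨∅, 𝒬, le_rfl, ⟨by simp, by simp, by simp, by simp, by simp⟩, by simp, ?_,
        fun Q h h' => absurd h h'⟩
      intro T hT J ξ κ hv
      exact hne ⟨T, by rw [hS, Finset.mem_filter, Finset.mem_powerset]; exact ⟨hT, J, ξ, κ, hv⟩⟩
    obtain ⟨T, hTS, hmax⟩ := Finset.exists_max_image S (key ε) hne
    rw [hS, Finset.mem_filter, Finset.mem_powerset] at hTS
    obtain ⟨hTQ, J, ξ, κ, hv⟩ := hTS
    have hmax' : ∀ T' ⊆ 𝒬, ∀ J ξ κ, Viol D a C2 ε lam T' J ξ κ → key ε T' ≤ key ε T := by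
      intro T' hT' J ξ κ hv
      apply hmax
      rw [hS, Finset.mem_filter, Finset.mem_powerset]
      exact ⟨hT', J, ξ, κ, hv⟩
    have hTne : T.Nonempty := by
      by_contra h
      rw [Finset.not_nonempty_iff_eq_empty] at h
      subst h
      have h1 := hv.2.2.2.2
      have := len_pos J
      simp at h1
      nlinarith [mul_pos (pow_pos hlam 2) this]
    set 𝒬₁ := 𝒬.filter fun Q => Q ∉ T ∧ ¬ (dI Q.I ⊆ dI J ∧ |Q.fr - ξ| ≤ 5 * pw Q.I.1) with h𝒬₁
    have h1sub : 𝒬₁ ⊆ 𝒬 := Finset.filter_subset _ _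
    have hlt : 𝒬₁.card < 𝒬.card := by
      apply Finset.card_lt_card
      obtain ⟨Q, hQ⟩ := hTne
      refine ⟨h1sub, fun h => ?_⟩
      have := h (hTQ hQ)
      rw [h𝒬₁, Finset.mem_filter] at this
      exact this.2.1 hQ
    obtain ⟨W, 𝒬', hq, hW, hWv, hno, hrem⟩ := ih 𝒬₁ (by omega) (fun Q h => hsp Q (h1sub h))
      (fun Q h => hsm Q (h1sub h))
    set t : Tre := ⟨J, ξ, κ, T⟩ with ht
    have hd : ∀ t' ∈ W, Disjoint T t'.T := by
      intro t' ht'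
      rw [Finset.disjoint_right]
      intro Q hQ
      have := (hWv t' ht').1 hQ
      rw [h𝒬₁, Finset.mem_filter] at this
      exact this.2.1
    refine ⟨insert t W, 𝒬', hq.trans h1sub, ⟨?_, ?_, ?_, ?_, ?_⟩, ?_, hno, ?_⟩
    · intro u hu
      rcases Finset.mem_insert.mp hu with rfl | hu
      · exact hv.2.2.2.1
      · exact hW.tree u hu
    · intro u hu u' hu' hne
      rcases Finset.mem_insert.mp hu with rfl | hu <;> rcases Finset.mem_insert.mp hu' with rfl | hu'
      · exact absurd rfl hne
      · exact hd u' hu'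
      · exact (hd u hu).symm
      · exact hW.disj u hu u' hu' hne
    · intro u hu
      rcases Finset.mem_insert.mp hu with rfl | hu
      · exact hv.2.2.2.2
      · exact hW.big u hu
    · intro u hu Q hQ
      rcases Finset.mem_insert.mp hu with rfl | hu
      · exact hsm Q (hTQ hQ)
      · exact hW.small u hu Q hQ
    · intro u hu u' hu' Q hQ R hR hs hn
      rcases Finset.mem_insert.mp hu with rfl | hu
      · have hQ : Q ∈ T := hQ
        rcases Finset.mem_insert.mp hu' with rfl | hu'
        · have hR : R ∈ T := hR
          exact absurd (key_lt hε hv.2.2.2.1 hv.2.1 hv.2.2.1 hL hQ hR (hsp Q (hTQ hQ))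
            (hsp R (hTQ hR)) hs hn) (lt_irrefl _)
        · have hR1 := (hWv u' hu').1 hR
          have sR := hsp R (h1sub hR1)
          have sQ := hsp Q (hTQ hQ)
          rw [h𝒬₁, Finset.mem_filter] at hR1
          have hnot := hR1.2.2
          have hin := hv.2.2.2.1 Q hQ
          have f := fr_intree hin
          have h2 := sparse_lt sQ sR hs
          have hp := pw_pos Q.I.1
          have e1 : ((C2 : ℝ) + 1) * pw Q.I.1 < pw R.I.1 := by nlinarith
          have hb : |Q.fr - ξ| ≤ ((C2 : ℝ) + 1) * pw Q.I.1 := by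
            obtain ⟨-, k7, kC, -⟩ := hv
            rw [abs_le]
            have k1 : (κ : ℝ) ≤ C2 := by
              exact_mod_cast (by rcases hε with rfl | rfl <;> omega : κ ≤ C2)
            have k2 : (-C2 : ℝ) ≤ κ := by
              exact_mod_cast (by rcases hε with rfl | rfl <;> omega : -C2 ≤ κ)
            constructor <;> nlinarith
          have hnear : |R.fr - ξ| ≤ 5 * pw R.I.1 := by
            have := abs_sub_le R.fr Q.fr ξ
            rw [abs_sub_comm R.fr Q.fr] at this
            linarith
          rcases dI_sub_or_disj (I := R.I) (J := J) (by
            have := scale_le_of_sub hin.1; omega) with h | h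
          · exact absurd ⟨h, hnear⟩ hnot
          · exact h
      · rcases Finset.mem_insert.mp hu' with rfl | hu'
        · have hR : R ∈ T := hR
          have hv' := (hWv u hu).2
          have hsub := ((hWv u hu).1.trans h1sub)
          exact absurd (key_lt hε hv'.2.2.2.1 hv'.2.1 hv'.2.2.1 hL hQ hR (hsp Q (hsub hQ))
            (hsp R (hTQ hR)) hs hn) (not_lt.mpr (hmax' _ hsub _ _ _ hv'))
        · exact hW.sd u hu u' hu' Q hQ R hR hs hn
    · intro u hu
      rcases Finset.mem_insert.mp hu with rfl | hu
      · exact ⟨hTQ, hv⟩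
      · exact ⟨(hWv u hu).1.trans h1sub, (hWv u hu).2⟩
    · intro Q hQ hQ'
      by_cases h1 : Q ∈ 𝒬₁
      · obtain ⟨u, hu, κ', h⟩ := hrem Q h1 hQ'
        exact ⟨u, Finset.mem_insert_of_mem hu, κ', h⟩
      · refine ⟨t, Finset.mem_insert_self _ _, ?_⟩
        rw [h𝒬₁, Finset.mem_filter, not_and, not_and_or, not_not, not_not] at h1
        rcases h1 hQ with h | h
        · refine ⟨κ, ?_, hv.2.2.2.1 Q h⟩
          obtain ⟨-, k7, kC, -⟩ := hv
          rw [abs_le]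
          rcases hε with rfl | rfl <;> constructor <;> omega
        · refine ⟨Q.v - ⌊pw (-Q.I.1) * ξ⌋, ?_, h.1, by ring⟩
          have hp := pw_pos Q.I.1
          have h3 := h.2
          have e : Q.fr - ξ = pw Q.I.1 * (Q.v - pw (-Q.I.1) * ξ) := by
            unfold Tile.fr
            rw [mul_sub, ← mul_assoc, pw_mul_neg, one_mul]
          rw [e, abs_mul, abs_of_pos hp, mul_comm] at h3
          have h4 := abs_le.mp (le_of_mul_le_mul_right h3 hp)
          have h1 := Int.floor_le (pw (-Q.I.1) * ξ)
          have h2 := Int.lt_floor_add_one (pw (-Q.I.1) * ξ)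
          rw [abs_le]
          constructor
          · have : (-6 : ℝ) ≤ ((Q.v - ⌊pw (-Q.I.1) * ξ⌋ : ℤ) : ℝ) := by push_cast; linarith
            have : -6 ≤ Q.v - ⌊pw (-Q.I.1) * ξ⌋ := by exact_mod_cast this
            omega
          · have : ((Q.v - ⌊pw (-Q.I.1) * ξ⌋ : ℤ) : ℝ) ≤ 6 := by push_cast; linarith
            have : Q.v - ⌊pw (-Q.I.1) * ξ⌋ ≤ 6 := by exact_mod_cast this
            omega

/-- size bound -/
def SizeLe (D : Finset Dy) (a : Tile → ℝ) (C2 : ℤ) (𝒬 : Finset Tile) (lam : ℝ) : Prop :=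
  ∀ J ∈ D, ∀ (ξ : ℝ) (κ : ℤ), 7 ≤ |κ| → |κ| ≤ C2 → ∀ T ⊆ 𝒬, (∀ Q ∈ T, InTree J ξ κ Q) →
    ∑ Q ∈ T, len Q.I * a Q ^ 2 ≤ lam ^ 2 * len J

lemma SizeLe.mono {𝒬 𝒬' : Finset Tile} {lam : ℝ} (h : SizeLe D a C2 𝒬 lam) (hs : 𝒬' ⊆ 𝒬) :
    SizeLe D a C2 𝒬' lam := fun J hJ ξ κ h7 hC T hT => h J hJ ξ κ h7 hC T (hT.trans hs)

lemma SizeLe.single {𝒬 : Finset Tile} {lam : ℝ} (h : SizeLe D a C2 𝒬 lam) (hlam : 0 ≤ lam)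
    (hC : 7 ≤ C2) {Q : Tile} (hQ : Q ∈ 𝒬) (hD : Q.I ∈ D) : a Q ≤ lam := by
  have h1 := h Q.I hD (pw Q.I.1 * ((Q.v - 7 : ℤ) : ℝ)) 7 (by norm_num) (by simpa using hC) {Q}
    (by simpa using hQ) (by
      intro R hR
      rw [Finset.mem_singleton] at hR
      subst hR
      refine ⟨le_rfl, ?_⟩
      rw [← mul_assoc, pw_neg_mul, one_mul, Int.floor_intCast]; ring)
  rw [Finset.sum_singleton, mul_comm] at h1
  exact le_trans (le_abs_self _) (abs_le_of_sq_le_sq (le_of_mul_le_mul_right h1 (len_pos _)) hlam)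

/-- forest packing hypothesis -/
def Pack (D : Finset Dy) (a : Tile → ℝ) (𝒬 : Finset Tile) (e : ℝ) : Prop :=
  ∀ (lam : ℝ) (W : Finset Tre), 0 < lam → SDF a lam W → (∀ t ∈ W, t.T ⊆ 𝒬) → ∀ K ∈ D,
    (∀ t ∈ W, dI t.J ⊆ dI K) → lam ^ 2 * ∑ t ∈ W, len t.J ≤ e * len K

lemma SDF.subset {lam : ℝ} {W W' : Finset Tre} (h : SDF a lam W) (hs : W' ⊆ W) : SDF a lam W' :=
  ⟨fun t ht => h.tree t (hs ht), fun t ht t' ht' => h.disj t (hs ht) t' (hs ht'),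
    fun t ht => h.big t (hs ht), fun t ht => h.small t (hs ht),
    fun t ht t' ht' => h.sd t (hs ht) t' (hs ht')⟩

lemma selection (hL : (C2 : ℝ) + 1 < pw L) (hC : 7 ≤ C2) {lam e : ℝ}
    (hlam : 0 < lam) {𝒬 : Finset Tile} (hsp : ∀ Q ∈ 𝒬, Sparse L s₀ r Q) (hD : ∀ Q ∈ 𝒬, Q.I ∈ D)
    (hsz : SizeLe D a C2 𝒬 (2 * lam)) (hP : Pack D a 𝒬 e) :
    ∃ (W : Finset Tre) (𝒬' : Finset Tile), 𝒬' ⊆ 𝒬 ∧ SizeLe D a C2 𝒬' lam ∧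
      (∀ t ∈ W, t.J ∈ D) ∧
      (∀ K ∈ D, lam ^ 2 * ∑ t ∈ W with dI t.J ⊆ dI K, len t.J ≤ 2 * e * len K) ∧
      (∀ Q ∈ 𝒬, Q ∉ 𝒬' → ∃ t ∈ W, ∃ κ : ℤ, |κ| ≤ C2 ∧ InTree t.J t.ξ κ Q) := by
  have hsm : ∀ Q ∈ 𝒬, a Q ≤ 2 * lam := fun Q hQ => hsz.single (by linarith) hC hQ (hD Q hQ)
  obtain ⟨W₁, 𝒬₁, hs1, hS1, hv1, hn1, hr1⟩ := greedy (D := D) (a := a) (ε := 1) (Or.inl rfl) hL hC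
    hlam _ 𝒬 le_rfl hsp hsm
  obtain ⟨W₂, 𝒬₂, hs2, hS2, hv2, hn2, hr2⟩ := greedy (D := D) (a := a) (ε := -1) (Or.inr rfl) hL hC
    hlam _ 𝒬₁ le_rfl (fun Q h => hsp Q (hs1 h)) (fun Q h => hsm Q (hs1 h))
  refine ⟨W₁ ∪ W₂, 𝒬₂, hs2.trans hs1, ?_, ?_, ?_, ?_⟩
  · intro J hJ ξ κ h7 hC T hT hin
    by_contra hcon
    push Not at hcon
    rcases le_abs.mp h7 with h | h
    · exact hn1 T (hT.trans hs2) J ξ κ ⟨hJ, by omega, by rw [abs_of_nonneg (by omega)] at hC; omega,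
        hin, hcon.le⟩
    · exact hn2 T hT J ξ κ ⟨hJ, by omega, by rw [abs_of_nonpos (by omega)] at hC; omega,
        hin, hcon.le⟩
  · intro t ht
    rcases Finset.mem_union.mp ht with ht | ht
    · exact (hv1 t ht).2.1
    · exact (hv2 t ht).2.1
  · intro K hK
    have p1 := hP lam (W₁.filter fun t => dI t.J ⊆ dI K) hlam (hS1.subset (Finset.filter_subset _ _))
      (fun t ht => (hv1 t (Finset.mem_filter.mp ht).1).1) K hK
      (fun t ht => (Finset.mem_filter.mp ht).2)
    have p2 := hP lam (W₂.filter fun t => dI t.J ⊆ dI K) hlam (hS2.subset (Finset.filter_subset _ _))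
      (fun t ht => (hv2 t (Finset.mem_filter.mp ht).1).1.trans hs1) K hK
      (fun t ht => (Finset.mem_filter.mp ht).2)
    have p3 : ∑ t ∈ W₁ ∪ W₂ with dI t.J ⊆ dI K, len t.J ≤
        ∑ t ∈ W₁ with dI t.J ⊆ dI K, len t.J + ∑ t ∈ W₂ with dI t.J ⊆ dI K, len t.J := by
      rw [Finset.filter_union, ← Finset.sum_union_inter]
      have : 0 ≤ ∑ t ∈ (W₁.filter fun t => dI t.J ⊆ dI K) ∩ (W₂.filter fun t => dI t.J ⊆ dI K),
        len t.J := Finset.sum_nonneg fun t _ => (len_pos _).le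
      linarith
    have := mul_le_mul_of_nonneg_left p3 (sq_nonneg lam)
    linarith
  · intro Q hQ hQ2
    by_cases h : Q ∈ 𝒬₁
    · obtain ⟨t, ht, h⟩ := hr2 Q h hQ2
      exact ⟨t, Finset.mem_union_right _ ht, h⟩
    · obtain ⟨t, ht, h⟩ := hr1 Q hQ h
      exact ⟨t, Finset.mem_union_left _ ht, h⟩

/-- iterated selection -/
lemma levels (hL : (C2 : ℝ) + 1 < pw L) (hC : 7 ≤ C2) {σ e : ℝ}
    (hσ : 0 < σ) {𝒬 : Finset Tile} (hsp : ∀ Q ∈ 𝒬, Sparse L s₀ r Q) (hD : ∀ Q ∈ 𝒬, Q.I ∈ D)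
    (hsz : SizeLe D a C2 𝒬 σ) (hP : Pack D a 𝒬 e) :
    ∃ (lev : Tile → ℕ) (W : ℕ → Finset Tre), ∀ m : ℕ,
      SizeLe D a C2 (𝒬.filter fun Q => 0 < a Q ∧ lev Q = m) (σ / 2 ^ m) ∧
      (∀ t ∈ W m, t.J ∈ D) ∧
      (∀ K ∈ D, ∑ t ∈ W m with dI t.J ⊆ dI K, len t.J ≤ 8 * e * 4 ^ m / σ ^ 2 * len K) ∧
      (∀ Q ∈ 𝒬, 0 < a Q → lev Q = m → ∃ t ∈ W m, ∃ κ : ℤ, |κ| ≤ C2 ∧ InTree t.J t.ξ κ Q) := by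
  have step : ∀ (m : ℕ) (X : {X : Finset Tile // X ⊆ 𝒬 ∧ SizeLe D a C2 X (σ / 2 ^ m)}),
      ∃ (W : Finset Tre) (Y : {X : Finset Tile // X ⊆ 𝒬 ∧ SizeLe D a C2 X (σ / 2 ^ (m + 1))}),
      (∀ t ∈ W, t.J ∈ D) ∧
      (∀ K ∈ D, (σ / 2 ^ (m + 1)) ^ 2 * ∑ t ∈ W with dI t.J ⊆ dI K, len t.J ≤ 2 * e * len K) ∧
      (∀ Q ∈ X.1, Q ∉ Y.1 → ∃ t ∈ W, ∃ κ : ℤ, |κ| ≤ C2 ∧ InTree t.J t.ξ κ Q) := by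
    rintro m ⟨X, hX, hs⟩
    obtain ⟨W, Y, h1, h2, h3, h4, h5⟩ := selection (lam := σ / 2 ^ (m + 1)) hL hC (by positivity)
      (fun Q h => hsp Q (hX h)) (fun Q h => hD Q (hX h)) (by
        convert hs using 1; rw [pow_succ]; field_simp)
      (e := e) (fun lam W h0 hS hsub => hP lam W h0 hS fun t ht => (hsub t ht).trans hX)
    exact ⟨W, ⟨Y, h1.trans hX, h2⟩, h3, h4, h5⟩
  choose W Y hY using step
  let X : (m : ℕ) → {X : Finset Tile // X ⊆ 𝒬 ∧ SizeLe D a C2 X (σ / 2 ^ m)} := fun m =>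
    Nat.rec ⟨𝒬, le_rfl, by simpa using hsz⟩ (fun m X => Y m X) m
  have hX : ∀ m, X (m + 1) = Y m (X m) := fun m => rfl
  have hX0 : (X 0).1 = 𝒬 := rfl
  have hex : ∀ Q ∈ 𝒬, 0 < a Q → ∃ m, Q ∉ (X m).1 := by
    intro Q hQ ha
    by_contra hcon
    push Not at hcon
    have h1 : ∀ m : ℕ, a Q ≤ σ / 2 ^ m := fun m =>
      (X m).2.2.single (by positivity) hC (hcon m) (hD Q hQ)
    have h2 : Filter.Tendsto (fun m : ℕ => σ / 2 ^ m) Filter.atTop (nhds 0) := by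
      have := (tendsto_pow_atTop_nhds_zero_of_lt_one (r := (1 / 2 : ℝ)) (by norm_num)
        (by norm_num)).const_mul σ
      simpa [div_eq_mul_inv] using this
    exact absurd (ge_of_tendsto' h2 h1) (not_le.mpr ha)
  let lev : Tile → ℕ := fun Q => if h : ∃ m, Q ∉ (X (m + 1)).1 then Nat.find h else 0
  have hlev : ∀ Q ∈ 𝒬, 0 < a Q → Q ∈ (X (lev Q)).1 ∧ Q ∉ (X (lev Q + 1)).1 := by
    intro Q hQ ha
    have h : ∃ m, Q ∉ (X (m + 1)).1 := by
      obtain ⟨m, hm⟩ := hex Q hQ ha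
      cases m with
      | zero => exact absurd (by rwa [hX0]) hm
      | succ m => exact ⟨m, hm⟩
    have hl : lev Q = Nat.find h := dif_pos h
    rw [hl]
    refine ⟨?_, Nat.find_spec h⟩
    rcases hn : Nat.find h with _ | m
    · rwa [hX0]
    · by_contra hc
      exact Nat.find_min h (by omega : m < Nat.find h) hc
  refine ⟨lev, fun m => W m (X m), fun m => ?_⟩
  obtain ⟨y1, y2, y3⟩ := hY m (X m)
  refine ⟨?_, y1, ?_, ?_⟩
  · apply (X m).2.2.mono
    intro Q hQ
    obtain ⟨hQ1, ha, rfl⟩ := Finset.mem_filter.mp hQ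
    exact (hlev Q hQ1 ha).1
  · intro K hK
    have h := y2 K hK
    have hl : (0:ℝ) < (σ / 2 ^ (m + 1)) ^ 2 := by positivity
    rw [mul_comm, ← le_div_iff₀ hl] at h
    refine h.trans_eq ?_
    rw [show (4:ℝ) ^ m = (2 ^ m) ^ 2 by rw [← pow_mul, mul_comm, pow_mul]; norm_num]
    rw [pow_succ]
    field_simp
    ring
  · rintro Q hQ ha rfl
    exact y3 Q (hlev Q hQ ha).1 (by rw [← hX]; exact (hlev Q hQ ha).2)
end
end

noncomputable section

lemma sum_le_cover {α β : Type*} {S : Finset α} {X : Finset β} {f : α → ℝ} {h : β → ℝ} (g : β → α)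
    (hh : ∀ x ∈ X, 0 ≤ h x) (hc : ∀ τ ∈ S, f τ ≠ 0 → ∃ x ∈ X, g x = τ ∧ f τ ≤ h x) :
    ∑ τ ∈ S, f τ ≤ ∑ x ∈ X, h x := by
  calc ∑ τ ∈ S, f τ ≤ ∑ τ ∈ S, ∑ x ∈ X, if g x = τ then h x else 0 := by
        refine Finset.sum_le_sum fun τ hτ => ?_
        have hnn : ∀ x ∈ X, 0 ≤ if g x = τ then h x else 0 := fun x hx => by
          split_ifs
          · exact hh x hx
          · exact le_rfl
        by_cases h0 : f τ = 0
        · rw [h0]; exact Finset.sum_nonneg hnn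
        · obtain ⟨x, hx, e, hl⟩ := hc τ hτ h0
          refine le_trans ?_ (Finset.single_le_sum hnn hx)
          simpa [e] using hl
    _ = ∑ x ∈ X, ∑ τ ∈ S, if g x = τ then h x else 0 := Finset.sum_comm
    _ ≤ ∑ x ∈ X, h x := by
        refine Finset.sum_le_sum fun x hx => ?_
        rw [Finset.sum_ite_eq]
        split_ifs
        · exact le_rfl
        · exact hh x hx

section
variable {ι : Type*} [Fintype ι]

def tup (A : Finset ι) (W : ι → Finset Tre) (t0 : Tre) : Finset (ι → Tre) :=
  Fintype.piFinset fun i => if i ∈ A then W i else {t0}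

def inte (A : Finset ι) (τ : ι → Tre) : Set ℝ := ⋂ i ∈ A, dI (τ i).J

def below (K : Dy) (W : ι → Finset Tre) : ι → Finset Tre :=
  fun i => (W i).filter fun t => dI t.J ⊆ dI K

lemma mem_tup {A : Finset ι} {W : ι → Finset Tre} {t0 : Tre} {τ : ι → Tre} :
    τ ∈ tup A W t0 ↔ (∀ i ∈ A, τ i ∈ W i) ∧ ∀ i ∉ A, τ i = t0 := by
  unfold tup
  rw [Fintype.mem_piFinset]
  constructor
  · intro h
    refine ⟨fun i hi => by simpa [hi] using h i, fun i hi => by simpa [hi] using h i⟩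
  · rintro ⟨h1, h2⟩ i
    by_cases hi : i ∈ A
    · simpa [hi] using h1 i hi
    · simpa [hi] using h2 i hi

lemma mem_inte {A : Finset ι} {τ : ι → Tre} {x : ℝ} : x ∈ inte A τ ↔ ∀ i ∈ A, x ∈ dI (τ i).J := by
  unfold inte; simp

lemma vol_sub_le {X : Set ℝ} {K : Dy} (h : X ⊆ dI K) {Y : Set ℝ} (hY : X ⊆ Y) (hY2 : Y ⊆ dI K) :
    volume.real X ≤ volume.real Y := by
  refine measureReal_mono hY ?_
  have : volume Y ≤ volume (dI K) := measure_mono hY2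
  rw [dI_vol] at this
  exact ne_top_of_le_ne_top ENNReal.ofReal_ne_top this

lemma count_K {D : Finset Dy} {Dd : ι → ℝ} (W : ι → Finset Tre) (t0 : Tre)
    (hWD : ∀ i, ∀ t ∈ W i, t.J ∈ D) (hDd : ∀ i, 0 ≤ Dd i)
    (hp : ∀ i, ∀ K ∈ D, ∑ t ∈ W i with dI t.J ⊆ dI K, len t.J ≤ Dd i * len K) :
    ∀ (N : ℕ) (A : Finset ι), A.card = N → ∀ K ∈ D,
    ∑ τ ∈ tup A (below K W) t0, volume.real (dI K ∩ inte A τ) ≤ N.factorial * (∏ i ∈ A, Dd i) * len K := by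
  intro N
  induction N with
  | zero =>
    intro A hA K hK
    have : A = ∅ := by simpa using hA
    subst this
    have h1 : tup (∅ : Finset ι) (below K W) t0 = {fun _ => t0} := by
      ext τ
      rw [mem_tup, Finset.mem_singleton]
      simp [funext_iff]
    rw [h1, Finset.sum_singleton]
    simp [inte, dI_vol_real]
  | succ N ih =>
    intro A hA K hK
    set X : Finset (Σ _ : ι, Σ _ : Tre, ι → Tre) := A.sigma fun j => (below K W j).sigma fun t =>
      tup (A.erase j) (below t.J W) t0 with hX
    have h1 : ∑ τ ∈ tup A (below K W) t0, volume.real (dI K ∩ inte A τ) ≤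
        ∑ x ∈ X, volume.real (dI x.2.1.J ∩ inte (A.erase x.1) x.2.2) := by
      apply sum_le_cover (fun x => Function.update x.2.2 x.1 x.2.1)
      · intro x _; exact measureReal_nonneg
      · intro τ hτ h0
        rw [mem_tup] at hτ
        have hne : (dI K ∩ inte A τ).Nonempty := by
          by_contra h
          rw [Set.not_nonempty_iff_eq_empty] at h
          rw [h] at h0; simp at h0
        obtain ⟨x, hxK, hx⟩ := hne
        rw [mem_inte] at hx
        obtain ⟨j, hj, hmin⟩ := Finset.exists_min_image A (fun i => (τ i).J.1)
          (Finset.card_pos.mp (by omega))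
        refine ⟨⟨j, τ j, Function.update τ j t0⟩, ?_, ?_, ?_⟩
        · rw [hX, Finset.mem_sigma, Finset.mem_sigma]
          refine ⟨hj, hτ.1 j hj, ?_⟩
          rw [mem_tup]
          dsimp only
          constructor
          · intro i hi
            rw [Finset.mem_erase] at hi
            rw [Function.update_of_ne hi.1]
            have := hτ.1 i hi.2
            unfold below at this ⊢
            rw [Finset.mem_filter] at this ⊢
            exact ⟨this.1, dI_sub_of_mem (hmin i hi.2) (hx i hi.2) (hx j hj)⟩
          · intro i hi
            rw [Finset.mem_erase, not_and_or, not_not] at hi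
            by_cases hij : i = j
            · subst hij; simp
            · rw [Function.update_of_ne hij]
              exact hτ.2 i (by tauto)
        · simp
        · have hsub : dI K ∩ inte A τ ⊆ dI (τ j).J ∩ inte (A.erase j) (Function.update τ j t0) := by
            intro y hy
            have hy2 := mem_inte.mp hy.2
            refine ⟨hy2 j hj, mem_inte.mpr fun i hi => ?_⟩
            rw [Finset.mem_erase] at hi
            rw [Function.update_of_ne hi.1]
            exact hy2 i hi.2
          exact vol_sub_le (K := (τ j).J) (hsub.trans Set.inter_subset_left) hsub
            Set.inter_subset_left
    refine h1.trans ?_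
    rw [hX, Finset.sum_sigma]
    have h2 : ∀ j ∈ A, ∑ s ∈ (below K W j).sigma (fun t => tup (A.erase j) (below t.J W) t0),
        volume.real (dI s.1.J ∩ inte (A.erase j) s.2) ≤
        N.factorial * (∏ i ∈ A, Dd i) * len K := by
      intro j hj
      rw [Finset.sum_sigma]
      calc _ ≤ ∑ t ∈ below K W j, N.factorial * (∏ i ∈ A.erase j, Dd i) * len t.J := by
            refine Finset.sum_le_sum fun t ht => ?_
            exact ih (A.erase j) (by rw [Finset.card_erase_of_mem hj]; omega) t.J
              (hWD j t (Finset.mem_filter.mp ht).1)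
        _ = N.factorial * (∏ i ∈ A.erase j, Dd i) * ∑ t ∈ below K W j, len t.J := by
            rw [Finset.mul_sum]
        _ ≤ N.factorial * (∏ i ∈ A.erase j, Dd i) * (Dd j * len K) := by
            apply mul_le_mul_of_nonneg_left (hp j K hK)
            exact mul_nonneg (by positivity) (Finset.prod_nonneg fun i _ => hDd i)
        _ = _ := by
            rw [← Finset.mul_prod_erase A Dd hj]; ring
    refine (Finset.sum_le_sum h2).trans_eq ?_
    rw [Finset.sum_const, hA, nsmul_eq_mul, Nat.factorial_succ]
    push_cast
    ring

/-- maximal intervals -/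
def maxi (D : Finset Dy) : Finset Dy := D.filter fun K => ∀ K' ∈ D, dI K ⊆ dI K' → K' = K

def UU (D : Finset Dy) : Set ℝ := ⋃ I ∈ D, dI I

lemma UU_meas (D : Finset Dy) : MeasurableSet (UU D) :=
  Finset.measurableSet_biUnion _ fun I _ => dI_meas I

lemma UU_fin (D : Finset Dy) : volume (UU D) ≠ ⊤ := by
  unfold UU
  refine ne_top_of_le_ne_top ?_ (measure_biUnion_finset_le D dI)
  simp [dI_vol]

lemma dy_eq_of_sub {I J : Dy} (h : dI I ⊆ dI J) (h' : dI J ⊆ dI I) : I = J := by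
  have h1 := scale_le_of_sub h
  have h2 := scale_le_of_sub h'
  obtain ⟨x, hx⟩ := dI_nonempty I
  have e1 := (mem_dI).mp hx
  have e2 := (mem_dI).mp (h hx)
  have e : I.1 = J.1 := le_antisymm h2 h1
  rw [← e, e1] at e2
  exact Prod.ext e e2

lemma exists_maxi {D : Finset Dy} {I : Dy} (hI : I ∈ D) : ∃ K ∈ maxi D, dI I ⊆ dI K := by
  obtain ⟨K, hK, hmin⟩ := Finset.exists_min_image (D.filter fun K => dI I ⊆ dI K) (fun K => K.1)
    ⟨I, Finset.mem_filter.mpr ⟨hI, le_rfl⟩⟩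
  rw [Finset.mem_filter] at hK
  refine ⟨K, ?_, hK.2⟩
  unfold maxi
  rw [Finset.mem_filter]
  refine ⟨hK.1, fun K' hK' hs => ?_⟩
  have h1 := hmin K' (Finset.mem_filter.mpr ⟨hK', hK.2.trans hs⟩)
  obtain ⟨x, hx⟩ := dI_nonempty K
  exact dy_eq_of_sub (dI_sub_of_mem h1 (hs hx) hx) hs

lemma sum_maxi (D : Finset Dy) : ∑ K ∈ maxi D, len K ≤ volume.real (UU D) := by
  have hd : (maxi D : Set Dy).PairwiseDisjoint dI := by
    intro K hK K' hK' hne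
    rw [Finset.mem_coe] at hK hK'
    unfold maxi at hK hK'
    rw [Finset.mem_filter] at hK hK'
    rw [Function.onFun, Set.disjoint_left]
    intro x hx hx'
    rcases le_total K.1 K'.1 with h | h
    · exact hne (hK'.2 K hK.1 (dI_sub_of_mem h hx' hx))
    · exact hne (hK.2 K' hK'.1 (dI_sub_of_mem h hx hx')).symm
  have h1 : volume.real (⋃ K ∈ maxi D, dI K) = ∑ K ∈ maxi D, len K := by
    rw [measureReal_biUnion_finset hd (fun K _ => dI_meas K) (by intro K _; simp [dI_vol])]
    exact Finset.sum_congr rfl fun K _ => dI_vol_real K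
  rw [← h1]
  apply measureReal_mono _ (UU_fin D)
  unfold UU
  exact Set.biUnion_subset_biUnion_left fun K hK => (Finset.mem_filter.mp hK).1

lemma count_U {D : Finset Dy} {Dd : ι → ℝ} (W : ι → Finset Tre) (t0 : Tre)
    (hWD : ∀ i, ∀ t ∈ W i, t.J ∈ D) (hDd : ∀ i, 0 ≤ Dd i)
    (hp : ∀ i, ∀ K ∈ D, ∑ t ∈ W i with dI t.J ⊆ dI K, len t.J ≤ Dd i * len K)
    (A : Finset ι) (hA : A.Nonempty) :
    ∑ τ ∈ tup A W t0, volume.real (inte A τ) ≤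
      A.card.factorial * (∏ i ∈ A, Dd i) * volume.real (UU D) := by
  set X : Finset (Σ _ : Dy, ι → Tre) := (maxi D).sigma fun K => tup A (below K W) t0 with hX
  have h1 : ∑ τ ∈ tup A W t0, volume.real (inte A τ) ≤
      ∑ x ∈ X, volume.real (dI x.1 ∩ inte A x.2) := by
    apply sum_le_cover (fun x => x.2)
    · intro x _; exact measureReal_nonneg
    · intro τ hτ h0
      rw [mem_tup] at hτ
      have hne : (inte A τ).Nonempty := by
        by_contra h
        rw [Set.not_nonempty_iff_eq_empty] at h
        rw [h] at h0; simp at h0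
      obtain ⟨x, hx⟩ := hne
      rw [mem_inte] at hx
      obtain ⟨j, hj, hmin⟩ := Finset.exists_min_image A (fun i => (τ i).J.1) hA
      obtain ⟨K, hK, hjK⟩ := exists_maxi (hWD j (τ j) (hτ.1 j hj))
      have hall : ∀ i ∈ A, dI (τ i).J ⊆ dI K := fun i hi =>
        (dI_sub_of_mem (hmin i hi) (hx i hi) (hx j hj)).trans hjK
      refine ⟨⟨K, τ⟩, ?_, rfl, ?_⟩
      · rw [hX, Finset.mem_sigma, mem_tup]
        refine ⟨hK, fun i hi => Finset.mem_filter.mpr ⟨hτ.1 i hi, hall i hi⟩, hτ.2⟩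
      · apply le_of_eq
        congr 1
        rw [eq_comm, Set.inter_eq_right]
        intro y hy
        exact hall j hj (mem_inte.mp hy j hj)
  refine h1.trans ?_
  rw [hX, Finset.sum_sigma]
  calc _ ≤ ∑ K ∈ maxi D, A.card.factorial * (∏ i ∈ A, Dd i) * len K := by
        refine Finset.sum_le_sum fun K hK => ?_
        exact count_K W t0 hWD hDd hp _ A rfl K (Finset.mem_filter.mp hK).1
    _ = A.card.factorial * (∏ i ∈ A, Dd i) * ∑ K ∈ maxi D, len K := by rw [Finset.mul_sum]
    _ ≤ _ := by
        apply mul_le_mul_of_nonneg_left (sum_maxi D)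
        exact mul_nonneg (by positivity) (Finset.prod_nonneg fun i _ => hDd i)
end
end

noncomputable section

/-- multitiles -/
structure MT (n : ℕ) where
  I : Dy
  v : Fin n → ℤ

def MT.t {n : ℕ} (P : MT n) (i : Fin n) : Tile := ⟨P.I, P.v i⟩

def kap {n : ℕ} (P : MT n) (i : Fin n) (x : ℝ) : ℤ := P.v i - ⌊pw (-P.I.1) * x⌋

/-- geometric consequences of nondegeneracy -/
structure Geo (n k : ℕ) (C2 C3 : ℤ) (ℙ : Finset (MT n))
    (ext : Finset (Fin n) → (Fin n → ℝ) → Fin n → ℝ) : Prop where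
  agree : ∀ A : Finset (Fin n), A.card = k → ∀ x, ∀ i ∈ A, ext A x i = x i
  c3 : ∀ A : Finset (Fin n), A.card = k → ∀ x, ∀ P ∈ ℙ, (∀ i ∈ A, |kap P i (x i)| ≤ C2) →
    ∀ i, |kap P i (ext A x i)| ≤ C3
  c2 : ∀ A : Finset (Fin n), A.card = k → ∀ x, ∀ P ∈ ℙ, (∀ i ∈ A, |kap P i (x i)| ≤ 6) →
    ∀ i, |kap P i (ext A x i)| ≤ C2
  two : ∀ A : Finset (Fin n), A.card = k → ∀ x, ∀ P ∈ ℙ, (∀ i ∈ A, |kap P i (x i)| ≤ 6) →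
    ∃ i i', i ≠ i' ∧ 7 ≤ |kap P i (ext A x i)| ∧ 7 ≤ |kap P i' (ext A x i')|

section
variable {n k : ℕ} {C2 C3 : ℤ} {ℙ : Finset (MT n)}
  {ext : Finset (Fin n) → (Fin n → ℝ) → Fin n → ℝ} {D : Finset Dy} {a : Fin n → Tile → ℝ}

def tau (A : Finset (Fin n)) (t0 : Tre) (tp : Fin n → MT n → Tre) (P : MT n) : Fin n → Tre :=
  fun i => if i ∈ A then tp i P else t0

/-- offset of `P` with respect to the extended frequency -/
def kv (ext : Finset (Fin n) → (Fin n → ℝ) → Fin n → ℝ) (A : Finset (Fin n)) (t0 : Tre)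
    (tp : Fin n → MT n → Tre) (P : MT n) (i : Fin n) : ℤ :=
  kap P i (ext A (fun i => (tau A t0 tp P i).ξ) i)

lemma good_sum (hg : Geo n k C2 C3 ℙ ext) {A : Finset (Fin n)} (hA : A.card = k) (hk : 1 ≤ k)
    (t0 : Tre) {tp : Fin n → MT n → Tre} {W : Fin n → Finset Tre} {X : Finset (MT n)} (hX : X ⊆ ℙ)
    (hW : ∀ i, ∀ t ∈ W i, t.J ∈ D)
    (htp : ∀ i, ∀ P ∈ X, tp i P ∈ W i ∧ dI P.I ⊆ dI (tp i P).J ∧ |kap P i (tp i P).ξ| ≤ C2)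
    {lam : ℝ} (i : Fin n) (hsz : SizeLe D (a i) C2 (X.image fun P => P.t i) lam) :
    ∑ P ∈ X with (7 ≤ |kv ext A t0 tp P i| ∧ |kv ext A t0 tp P i| ≤ C2), len P.I * a i (P.t i) ^ 2 ≤
      (2 * (C3.toNat : ℝ) + 1) ^ n * lam ^ 2 * ∑ τ ∈ tup A W t0, volume.real (inte A τ) := by
  set S := X.filter fun P => (7 ≤ |kv ext A t0 tp P i| ∧ |kv ext A t0 tp P i| ≤ C2) with hS
  have hne : A.Nonempty := Finset.card_pos.mp (by omega)
  set V : Finset (Fin n → ℤ) := Fintype.piFinset fun _ => Finset.Icc (-C3.toNat : ℤ) C3.toNat with hV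
  have hVc : (V.card : ℝ) = (2 * (C3.toNat : ℝ) + 1) ^ n := by
    rw [hV, Fintype.card_piFinset]
    simp only [Int.card_Icc, Finset.prod_const, Finset.card_univ, Fintype.card_fin]
    push_cast
    congr 1
    have : ((C3.toNat : ℤ) + 1 - -(C3.toNat : ℤ)).toNat = 2 * C3.toNat + 1 := by omega
    rw [this]; push_cast; ring
  have hmaps : ∀ P ∈ S, (tau A t0 tp P, kv ext A t0 tp P) ∈ tup A W t0 ×ˢ V := by
    intro P hP
    have hPX := (Finset.mem_filter.mp hP).1
    rw [Finset.mem_product, mem_tup, hV, Fintype.mem_piFinset]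
    refine ⟨⟨fun i hi => ?_, fun i hi => ?_⟩, fun i => ?_⟩
    · simp only [tau, if_pos hi]; exact (htp i P hPX).1
    · simp only [tau, if_neg hi]
    · have h := hg.c3 A hA (fun i => (tau A t0 tp P i).ξ) P (hX hPX) (by
        intro j hj
        simp only [tau, if_pos hj]; exact (htp j P hPX).2.2) i
      have h2 : |kv ext A t0 tp P i| ≤ C3 := h
      rw [Finset.mem_Icc]
      have := Int.self_le_toNat C3
      rw [abs_le] at h2
      show -(C3.toNat : ℤ) ≤ kv ext A t0 tp P i ∧ kv ext A t0 tp P i ≤ C3.toNat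
      constructor <;> omega
  rw [← Finset.sum_fiberwise_of_maps_to hmaps]
  have hfib : ∀ y ∈ tup A W t0 ×ˢ V, ∑ P ∈ S with (tau A t0 tp P, kv ext A t0 tp P) = y,
      len P.I * a i (P.t i) ^ 2 ≤ lam ^ 2 * volume.real (inte A y.1) := by
    rintro ⟨τ, κ⟩ hy
    set F := S.filter fun P => (tau A t0 tp P, kv ext A t0 tp P) = (τ, κ) with hF
    have hFm : ∀ P ∈ F, P ∈ X ∧ tau A t0 tp P = τ ∧ kv ext A t0 tp P = κ ∧ 7 ≤ |κ i| ∧ |κ i| ≤ C2 := by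
      intro P hP
      rw [hF, hS, Finset.mem_filter, Finset.mem_filter, Prod.mk.injEq] at hP
      refine ⟨hP.1.1, hP.2.1, hP.2.2, ?_⟩
      rw [← hP.2.2]; exact hP.1.2
    rcases F.eq_empty_or_nonempty with h0 | ⟨P0, hP0⟩
    · rw [h0, Finset.sum_empty]
      exact mul_nonneg (sq_nonneg _) measureReal_nonneg
    obtain ⟨j, hj, hmax⟩ := Finset.exists_max_image A (fun i => (τ i).J.1) hne
    have hIτ : ∀ P ∈ F, ∀ i ∈ A, dI P.I ⊆ dI (τ i).J := by
      intro P hP i hi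
      obtain ⟨h1, h2, -⟩ := hFm P hP
      have := (htp i P h1).2.1
      rw [← h2]; simpa only [tau, if_pos hi] using this
    have hinj : Set.InjOn (fun P : MT n => P.t i) F := by
      intro P hP P' hP' h
      obtain ⟨-, h2, h3, -⟩ := hFm P hP
      obtain ⟨-, h2', h3', -⟩ := hFm P' hP'
      have hI : P.I = P'.I := congrArg Tile.I h
      have hv : P.v = P'.v := by
        ext l
        have e := congrFun (h3.trans h3'.symm) l
        unfold kv kap at e
        rw [h2, h2', hI] at e
        omega
      cases P; cases P'; simp_all
    have hJ : (τ j).J ∈ D := by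
      rw [Finset.mem_product, mem_tup] at hy
      exact hW j _ (hy.1.1 j hj)
    have hb := hsz (τ j).J hJ (ext A (fun i => (τ i).ξ) i) (κ i) (hFm P0 hP0).2.2.2.1
      (hFm P0 hP0).2.2.2.2 (F.image fun P => P.t i)
      (Finset.image_subset_image fun P hP => (hFm P hP).1) (by
        intro Q hQ
        obtain ⟨P, hP, rfl⟩ := Finset.mem_image.mp hQ
        obtain ⟨-, h2, h3, -⟩ := hFm P hP
        refine ⟨hIτ P hP j hj, ?_⟩
        rw [← h3]
        unfold kv kap
        rw [h2]
        show P.v i = _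
        simp [MT.t])
    rw [Finset.sum_image hinj] at hb
    refine hb.trans (mul_le_mul_of_nonneg_left ?_ (sq_nonneg _))
    rw [← dI_vol_real]
    obtain ⟨x, hx⟩ := dI_nonempty P0.I
    apply vol_sub_le (K := (τ j).J) le_rfl
    · intro y hy
      rw [mem_inte]
      intro l hl
      exact dI_sub_of_mem (hmax l hl) (hIτ P0 hP0 j hj hx) (hIτ P0 hP0 l hl hx) hy
    · intro y hy
      exact mem_inte.mp hy j hj
  refine (Finset.sum_le_sum hfib).trans_eq ?_
  rw [Finset.sum_product, ← hVc]
  simp only [Finset.sum_const, nsmul_eq_mul]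
  rw [← Finset.mul_sum, ← Finset.mul_sum]
  ring

lemma level_bound (hg : Geo n k C2 C3 ℙ ext) {A A' : Finset (Fin n)} (hA : A.card = k)
    (hA' : A'.card = k) (hd : Disjoint A A') (hk : 1 ≤ k) (hC27 : 7 ≤ C2)
    (t0 : Tre) {tp : Fin n → MT n → Tre} {W : Fin n → Finset Tre} {X : Finset (MT n)} (hX : X ⊆ ℙ)
    (hW : ∀ i, ∀ t ∈ W i, t.J ∈ D) (ha : ∀ i Q, 0 ≤ a i Q)
    (htp : ∀ i, ∀ P ∈ X, tp i P ∈ W i ∧ dI P.I ⊆ dI (tp i P).J ∧ |kap P i (tp i P).ξ| ≤ C2)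
    {lam : Fin n → ℝ} (hlam : ∀ i, 0 ≤ lam i) (hXD : ∀ P ∈ X, P.I ∈ D)
    (hsz : ∀ i, SizeLe D (a i) C2 (X.image fun P => P.t i) (lam i)) :
    ∑ P ∈ X, len P.I * ∏ i, a i (P.t i) ≤
      n ^ 2 * ((2 * (C3.toNat : ℝ) + 1) ^ n * (∏ i, lam i) *
      √((∑ τ ∈ tup A W t0, volume.real (inte A τ)) * ∑ τ ∈ tup A' W t0, volume.real (inte A' τ))) := by
  set g : Finset (Fin n) → MT n → Fin n → Prop := fun A P i =>
    (7 ≤ |kv ext A t0 tp P i| ∧ |kv ext A t0 tp P i| ≤ C2) with hgd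
  have hgood : ∀ A : Finset (Fin n), A.card = k → ∀ P ∈ X, (∃ i ∈ A, g A P i) ∨
      ∃ i i', i ≠ i' ∧ g A P i ∧ g A P i' := by
    intro A hA P hP
    have hkv : ∀ i ∈ A, kv ext A t0 tp P i = kap P i (tp i P).ξ := by
      intro i hi
      unfold kv
      rw [hg.agree A hA _ i hi]
      simp only [tau, if_pos hi]
    by_cases h : ∀ i ∈ A, |kap P i (tp i P).ξ| ≤ 6
    · right
      have h' : ∀ i ∈ A, |kap P i (tau A t0 tp P i).ξ| ≤ 6 := by
        intro i hi; simp only [tau, if_pos hi]; exact h i hi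
      obtain ⟨i, i', hne, h1, h2⟩ := hg.two A hA (fun i => (tau A t0 tp P i).ξ) P (hX hP) h'
      have h3 := hg.c2 A hA (fun i => (tau A t0 tp P i).ξ) P (hX hP) h'
      exact ⟨i, i', hne, ⟨h1, h3 i⟩, ⟨h2, h3 i'⟩⟩
    · left
      push Not at h
      obtain ⟨i, hi, h⟩ := h
      refine ⟨i, hi, ?_⟩
      simp only [hgd]
      rw [hkv i hi]
      exact ⟨by omega, (htp i P hP).2.2⟩
  have hpair : ∀ P ∈ X, ∃ i i', i ≠ i' ∧ g A P i ∧ g A' P i' := by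
    intro P hP
    rcases hgood A hA P hP with ⟨i, hi, h⟩ | ⟨i1, i2, hne, h1, h2⟩
    · rcases hgood A' hA' P hP with ⟨i', hi', h'⟩ | ⟨j1, j2, hne', h1', h2'⟩
      · exact ⟨i, i', fun e => Finset.disjoint_left.mp hd hi (e ▸ hi'), h, h'⟩
      · by_cases e : i = j1
        · exact ⟨i, j2, e ▸ hne', h, h2'⟩
        · exact ⟨i, j1, e, h, h1'⟩
    · obtain ⟨j, hj⟩ : ∃ j, g A' P j := by
        rcases hgood A' hA' P hP with ⟨i', hi', h'⟩ | ⟨j1, j2, hne', h1', h2'⟩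
        · exact ⟨i', h'⟩
        · exact ⟨j1, h1'⟩
      by_cases e : i1 = j
      · exact ⟨i2, j, e ▸ hne.symm, h2, hj⟩
      · exact ⟨i1, j, e, h1, hj⟩
  set c := (2 * (C3.toNat : ℝ) + 1) ^ n with hc
  have hc0 : 0 ≤ c := by positivity
  set N1 := ∑ τ ∈ tup A W t0, volume.real (inte A τ) with hN1
  set N2 := ∑ τ ∈ tup A' W t0, volume.real (inte A' τ) with hN2
  have hN10 : 0 ≤ N1 := Finset.sum_nonneg fun _ _ => measureReal_nonneg
  have hN20 : 0 ≤ N2 := Finset.sum_nonneg fun _ _ => measureReal_nonneg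
  have hlamp : 0 ≤ ∏ i, lam i := Finset.prod_nonneg fun i _ => hlam i
  have hale : ∀ P ∈ X, ∀ i, a i (P.t i) ≤ lam i := fun P hP i =>
    (hsz i).single (hlam i) hC27 (Finset.mem_image_of_mem _ hP) (hXD P hP)
  have hterm : ∀ i i' : Fin n, i ≠ i' → ∑ P ∈ X with (g A P i ∧ g A' P i'),
      len P.I * ∏ i, a i (P.t i) ≤ c * (∏ i, lam i) * √(N1 * N2) := by
    intro i i' hne
    set S := X.filter fun P => g A P i ∧ g A' P i' with hS
    have b1 : ∑ P ∈ S, len P.I * a i (P.t i) ^ 2 ≤ c * lam i ^ 2 * N1 := by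
      refine le_trans (Finset.sum_le_sum_of_subset_of_nonneg ?_ ?_)
        (good_sum (a := a) hg hA hk t0 hX hW htp i (hsz i))
      · intro P hP
        rw [hS, Finset.mem_filter] at hP
        exact Finset.mem_filter.mpr ⟨hP.1, hP.2.1⟩
      · intro P _ _; exact mul_nonneg (len_pos _).le (sq_nonneg _)
    have b2 : ∑ P ∈ S, len P.I * a i' (P.t i') ^ 2 ≤ c * lam i' ^ 2 * N2 := by
      refine le_trans (Finset.sum_le_sum_of_subset_of_nonneg ?_ ?_)
        (good_sum (a := a) hg hA' hk t0 hX hW htp i' (hsz i'))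
      · intro P hP
        rw [hS, Finset.mem_filter] at hP
        exact Finset.mem_filter.mpr ⟨hP.1, hP.2.2⟩
      · intro P _ _; exact mul_nonneg (len_pos _).le (sq_nonneg _)
    set R := ∏ l ∈ (Finset.univ.erase i).erase i', lam l with hR
    have hR0 : 0 ≤ R := Finset.prod_nonneg fun i _ => hlam i
    have hmem : i' ∈ Finset.univ.erase i := Finset.mem_erase.mpr ⟨hne.symm, Finset.mem_univ _⟩
    have hRe : ∏ i, lam i = lam i * (lam i' * R) := by
      rw [hR, Finset.mul_prod_erase _ lam hmem, Finset.mul_prod_erase _ lam (Finset.mem_univ _)]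
    calc ∑ P ∈ S, len P.I * ∏ i, a i (P.t i)
        ≤ ∑ P ∈ S, (√(len P.I) * a i (P.t i)) * (√(len P.I) * a i' (P.t i')) * R := by
          refine Finset.sum_le_sum fun P hP => ?_
          have hPX : P ∈ X := (Finset.mem_filter.mp hP).1
          rw [← Finset.mul_prod_erase _ (fun l => a l (P.t l)) (Finset.mem_univ i),
            ← Finset.mul_prod_erase _ (fun l => a l (P.t l)) hmem]
          have h1 : ∏ l ∈ (Finset.univ.erase i).erase i', a l (P.t l) ≤ R :=
            Finset.prod_le_prod (fun l _ => ha l _) fun l _ => hale P hPX l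
          have h2 : √(len P.I) * √(len P.I) = len P.I := Real.mul_self_sqrt (len_pos _).le
          calc _ = (√(len P.I) * a i (P.t i)) * (√(len P.I) * a i' (P.t i')) *
                ∏ l ∈ (Finset.univ.erase i).erase i', a l (P.t l) := by
                linear_combination (-(a i (P.t i) * a i' (P.t i') *
                  ∏ l ∈ (Finset.univ.erase i).erase i', a l (P.t l))) * h2
            _ ≤ _ := by
                apply mul_le_mul_of_nonneg_left h1
                exact mul_nonneg (mul_nonneg (Real.sqrt_nonneg _) (ha _ _))
                  (mul_nonneg (Real.sqrt_nonneg _) (ha _ _))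
      _ = (∑ P ∈ S, (√(len P.I) * a i (P.t i)) * (√(len P.I) * a i' (P.t i'))) * R := by
          rw [Finset.sum_mul]
      _ ≤ (√(∑ P ∈ S, (√(len P.I) * a i (P.t i)) ^ 2) *
          √(∑ P ∈ S, (√(len P.I) * a i' (P.t i')) ^ 2)) * R := by
          gcongr
          exact Real.sum_mul_le_sqrt_mul_sqrt _ _ _
      _ ≤ (√(c * lam i ^ 2 * N1) * √(c * lam i' ^ 2 * N2)) * R := by
          have hsq : ∀ (P : MT n) (x : ℝ), (√(len P.I) * x) ^ 2 = len P.I * x ^ 2 := by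
            intro P x; rw [mul_pow, Real.sq_sqrt (len_pos _).le]
          simp only [hsq]
          gcongr
      _ = c * (∏ i, lam i) * √(N1 * N2) := by
          rw [hRe, ← Real.sqrt_mul (by positivity),
            show c * lam i ^ 2 * N1 * (c * lam i' ^ 2 * N2) = (c * lam i * lam i') ^ 2 * (N1 * N2) by
              ring, Real.sqrt_mul (by positivity), Real.sqrt_sq
              (mul_nonneg (mul_nonneg hc0 (hlam _)) (hlam _))]
          ring
  set Y : Finset (Σ _ : Fin n × Fin n, MT n) :=
    (Finset.univ.filter fun p : Fin n × Fin n => p.1 ≠ p.2).sigma fun p =>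
      X.filter fun P => g A P p.1 ∧ g A' P p.2 with hY
  have hcov : ∑ P ∈ X, len P.I * ∏ i, a i (P.t i) ≤ ∑ x ∈ Y, len x.2.I * ∏ i, a i (x.2.t i) := by
    apply sum_le_cover (fun x => x.2)
    · intro x _
      exact mul_nonneg (len_pos _).le (Finset.prod_nonneg fun i _ => ha i _)
    · intro P hP _
      obtain ⟨i, i', hne, h1, h2⟩ := hpair P hP
      refine ⟨⟨(i, i'), P⟩, ?_, rfl, le_rfl⟩
      rw [hY, Finset.mem_sigma, Finset.mem_filter, Finset.mem_filter]
      exact ⟨⟨Finset.mem_univ _, hne⟩, hP, h1, h2⟩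
  refine hcov.trans ?_
  rw [hY, Finset.sum_sigma]
  refine (Finset.sum_le_sum (fun p hp => hterm p.1 p.2 (Finset.mem_filter.mp hp).2)).trans ?_
  rw [Finset.sum_const, nsmul_eq_mul]
  apply mul_le_mul_of_nonneg_right _ (by positivity)
  have : (Finset.univ.filter fun p : Fin n × Fin n => p.1 ≠ p.2).card ≤ n ^ 2 := by
    refine (Finset.card_filter_le _ _).trans ?_
    simp [sq]
  exact_mod_cast this
end
end

noncomputable section

lemma choose_AA {n k : ℕ} (hk : 1 ≤ k) (hkn : 2 * k ≤ n) (x w : Fin n → ℝ) (hw0 : ∀ i, 0 ≤ w i)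
    (hw1 : ∀ i, w i ≤ 1 / 2) (hws : ∑ i, w i = k) : ∃ A A' : Finset (Fin n), Disjoint A A' ∧
      A.card = k ∧ A'.card = k ∧ ∑ i ∈ A, x i / 2 + ∑ i ∈ A', x i / 2 ≤ ∑ i, w i * x i := by
  obtain ⟨B, hB, hmin⟩ := Finset.exists_min_image (Finset.powersetCard (2 * k) Finset.univ)
    (fun B => ∑ i ∈ B, x i) (Finset.powersetCard_nonempty.mpr (by simpa using hkn))
  rw [Finset.mem_powersetCard] at hB
  have hBc := hB.2
  have hBne : B.Nonempty := Finset.card_pos.mp (by omega)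
  have hex : ∀ i ∈ B, ∀ j ∉ B, x i ≤ x j := by
    intro i hi j hj
    have hj' : j ∉ B.erase i := fun h => hj (Finset.mem_of_mem_erase h)
    have h := hmin (insert j (B.erase i)) (by
      rw [Finset.mem_powersetCard]
      refine ⟨Finset.subset_univ _, ?_⟩
      rw [Finset.card_insert_of_notMem hj', Finset.card_erase_of_mem hi]
      omega)
    rw [Finset.sum_insert hj', ← Finset.add_sum_erase B x hi] at h
    linarith
  obtain ⟨i0, hi0, hmax⟩ := Finset.exists_max_image B x hBne
  obtain ⟨A, hAB, hA⟩ := Finset.exists_subset_card_eq (show k ≤ B.card by omega)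
  refine ⟨A, B \ A, Finset.disjoint_sdiff, hA, by rw [Finset.card_sdiff_of_subset hAB]; omega, ?_⟩
  rw [← Finset.sum_union Finset.disjoint_sdiff, Finset.union_sdiff_of_subset hAB]
  have h1 : ∑ i ∈ B, x i / 2 - ∑ i, w i * x i = ∑ i, ((if i ∈ B then 1 / 2 else 0) - w i) * x i := by
    simp only [sub_mul, Finset.sum_sub_distrib, ite_mul, zero_mul, Finset.sum_ite_mem,
      Finset.univ_inter]
    congr 1
    exact Finset.sum_congr rfl fun i _ => by ring
  have h2 : ∑ i, ((if i ∈ B then 1 / 2 else 0) - w i) * x i ≤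
      ∑ i, ((if i ∈ B then 1 / 2 else 0) - w i) * x i0 := by
    refine Finset.sum_le_sum fun i _ => ?_
    by_cases hi : i ∈ B
    · simp only [hi, if_true]
      exact mul_le_mul_of_nonneg_left (hmax i hi) (by linarith [hw1 i])
    · simp only [hi, if_false]
      have := hex i0 hi0 i hi
      nlinarith [hw0 i]
  have h3 : ∑ i, ((if i ∈ B then (1 / 2 : ℝ) else 0) - w i) * x i0 = 0 := by
    rw [← Finset.sum_mul, Finset.sum_sub_distrib, hws]
    rw [Finset.sum_ite_mem, Finset.univ_inter, Finset.sum_const, hBc, nsmul_eq_mul]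
    push_cast; ring
  linarith

lemma level_calc {σ e w : ℝ} (hσ : 0 < σ) (he : 0 < e) (hw : w ≤ 1 / 2) (m : ℕ) :
    σ / 2 ^ m * (8 * e * 4 ^ m / σ ^ 2) ^ w ≤
      8 * ((σ ^ (1 - 2 * w) * e ^ w) * ((2 : ℝ) ^ (-(1 - 2 * w))) ^ m) := by
  have h8 : (8 : ℝ) ^ w ≤ 8 := by
    calc (8 : ℝ) ^ w ≤ 8 ^ (1 : ℝ) := Real.rpow_le_rpow_of_exponent_le (by norm_num) (by linarith)
      _ = 8 := by norm_num
  have e1 : (8 * e * 4 ^ m / σ ^ 2) ^ w = 8 ^ w * e ^ w * ((2 : ℝ) ^ (2 * w)) ^ m * σ ^ (-(2 * w)) := by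
    rw [Real.div_rpow (by positivity) (by positivity), Real.mul_rpow (by positivity) (by positivity),
      Real.mul_rpow (by positivity) (by positivity)]
    rw [show ((4 : ℝ) ^ m) ^ w = ((2 : ℝ) ^ (2 * w)) ^ m by
      rw [Real.rpow_mul (by norm_num), ← Real.rpow_natCast, ← Real.rpow_natCast, ← Real.rpow_mul,
        ← Real.rpow_mul (by positivity)]
      · norm_num; ring_nf
      · norm_num]
    rw [show (σ ^ 2) ^ w = σ ^ (2 * w) by rw [Real.rpow_mul hσ.le]; norm_num]
    rw [Real.rpow_neg hσ.le]
    rfl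
  have e2 : σ ^ (1 - 2 * w) = σ * σ ^ (-(2 * w)) := by
    rw [sub_eq_add_neg, Real.rpow_add hσ, Real.rpow_one]
  have e3 : ((2 : ℝ) ^ (-(1 - 2 * w))) ^ m = ((2 : ℝ) ^ (2 * w)) ^ m / 2 ^ m := by
    rw [← div_pow]
    congr 1
    rw [neg_sub, Real.rpow_sub (by norm_num), Real.rpow_one]
  rw [e1, e2, e3]
  have : 0 ≤ σ * σ ^ (-(2 * w)) * e ^ w * (((2 : ℝ) ^ (2 * w)) ^ m / 2 ^ m) := by positivity
  calc _ = 8 ^ w * (σ * σ ^ (-(2 * w)) * e ^ w * (((2 : ℝ) ^ (2 * w)) ^ m / 2 ^ m)) := by ring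
    _ ≤ _ := mul_le_mul_of_nonneg_right h8 this

lemma sum_geom_pi {n : ℕ} {β : Fin n → ℝ} (h0 : ∀ i, 0 ≤ β i) (h1 : ∀ i, β i < 1)
    (M : Finset (Fin n → ℕ)) : ∑ m ∈ M, ∏ i, β i ^ m i ≤ ∏ i, (1 - β i)⁻¹ := by
  set b := (M.sup fun m => Finset.univ.sup m) + 1 with hb
  have hsub : M ⊆ Fintype.piFinset fun _ => Finset.range b := by
    intro m hm
    rw [Fintype.mem_piFinset]
    intro i
    rw [Finset.mem_range, hb]
    have h1 : m i ≤ Finset.univ.sup m := Finset.le_sup (Finset.mem_univ i)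
    have h2 : Finset.univ.sup m ≤ M.sup fun m => Finset.univ.sup m :=
      Finset.le_sup (f := fun m : Fin n → ℕ => Finset.univ.sup m) hm
    omega
  refine (Finset.sum_le_sum_of_subset_of_nonneg hsub fun m _ _ =>
    Finset.prod_nonneg fun i _ => pow_nonneg (h0 i) _).trans ?_
  rw [← Finset.prod_univ_sum]
  refine Finset.prod_le_prod (fun i _ => Finset.sum_nonneg fun m _ => pow_nonneg (h0 i) _) fun i _ => ?_
  rw [← tsum_geometric_of_lt_one (h0 i) (h1 i)]
  exact (summable_geometric_of_lt_one (h0 i) (h1 i)).sum_le_tsum _ fun m _ => pow_nonneg (h0 i) _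

/-- Main multilinear estimate for tiles. -/
theorem thmA {n k : ℕ} (hk : 1 ≤ k) (hkn : 2 * k ≤ n) {C2 : ℤ} (C3 : ℤ) (hC2 : 7 ≤ C2) {w : Fin n → ℝ}
    (hw0 : ∀ i, 0 ≤ w i) (hw1 : ∀ i, w i < 1 / 2) (hws : ∑ i, w i = k) : ∃ C : ℝ, 0 ≤ C ∧
    ∀ (ℙ : Finset (MT n)) (ext : Finset (Fin n) → (Fin n → ℝ) → Fin n → ℝ) (L s₀ : ℤ) (r : Fin n → ℤ)
      (a : Fin n → Tile → ℝ) (σ e : Fin n → ℝ), Geo n k C2 C3 ℙ ext → (C2 : ℝ) + 1 < pw L →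
      (∀ i Q, 0 ≤ a i Q) → (∀ i, ∀ P ∈ ℙ, Sparse L s₀ (r i) (P.t i)) → (∀ i, 0 < σ i) →
      (∀ i, 0 < e i) →
      (∀ i, SizeLe (ℙ.image MT.I) (a i) C2 (ℙ.image fun P => P.t i) (σ i)) →
      (∀ i, Pack (ℙ.image MT.I) (a i) (ℙ.image fun P => P.t i) (e i)) →
      ∑ P ∈ ℙ, len P.I * ∏ i, a i (P.t i) ≤
        C * volume.real (UU (ℙ.image MT.I)) * ∏ i, σ i ^ (1 - 2 * w i) * e i ^ w i := by
  set β : Fin n → ℝ := fun i => (2 : ℝ) ^ (-(1 - 2 * w i)) with hβ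
  have hβ0 : ∀ i, 0 ≤ β i := fun i => by positivity
  have hβ1 : ∀ i, β i < 1 := fun i => by
    apply Real.rpow_lt_one_of_one_lt_of_neg (by norm_num); linarith [hw1 i]
  set c := (2 * (C3.toNat : ℝ) + 1) ^ n with hc
  have hc0 : 0 ≤ c := by positivity
  set C0 : ℝ := n ^ 2 * (c * k.factorial * 8 ^ n) with hC0
  have hC00 : 0 ≤ C0 := by positivity
  refine ⟨C0 * ∏ i, (1 - β i)⁻¹, mul_nonneg hC00 (Finset.prod_nonneg fun i _ => inv_nonneg.mpr
    (by linarith [hβ1 i])), ?_⟩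
  intro ℙ ext L s₀ r a σ e hg hL ha hsp hσ he hsz hpk
  set D := ℙ.image MT.I with hD
  set U := volume.real (UU D) with hU
  have hU0 : 0 ≤ U := measureReal_nonneg
  have hlv : ∀ i, ∃ (lev : Tile → ℕ) (W : ℕ → Finset Tre), ∀ m : ℕ,
      SizeLe D (a i) C2 ((ℙ.image fun P => P.t i).filter fun Q => 0 < a i Q ∧ lev Q = m)
        (σ i / 2 ^ m) ∧
      (∀ t ∈ W m, t.J ∈ D) ∧
      (∀ K ∈ D, ∑ t ∈ W m with dI t.J ⊆ dI K, len t.J ≤ 8 * e i * 4 ^ m / σ i ^ 2 * len K) ∧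
      (∀ Q ∈ (ℙ.image fun P => P.t i), 0 < a i Q → lev Q = m →
        ∃ t ∈ W m, ∃ κ : ℤ, |κ| ≤ C2 ∧ InTree t.J t.ξ κ Q) := fun i =>
    levels hL hC2 (hσ i) (s₀ := s₀) (r := r i) (by
      intro Q hQ
      obtain ⟨P, hP, rfl⟩ := Finset.mem_image.mp hQ
      exact hsp i P hP) (by
      intro Q hQ
      obtain ⟨P, hP, rfl⟩ := Finset.mem_image.mp hQ
      exact Finset.mem_image_of_mem _ hP) (hsz i) (hpk i)
  choose lev W hlev using hlv
  set ℙ' := ℙ.filter fun P => ∀ i, 0 < a i (P.t i) with hℙ'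
  have hred : ∑ P ∈ ℙ, len P.I * ∏ i, a i (P.t i) = ∑ P ∈ ℙ', len P.I * ∏ i, a i (P.t i) := by
    rw [hℙ', Finset.sum_filter]
    refine Finset.sum_congr rfl fun P hP => ?_
    split_ifs with h
    · rfl
    · push Not at h
      obtain ⟨i, hi⟩ := h
      rw [Finset.prod_eq_zero (Finset.mem_univ i) (le_antisymm hi (ha i _)), mul_zero]
  rw [hred]
  set mv : MT n → Fin n → ℕ := fun P i => lev i (P.t i) with hmv
  rw [← Finset.sum_fiberwise_of_maps_to (g := mv) (t := ℙ'.image mv)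
    (fun P hP => Finset.mem_image_of_mem _ hP)]
  have hfib : ∀ m ∈ ℙ'.image mv, ∑ P ∈ ℙ' with mv P = m, len P.I * ∏ i, a i (P.t i) ≤
      C0 * U * (∏ i, σ i ^ (1 - 2 * w i) * e i ^ w i) * ∏ i, β i ^ m i := by
    intro m _
    set X := ℙ'.filter fun P => mv P = m with hX
    have hXm : ∀ P ∈ X, P ∈ ℙ ∧ (∀ i, 0 < a i (P.t i)) ∧ ∀ i, lev i (P.t i) = m i := by
      intro P hP
      rw [hX, hℙ', Finset.mem_filter, Finset.mem_filter] at hP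
      exact ⟨hP.1.1, hP.1.2, fun i => congrFun hP.2 i⟩
    have htop : ∀ i, ∀ P, ∃ t : Tre, P ∈ X →
        (t ∈ W i (m i) ∧ dI P.I ⊆ dI t.J ∧ |kap P i t.ξ| ≤ C2) := by
      intro i P
      by_cases hP : P ∈ X
      · obtain ⟨h1, h2, h3⟩ := hXm P hP
        obtain ⟨t, ht, κ, hκ, hin⟩ := (hlev i (m i)).2.2.2 (P.t i) (Finset.mem_image_of_mem _ h1)
          (h2 i) (h3 i)
        refine ⟨t, fun _ => ⟨ht, hin.1, ?_⟩⟩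
        have h5 : P.v i = ⌊pw (-P.I.1) * t.ξ⌋ + κ := hin.2
        have : kap P i t.ξ = κ := by
          unfold kap; omega
        rw [this]; exact hκ
      · exact ⟨⟨(0, 0), 0, 0, ∅⟩, fun h => absurd h hP⟩
    choose tp htp using htop
    set Dd : Fin n → ℝ := fun i => 8 * e i * 4 ^ m i / σ i ^ 2 with hDd
    have hDd0 : ∀ i, 0 < Dd i := fun i => by
      have := he i; have := hσ i
      simp only [hDd]; positivity
    obtain ⟨A, A', hdis, hA, hA', hAA⟩ := choose_AA hk hkn (fun i => Real.log (Dd i)) w hw0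
      (fun i => (hw1 i).le) hws
    set t0 : Tre := ⟨(0, 0), 0, 0, ∅⟩ with ht0
    have hlb := level_bound (a := a) (W := fun i => W i (m i)) (X := X) (D := D) (tp := tp)
      (lam := fun i => σ i / 2 ^ m i) hg hA hA' hdis hk hC2 t0
      (fun P hP => (hXm P hP).1) (fun i => (hlev i (m i)).2.1) ha (fun i P hP => htp i P hP)
      (fun i => by have := hσ i; positivity)
      (fun P hP => Finset.mem_image_of_mem _ (hXm P hP).1) (fun i => by
        apply (hlev i (m i)).1.mono
        intro Q hQ
        obtain ⟨P, hP, rfl⟩ := Finset.mem_image.mp hQ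
        obtain ⟨h1, h2, h3⟩ := hXm P hP
        exact Finset.mem_filter.mpr ⟨Finset.mem_image_of_mem _ h1, h2 i, h3 i⟩)
    refine hlb.trans ?_
    have hcount : ∀ A : Finset (Fin n), A.card = k →
        ∑ τ ∈ tup A (fun i => W i (m i)) t0, volume.real (inte A τ) ≤
        k.factorial * (∏ i ∈ A, Dd i) * U := by
      intro A hA
      have := count_U (D := D) (Dd := Dd) (fun i => W i (m i)) t0 (fun i => (hlev i (m i)).2.1)
        (fun i => (hDd0 i).le) (fun i => (hlev i (m i)).2.2.1) A (Finset.card_pos.mp (by omega))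
      rwa [hA] at this
    have hexp : ∀ A : Finset (Fin n), ∏ i ∈ A, Dd i = Real.exp (∑ i ∈ A, Real.log (Dd i)) := by
      intro A
      rw [Real.exp_sum]
      exact Finset.prod_congr rfl fun i _ => (Real.exp_log (hDd0 i)).symm
    have hsq : √((∑ τ ∈ tup A (fun i => W i (m i)) t0, volume.real (inte A τ)) *
        ∑ τ ∈ tup A' (fun i => W i (m i)) t0, volume.real (inte A' τ)) ≤
        k.factorial * U * ∏ i, Dd i ^ w i := by
      have hnn : ∀ A : Finset (Fin n), 0 ≤ ∑ τ ∈ tup A (fun i => W i (m i)) t0,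
        volume.real (inte A τ) := fun A => Finset.sum_nonneg fun _ _ => measureReal_nonneg
      have hpp : ∀ A : Finset (Fin n), 0 ≤ ∏ i ∈ A, Dd i := fun A =>
        Finset.prod_nonneg fun i _ => (hDd0 i).le
      calc _ ≤ √((k.factorial * (∏ i ∈ A, Dd i) * U) * (k.factorial * (∏ i ∈ A', Dd i) * U)) := by
            apply Real.sqrt_le_sqrt
            exact mul_le_mul (hcount A hA) (hcount A' hA') (hnn A')
              (mul_nonneg (mul_nonneg (by positivity) (hpp A)) hU0)
        _ = k.factorial * U * √((∏ i ∈ A, Dd i) * ∏ i ∈ A', Dd i) := by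
            rw [show (k.factorial * (∏ i ∈ A, Dd i) * U) * (k.factorial * (∏ i ∈ A', Dd i) * U) =
              (k.factorial * U) ^ 2 * ((∏ i ∈ A, Dd i) * ∏ i ∈ A', Dd i) by ring,
              Real.sqrt_mul (by positivity), Real.sqrt_sq (by positivity)]
        _ ≤ _ := by
            apply mul_le_mul_of_nonneg_left _ (by positivity)
            rw [hexp, hexp, ← Real.exp_add, Real.sqrt_eq_rpow, ← Real.exp_mul]
            have : ∏ i, Dd i ^ w i = Real.exp (∑ i, w i * Real.log (Dd i)) := by
              rw [Real.exp_sum]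
              refine Finset.prod_congr rfl fun i _ => ?_
              rw [Real.rpow_def_of_pos (hDd0 i), mul_comm]
            rw [this]
            apply Real.exp_le_exp.mpr
            refine le_trans (le_of_eq ?_) hAA
            rw [← Finset.sum_div, ← Finset.sum_div]; ring
    calc _ ≤ n ^ 2 * (c * (∏ i, σ i / 2 ^ m i) * (k.factorial * U * ∏ i, Dd i ^ w i)) := by
          have : 0 ≤ ∏ i, σ i / 2 ^ m i := Finset.prod_nonneg fun i _ => by
            have := hσ i; positivity
          gcongr
      _ = n ^ 2 * c * k.factorial * U * ∏ i, (σ i / 2 ^ m i * Dd i ^ w i) := by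
          rw [Finset.prod_mul_distrib]; ring
      _ ≤ n ^ 2 * c * k.factorial * U * ∏ i, (8 * ((σ i ^ (1 - 2 * w i) * e i ^ w i) * β i ^ m i)) := by
          apply mul_le_mul_of_nonneg_left _ (by positivity)
          refine Finset.prod_le_prod (fun i _ => ?_) fun i _ => ?_
          · have := hσ i; have := hDd0 i; positivity
          · exact level_calc (hσ i) (he i) (hw1 i).le (m i)
      _ = _ := by
          rw [Finset.prod_mul_distrib, Finset.prod_mul_distrib, Finset.prod_const, Finset.card_univ,
            Fintype.card_fin, hC0]
          ring
  refine (Finset.sum_le_sum hfib).trans ?_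
  rw [← Finset.mul_sum]
  have hQ0 : 0 ≤ ∏ i, σ i ^ (1 - 2 * w i) * e i ^ w i := Finset.prod_nonneg fun i _ => by
    have := hσ i; have := he i; positivity
  have := mul_le_mul_of_nonneg_left (sum_geom_pi hβ0 hβ1 (ℙ'.image mv))
    (mul_nonneg (mul_nonneg hC00 hU0) hQ0)
  refine this.trans_eq ?_
  ring
end

noncomputable section

/-! ### Density -/
def Dens (E : Set ℝ) (ρ : ℝ) (I : Dy) : Prop := ∀ r, len I ≤ r →
  volume (E ∩ Set.Icc (cen I - r) (cen I + r)) ≤ ENNReal.ofReal (2 * r * ρ)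

lemma dens_lint {E : Set ℝ} (hE : MeasurableSet E) {ρ : ℝ} (hρ : 0 ≤ ρ) {I : Dy}
    (h : Dens E ρ I) :
    ∫⁻ y in E, ENNReal.ofReal ((wt I y)⁻¹) ≤ ENNReal.ofReal (16 * ρ * len I) := by
  have hl := len_pos I
  set c : ℕ → ℝ≥0∞ := fun k => ENNReal.ofReal (4 * (1 / 4) ^ k) with hc
  set B : ℕ → Set ℝ := fun k => Set.Icc (cen I - 2 ^ k * len I) (cen I + 2 ^ k * len I) with hB
  have hpt : ∀ y, ENNReal.ofReal ((wt I y)⁻¹) ≤ ∑' k, (B k).indicator (fun _ => c k) y := by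
    intro y
    set t := |pw I.1 * (y - cen I)| with ht
    have hyt : |y - cen I| = t * len I := by
      rw [ht, abs_mul, abs_of_pos (pw_pos _), mul_right_comm, pw_mul_len, one_mul]
    have hex : ∃ k : ℕ, t ≤ 2 ^ k := (pow_unbounded_of_one_lt t (by norm_num)).imp fun k h => h.le
    have hk := Nat.find_spec hex
    have hmin := fun m => @Nat.find_min _ _ hex m
    set k := Nat.find hex
    have hw : (wt I y)⁻¹ ≤ 4 * (1 / 4) ^ k := by
      have e : wt I y = 1 + t ^ 2 := by unfold wt bw; rw [ht, sq_abs]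
      rw [e]
      rcases k with _ | k
      · have : (1 + t ^ 2)⁻¹ ≤ 1 := inv_le_one_of_one_le₀ (by nlinarith [sq_nonneg t])
        simp; linarith
      · have h1 := hmin k (by omega)
        push Not at h1
        have h2 : (4 : ℝ) ^ k ≤ t ^ 2 := by
          rw [show (4 : ℝ) ^ k = (2 ^ k) ^ 2 by rw [← pow_mul, mul_comm, pow_mul]; norm_num]
          gcongr
        rw [show (4 : ℝ) * (1 / 4) ^ (k + 1) = (4 ^ k)⁻¹ by
          rw [pow_succ, one_div, inv_pow]; ring]
        exact inv_anti₀ (by positivity) (by linarith)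
    refine le_trans ?_ (ENNReal.le_tsum k)
    rw [Set.indicator_of_mem]
    · exact ENNReal.ofReal_le_ofReal hw
    · have : |y - cen I| ≤ 2 ^ k * len I := by rw [hyt]; gcongr
      rw [abs_le] at this
      exact ⟨by linarith, by linarith⟩
  calc ∫⁻ y in E, ENNReal.ofReal ((wt I y)⁻¹)
      ≤ ∫⁻ y in E, ∑' k, (B k).indicator (fun _ => c k) y := lintegral_mono hpt
    _ = ∑' k, ∫⁻ y in E, (B k).indicator (fun _ => c k) y := by
        refine lintegral_tsum fun k => ?_
        exact (measurable_const.indicator measurableSet_Icc).aemeasurable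
    _ ≤ ∑' k, ENNReal.ofReal (8 * ρ * len I * (1 / 2) ^ k) := by
        refine ENNReal.tsum_le_tsum fun k => ?_
        rw [lintegral_indicator_const measurableSet_Icc, Measure.restrict_apply measurableSet_Icc,
          Set.inter_comm]
        calc c k * volume (E ∩ B k) ≤ c k * ENNReal.ofReal (2 * (2 ^ k * len I) * ρ) := by
              gcongr
              refine h _ ?_
              exact le_mul_of_one_le_left hl.le (one_le_pow₀ (by norm_num))
          _ = _ := by
              rw [hc, ← ENNReal.ofReal_mul (by positivity)]
              congr 1
              have : ((1 : ℝ) / 4) ^ k * 2 ^ k = (1 / 2) ^ k := by rw [← mul_pow]; norm_num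
              rw [← this]; ring
    _ = ENNReal.ofReal (16 * ρ * len I) := by
        rw [← ENNReal.ofReal_tsum_of_nonneg (fun k => by positivity)
          (summable_geometric_two.mul_left _), tsum_mul_left, tsum_geometric_two]
        congr 1; ring

lemma dens_int {E : Set ℝ} (hE : MeasurableSet E) {ρ : ℝ} (hρ : 0 ≤ ρ) {I : Dy}
    (h : Dens E ρ I) : ∫ y in E, (wt I y)⁻¹ ≤ 16 * ρ * len I := by
  have hl := len_pos I
  rw [integral_eq_lintegral_of_nonneg_ae (Filter.Eventually.of_forall fun y =>
    (inv_pos.2 (wt_pos I y)).le) ((wt_inv_integrable I).1.restrict)]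
  exact ENNReal.toReal_le_of_le_ofReal (by positivity) (dens_lint hE hρ h)

/-! ### stopping partition -/
def dya (s : ℤ) (y : ℝ) : Dy := (s, ⌊y * pw s⌋)
lemma mem_dya (s : ℤ) (y : ℝ) : y ∈ dI (dya s y) := mem_dI.2 rfl
lemma dya_eq {s t : ℤ} {x y : ℝ} (h : t ≤ s) (hx : x ∈ dI (dya s y)) : dya t x = dya t y := by
  unfold dya
  rw [floor_scale h (mem_dI.1 hx)]
lemma eq_dya {L : Dy} {y : ℝ} (h : y ∈ dI L) : L = dya L.1 y :=
  Prod.ext rfl (mem_dI.1 h).symm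

def tri (L : Dy) : Set ℝ := Set.Ico ((L.2 - 1) * len L) ((L.2 + 2) * len L)
def St (S : Finset Dy) (L : Dy) : Prop := ∀ I ∈ S, ¬ dI I ⊆ tri L

lemma mem_tri {L : Dy} {x y : ℝ} (hy : y ∈ dI L) (h : |x - y| ≤ len L) : x ∈ tri L := by
  obtain ⟨h1, h2⟩ := hy
  rw [abs_le] at h
  constructor <;> nlinarith

lemma St_least {S : Finset Dy} (hS : S.Nonempty) (y : ℝ) :
    ∃ s, St S (dya s y) ∧ ∀ t, St S (dya t y) → s ≤ t := by
  refine Int.exists_least_of_bdd ?_ ?_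
  · obtain ⟨I, hI⟩ := hS
    obtain ⟨d, hd⟩ := pow_unbounded_of_one_lt (|cen I - y| + len I) (show (1 : ℝ) < 2 by norm_num)
    refine ⟨-d, fun z hz => ?_⟩
    by_contra hlt
    push Not at hlt
    refine hz I hI fun x hx => mem_tri (mem_dya z y) ?_
    have h1 : |x - y| ≤ |x - cen I| + |cen I - y| := abs_sub_le _ _ _
    have h2 := dist_cen_le hx
    have h3 : (2 : ℝ) ^ d ≤ len (dya z y) := by
      rw [← pw_natCast]; exact pw_mono (by simp only [dya]; omega)
    linarith [len_pos I]
  · obtain ⟨b, hb⟩ := Finset.exists_le (S.image Prod.fst)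
    refine ⟨b + 2, fun I hI h => ?_⟩
    have h1 : I.1 ≤ b := hb _ (Finset.mem_image_of_mem _ hI)
    have h2 := measure_mono (μ := volume) h
    rw [dI_vol, tri, Real.volume_Ico, ENNReal.ofReal_le_ofReal_iff] at h2
    · have h3 : len (dya (b + 2) y) = pw (-b) * (1 / 4) := by
        unfold len dya; simp only
        rw [show -(b + 2) = -b + -2 by ring, pw_add]
        congr 1; norm_num [pw]
      have h4 : pw (-b) ≤ len I := pw_mono (by omega)
      have := pw_pos (-b)
      nlinarith
    · nlinarith [len_pos (dya (b + 2) y)]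

def sS {S : Finset Dy} (hS : S.Nonempty) (y : ℝ) : ℤ := (St_least hS y).choose
def LL {S : Finset Dy} (hS : S.Nonempty) (y : ℝ) : Dy := dya (sS hS y) y

section
variable {S : Finset Dy} (hS : S.Nonempty)

lemma mem_LL (y : ℝ) : y ∈ dI (LL hS y) := mem_dya _ _
lemma LL_St (y : ℝ) : St S (LL hS y) := (St_least hS y).choose_spec.1
lemma LL_eq {x y : ℝ} (h : x ∈ dI (LL hS y)) : LL hS x = LL hS y := by
  have hy := (St_least hS y).choose_spec
  have hx := (St_least hS x).choose_spec
  have e : sS hS x = sS hS y := by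
    have h1 : sS hS x ≤ sS hS y := hx.2 _ (by
      have := dya_eq le_rfl h
      rw [show (St_least hS y).choose = sS hS y from rfl] at hy
      rw [this]; exact hy.1)
    refine le_antisymm h1 (hy.2 _ ?_)
    rw [← dya_eq h1 h]; exact hx.1
  unfold LL
  rw [e]; exact dya_eq le_rfl h

lemma LL_preimage (L : Dy) : LL hS ⁻¹' {L} = if (∃ y, LL hS y = L) then dI L else ∅ := by
  split_ifs with h
  · obtain ⟨y, rfl⟩ := h
    ext x
    simp only [Set.mem_preimage, Set.mem_singleton_iff]
    constructor
    · intro e; rw [← e]; exact mem_LL hS x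
    · exact LL_eq hS
  · ext x
    simp only [Set.mem_preimage, Set.mem_singleton_iff, Set.mem_empty_iff_false, iff_false]
    exact fun e => h ⟨x, e⟩

lemma LL_meas : Measurable (LL hS) := by
  refine measurable_to_countable' fun L => ?_
  rw [LL_preimage]
  split_ifs
  · exact dI_meas L
  · exact MeasurableSet.empty

lemma LL_parent (y : ℝ) : ∃ I ∈ S, len I ≤ 6 * len (LL hS y) ∧
    ∀ x ∈ dI (LL hS y), |x - cen I| ≤ 6 * len (LL hS y) := by
  have h : ¬ St S (dya (sS hS y - 1) y) := fun h => by
    have := (St_least hS y).choose_spec.2 _ h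
    rw [show (St_least hS y).choose = sS hS y from rfl] at this
    omega
  unfold St at h
  push Not at h
  obtain ⟨I, hI, h⟩ := h
  have hle : len (dya (sS hS y - 1) y) = 2 * len (LL hS y) := by
    unfold len LL dya; simp only
    rw [show -(sS hS y - 1) = 1 + -sS hS y by ring, pw_add, pw_one]
  have hl := len_pos (LL hS y)
  refine ⟨I, hI, ?_, ?_⟩
  · have h2 := measure_mono (μ := volume) h
    rw [dI_vol, tri, Real.volume_Ico, hle, ENNReal.ofReal_le_ofReal_iff (by nlinarith)] at h2
    linarith
  · intro x hx
    have hc := h (cen_mem I)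
    have hx' : x ∈ dI (dya (sS hS y - 1) y) :=
      dI_sub_of_mem (by simp [LL, dya]) (mem_LL hS y) (mem_dya _ _) hx
    unfold tri at hc
    unfold dI at hx'
    rw [hle] at hc hx'
    obtain ⟨a1, a2⟩ := hc
    obtain ⟨b1, b2⟩ := hx'
    rw [abs_le]; constructor <;> nlinarith

lemma far_of_St {L I : Dy} (hL : L.1 ≤ I.1) (h : ¬ dI I ⊆ tri L) {x : ℝ} (hx : x ∈ dI L) :
    len L ≤ |x - cen I| := by
  by_contra hlt
  push Not at hlt
  apply h
  have hl := len_pos L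
  have h1 : dI I ⊆ dI (dya L.1 (cen I)) := dI_sub_of_mem hL (cen_mem I) (mem_dya _ _)
  refine h1.trans fun z hz => ?_
  have hc := mem_dya L.1 (cen I)
  set M := dya L.1 (cen I) with hM
  have hlM : len M = len L := rfl
  have hd : |M.2 - L.2| ≤ 1 := by
    unfold dI at hc hx
    rw [hlM] at hc
    obtain ⟨a1, a2⟩ := hc
    obtain ⟨b1, b2⟩ := hx
    rw [abs_lt] at hlt
    have u1 : (M.2 : ℝ) < L.2 + 2 := by
      by_contra! hh; nlinarith
    have u2 : (L.2 : ℝ) < M.2 + 2 := by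
      by_contra! hh; nlinarith
    have u1' : M.2 < L.2 + 2 := by exact_mod_cast u1
    have u2' : L.2 < M.2 + 2 := by exact_mod_cast u2
    rw [abs_le]; omega
  rw [abs_le] at hd
  unfold dI at hz
  rw [hlM] at hz
  have v1 : (L.2 : ℝ) - 1 ≤ M.2 := by exact_mod_cast (by omega : L.2 - 1 ≤ M.2)
  have v2 : (M.2 : ℝ) ≤ L.2 + 1 := by exact_mod_cast (by omega : M.2 ≤ L.2 + 1)
  constructor
  · nlinarith [hz.1]
  · nlinarith [hz.2]
end
end

noncomputable section

section
variable {S : Finset Dy} (hS : S.Nonempty)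

/-- modulated average over a dyadic interval -/
def mavg (ξ : ℝ) (f : ℝ → ℂ) (L : Dy) : ℂ := ((len L)⁻¹ : ℝ) * ∫ x in dI L, f x * ex ξ x

/-- modulated conditional expectation -/
def emo (ξ : ℝ) (f : ℝ → ℂ) (y : ℝ) : ℂ := ex (-ξ) y * mavg ξ f (LL hS y)

lemma emo_meas (ξ : ℝ) (f : ℝ → ℂ) : Measurable (emo hS ξ f) := by
  unfold emo
  exact (ex_cont _).measurable.mul ((measurable_of_countable (mavg ξ f)).comp (LL_meas hS))

lemma LL_cover : (⋃ L : Set.range (LL hS), dI L.1) = Set.univ := by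
  rw [Set.eq_univ_iff_forall]
  intro y
  exact Set.mem_iUnion.2 ⟨⟨_, y, rfl⟩, mem_LL hS y⟩

lemma LL_disj : Pairwise (Function.onFun Disjoint fun L : Set.range (LL hS) => dI L.1) := by
  rintro ⟨_, y, rfl⟩ ⟨_, z, rfl⟩ h
  rw [Function.onFun, Set.disjoint_left]
  intro x h1 h2
  exact h (Subtype.ext ((LL_eq hS h1).symm.trans (LL_eq hS h2)))

lemma integral_LL {f : ℝ → ℂ} (hf : Integrable f) :
    ∫ y, f y = ∑' L : Set.range (LL hS), ∫ y in dI L.1, f y := by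
  rw [← setIntegral_univ, ← LL_cover hS,
    integral_iUnion (fun L => dI_meas _) (LL_disj hS) hf.integrableOn]

lemma setint_em (ξ : ℝ) (f g : ℝ → ℂ) (L : Set.range (LL hS)) :
    ∫ y in dI L.1, f y * emo hS ξ g y =
      ((len L.1)⁻¹ : ℝ) * (∫ x in dI L.1, f x * ex (-ξ) x) * ∫ x in dI L.1, g x * ex ξ x := by
  obtain ⟨_, z, rfl⟩ := L
  simp only
  rw [setIntegral_congr_fun (g := fun y => (f y * ex (-ξ) y) * mavg ξ g (LL hS z)) (dI_meas _)]
  · rw [integral_mul_const, mavg]; ring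
  · intro y hy
    simp only [emo]
    rw [LL_eq hS hy]; ring

lemma emo_adj (ξ : ℝ) {f g : ℝ → ℂ} (h1 : Integrable fun y => f y * emo hS ξ g y)
    (h2 : Integrable fun y => emo hS (-ξ) f y * g y) :
    ∫ y, f y * emo hS ξ g y = ∫ y, emo hS (-ξ) f y * g y := by
  rw [integral_LL hS h1, integral_LL hS h2]
  refine tsum_congr fun L => ?_
  rw [setint_em]
  simp only [mul_comm (emo hS (-ξ) f _)]
  rw [setint_em, neg_neg]; ring

variable {E : Set ℝ} {f : ℝ → ℂ} {ρ : ℝ}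

lemma emo_bound (hE : MeasurableSet E) (hf1 : ∀ x, ‖f x‖ ≤ 1) (hf0 : ∀ x, x ∉ E → f x = 0)
    (hρ : 0 ≤ ρ) (hd : ∀ I ∈ S, Dens E ρ I) (ξ y : ℝ) : ‖emo hS ξ f y‖ ≤ 12 * ρ := by
  have hl := len_pos (LL hS y)
  unfold emo mavg
  rw [norm_mul, ex_norm, one_mul, norm_mul, Complex.norm_real, Real.norm_of_nonneg (by positivity),
    inv_mul_le_iff₀ hl]
  obtain ⟨I, hI, h1, h2⟩ := LL_parent hS y
  have h3 : ∫ x in dI (LL hS y), f x * ex ξ x = ∫ x in dI (LL hS y) ∩ E, f x * ex ξ x := by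
    apply setIntegral_eq_of_subset_of_forall_sdiff_eq_zero (dI_meas _) Set.inter_subset_left
    intro x hx
    rw [hf0 x fun h => hx.2 ⟨hx.1, h⟩, zero_mul]
  have hv : volume (dI (LL hS y) ∩ E) ≤ ENNReal.ofReal (2 * (6 * len (LL hS y)) * ρ) := by
    refine le_trans (measure_mono ?_) (hd I hI _ h1)
    intro x hx
    have := abs_le.1 (h2 x hx.1)
    exact ⟨hx.2, by linarith, by linarith⟩
  rw [h3]
  have h4 := norm_setIntegral_le_of_norm_le_const (μ := volume) (s := dI (LL hS y) ∩ E)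
    (f := fun x => f x * ex ξ x) (C := 1) (lt_of_le_of_lt hv ENNReal.ofReal_lt_top)
    (fun x _ => by rw [norm_mul, ex_norm, mul_one]; exact hf1 x)
  refine h4.trans ?_
  rw [one_mul]
  refine (ENNReal.toReal_le_of_le_ofReal (by positivity) hv).trans (by linarith)

variable {N q : ℕ} {KK : ℝ} {φ : Tile → ℝ → ℂ}

/-- the off-diagonal kernel bound -/
lemma emo_diff (hφ : WP N KK φ) (hN : 3 ≤ N) {Q : Tile} (hQ : Q.I ∈ S) {ξ : ℝ}
    (hξ : |Q.fr - ξ| ≤ KK * pw Q.I.1) (y : ℝ) : ‖φ Q y - emo hS ξ (φ Q) y‖ ≤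
      2 * 4 ^ N * (pw (-|Q.I.1 - (LL hS y).1|) * (pw Q.I.1 * (wt Q.I y ^ 2)⁻¹)) := by
  set L := LL hS y with hL
  have hyL : y ∈ dI L := mem_LL hS y
  have hl := len_pos L
  have hp := pw_pos Q.I.1
  have hw := wt_pos Q.I y
  have hw1 := one_le_wt Q.I y
  have hIntg : IntegrableOn (fun x => φ Q x * ex ξ x) (dI L) := by
    refine (((hφ.cont Q).mul (ex_cont ξ)).continuousOn.integrableOn_Icc
      (a := L.2 * len L) (b := (L.2 + 1) * len L)).mono_set ?_
    exact Set.Ico_subset_Icc_self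
  have e : φ Q y - emo hS ξ (φ Q) y = ex (-ξ) y * (((len L)⁻¹ : ℝ) *
      ∫ x in dI L, (φ Q y * ex ξ y - φ Q x * ex ξ x)) := by
    have hci : IntegrableOn (fun _ : ℝ => φ Q y * ex ξ y) (dI L) :=
      integrableOn_const (by rw [dI_vol]; exact ENNReal.ofReal_ne_top)
    rw [integral_sub hci hIntg,
      setIntegral_const, dI_vol_real, emo, ← hL, mavg, mul_sub, mul_sub, Complex.real_smul]
    have h1 : (((len L)⁻¹ : ℝ) : ℂ) * ((len L : ℝ) : ℂ) = 1 := by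
      rw [← Complex.ofReal_mul, inv_mul_cancel₀ hl.ne', Complex.ofReal_one]
    have h2 := ex_mul_neg ξ y
    linear_combination (-(φ Q y)) * h2 - φ Q y * ex ξ y * ex (-ξ) y * h1
  set M : ℝ := 2 * 4 ^ N * (pw (-|Q.I.1 - L.1|) * (pw Q.I.1 * (wt Q.I y ^ 2)⁻¹)) with hM
  have key : ∀ x ∈ dI L, ‖φ Q y * ex ξ y - φ Q x * ex ξ x‖ ≤ M := by
    intro x hx
    have hxy : |y - x| ≤ len L := by
      have a := dist_cen_le hx
      have b := dist_cen_le hyL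
      have := abs_sub_le y (cen L) x
      rw [abs_sub_comm (cen L) x] at this
      linarith
    rcases le_or_gt Q.I.1 L.1 with hc | hc
    · have hlen : len L ≤ len Q.I := pw_mono (by omega)
      refine (hφ.lip Q ξ hξ y x (hxy.trans hlen)).trans ?_
      have h1 : pw Q.I.1 * |y - x| ≤ pw (-|Q.I.1 - L.1|) := by
        rw [abs_of_nonpos (a := Q.I.1 - L.1) (by omega), show - -(Q.I.1 - L.1) = Q.I.1 + -L.1 by ring, pw_add]
        exact mul_le_mul_of_nonneg_left hxy hp.le
      have h2 : (wt Q.I y ^ N)⁻¹ ≤ (wt Q.I y ^ 2)⁻¹ :=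
        inv_anti₀ (by positivity) (pow_le_pow_right₀ hw1 (by omega))
      have h3 : (1 : ℝ) ≤ 2 * 4 ^ N := by
        have : (1 : ℝ) ≤ 4 ^ N := one_le_pow₀ (by norm_num)
        linarith
      have hpp := pw_pos (-|Q.I.1 - L.1|)
      calc pw Q.I.1 * |y - x| * (pw Q.I.1 * (wt Q.I y ^ N)⁻¹)
          ≤ pw (-|Q.I.1 - L.1|) * (pw Q.I.1 * (wt Q.I y ^ 2)⁻¹) := by gcongr
        _ ≤ M := le_mul_of_one_le_left (by positivity) h3
    · have hfar := fun {z} (hz : z ∈ dI L) => far_of_St hc.le (LL_St hS y Q.I hQ) hz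
      have hxw : wt Q.I y ≤ 4 * wt Q.I x := by
        have f1 := hfar hx
        have f2 : |y - cen Q.I| ≤ 2 * |x - cen Q.I| := by
          have := abs_sub_le y x (cen Q.I); linarith
        unfold wt bw
        have f3 : (y - cen Q.I) ^ 2 ≤ 4 * (x - cen Q.I) ^ 2 := by
          rw [← sq_abs, ← sq_abs (x - cen Q.I)]
          nlinarith [abs_nonneg (y - cen Q.I)]
        rw [mul_pow, mul_pow]
        nlinarith [sq_nonneg (pw Q.I.1)]
      have hbig : pw |Q.I.1 - L.1| ≤ wt Q.I y := by
        rw [abs_of_pos (by omega), sub_eq_add_neg, pw_add]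
        change pw Q.I.1 * len L ≤ _
        have f1 := hfar hyL
        have f2 : pw Q.I.1 * len L ≤ |pw Q.I.1 * (y - cen Q.I)| := by
          rw [abs_mul, abs_of_pos hp]; exact mul_le_mul_of_nonneg_left f1 hp.le
        refine f2.trans ?_
        unfold wt bw
        rw [← sq_abs]
        nlinarith [sq_nonneg (|pw Q.I.1 * (y - cen Q.I)| - 1)]
      have g1 : ‖φ Q y‖ ≤ pw Q.I.1 * (wt Q.I y ^ N)⁻¹ := hφ.bd' Q y
      have g2 : ‖φ Q x‖ ≤ 4 ^ N * (pw Q.I.1 * (wt Q.I y ^ N)⁻¹) := by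
        refine (hφ.bd' Q x).trans ?_
        rw [mul_left_comm]
        refine mul_le_mul_of_nonneg_left ?_ hp.le
        have hwx := wt_pos Q.I x
        rw [inv_le_iff_one_le_mul₀ (by positivity)]
        have : wt Q.I y ^ N ≤ 4 ^ N * wt Q.I x ^ N := by rw [← mul_pow]; gcongr
        rw [mul_right_comm, ← div_eq_mul_inv, one_le_div (by positivity)]
        exact this
      have g3 : (wt Q.I y ^ N)⁻¹ ≤ pw (-|Q.I.1 - L.1|) * (wt Q.I y ^ 2)⁻¹ := by
        rw [pw_neg, ← mul_inv]
        apply inv_anti₀ (by have := pw_pos |Q.I.1 - L.1|; positivity)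
        calc pw |Q.I.1 - L.1| * wt Q.I y ^ 2 ≤ wt Q.I y * wt Q.I y ^ 2 := by gcongr
          _ = wt Q.I y ^ 3 := by ring
          _ ≤ _ := pow_le_pow_right₀ hw1 hN
      have h4 : (1 : ℝ) ≤ 4 ^ N := one_le_pow₀ (by norm_num)
      calc ‖φ Q y * ex ξ y - φ Q x * ex ξ x‖ ≤ ‖φ Q y‖ + ‖φ Q x‖ := by
            refine (norm_sub_le _ _).trans ?_
            rw [norm_mul, norm_mul, ex_norm, ex_norm, mul_one, mul_one]
        _ ≤ 2 * 4 ^ N * (pw Q.I.1 * (wt Q.I y ^ N)⁻¹) := by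
            have : 0 ≤ pw Q.I.1 * (wt Q.I y ^ N)⁻¹ := by positivity
            nlinarith
        _ ≤ 2 * 4 ^ N * (pw Q.I.1 * (pw (-|Q.I.1 - L.1|) * (wt Q.I y ^ 2)⁻¹)) := by gcongr
        _ = M := by rw [hM]; ring
  rw [e, norm_mul, ex_norm, one_mul, norm_mul, Complex.norm_real, Real.norm_of_nonneg (by positivity),
    inv_mul_le_iff₀ hl]
  have := norm_setIntegral_le_of_norm_le_const (μ := volume) (s := dI L)
    (by rw [dI_vol]; exact ENNReal.ofReal_lt_top) key
  rw [dI_vol_real] at this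
  linarith

end
end

noncomputable section

lemma pw_abs_sum (S : Finset ℤ) (l : ℤ) : ∑ s ∈ S, pw (-|s - l|) ≤ 4 := by
  have h1 : ∑ s ∈ S.filter (fun s => l ≤ s), pw (-|s - l|) ≤ 2 := by
    have := pw_sum_le ((S.filter (fun s => l ≤ s)).image (fun s => s - l)) 0 (by
      intro s hs
      simp only [Finset.mem_image, Finset.mem_filter] at hs
      obtain ⟨a, ha, rfl⟩ := hs; omega)
    rw [Finset.sum_image (by intro a _ b _ h; simp only at h; omega), neg_zero, pw_zero, mul_one] at this
    refine le_trans (le_of_eq (Finset.sum_congr rfl fun s hs => ?_)) this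
    rw [Finset.mem_filter] at hs
    rw [abs_of_nonneg (by omega)]
  have h2 : ∑ s ∈ S.filter (fun s => ¬ l ≤ s), pw (-|s - l|) ≤ 2 := by
    have := pw_sum_le ((S.filter (fun s => ¬ l ≤ s)).image (fun s => l - s)) 0 (by
      intro s hs
      simp only [Finset.mem_image, Finset.mem_filter] at hs
      obtain ⟨a, ha, rfl⟩ := hs; omega)
    rw [Finset.sum_image (by intro a _ b _ h; simp only at h; omega), neg_zero, pw_zero, mul_one] at this
    refine le_trans (le_of_eq (Finset.sum_congr rfl fun s hs => ?_)) this
    rw [Finset.mem_filter] at hs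
    rw [abs_of_nonpos (by omega)]; congr 1; ring
  rw [← Finset.sum_filter_add_sum_filter_not S (fun s => l ≤ s)]
  linarith

lemma tree_kernel_sum {J : Dy} {ξ : ℝ} {κ : ℤ} (T : Finset Tile) (hT : ∀ Q ∈ T, InTree J ξ κ Q)
    (l : ℤ) (y : ℝ) : ∑ Q ∈ T, pw (-|Q.I.1 - l|) * (wt Q.I y)⁻¹ ≤ 52 := by
  rw [← Finset.sum_fiberwise_of_maps_to (t := T.image fun Q => Q.I.1) (g := fun Q => Q.I.1)
    (fun Q hQ => Finset.mem_image_of_mem _ hQ)]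
  have h : ∀ s ∈ T.image fun Q => Q.I.1,
      ∑ Q ∈ T with Q.I.1 = s, pw (-|Q.I.1 - l|) * (wt Q.I y)⁻¹ ≤ pw (-|s - l|) * 13 := by
    intro s _
    have e : ∑ Q ∈ T with Q.I.1 = s, pw (-|Q.I.1 - l|) * (wt Q.I y)⁻¹ =
        pw (-|s - l|) * ∑ Q ∈ T with Q.I.1 = s, (bw ((Q.I.2 : ℝ) - (pw s * y - 1 / 2)))⁻¹ := by
      rw [Finset.mul_sum]
      refine Finset.sum_congr rfl fun Q hQ => ?_
      rw [Finset.mem_filter] at hQ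
      rw [hQ.2, wt, cen, ← hQ.2, mul_sub, mul_left_comm, pw_mul_len, bw_sub_comm]
      congr 3; ring
    rw [e]
    refine mul_le_mul_of_nonneg_left ?_ (pw_pos _).le
    rw [← Finset.sum_image (g := fun Q : Tile => Q.I.2)
      (f := fun p : ℤ => (bw ((p : ℝ) - (pw s * y - 1 / 2)))⁻¹)]
    · exact bw_sum_int _ _
    · intro Q hQ R hR hh
      simp only [Finset.coe_filter, Set.mem_ofPred_eq] at hQ hR
      have hI : Q.I = R.I := Prod.ext (hQ.2.trans hR.2.symm) hh
      refine Tile.ext2 hI ?_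
      rw [(hT Q hQ.1).2, (hT R hR.1).2, hI]
  refine (Finset.sum_le_sum h).trans ?_
  rw [← Finset.sum_mul]
  linarith [pw_abs_sum (T.image fun Q => Q.I.1) l]

section
variable {E : Set ℝ} {f : ℝ → ℂ} {ρ : ℝ} {N q : ℕ} {KK : ℝ} {φ : Tile → ℝ → ℂ} {L s₀ r : ℤ}

def C5 (N q : ℕ) : ℝ := 2 * (16 * 16 ^ q * 13) * (144 * 4) + 2 * ((2 * 4 ^ N) * 16) * ((2 * 4 ^ N) * (208 * 16))

lemma C5_pos (N q : ℕ) : 0 < C5 N q := by unfold C5; positivity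

lemma lm_const {g : ℝ → ℂ} (hgm : Measurable g) {c : ℝ} (hc : 0 ≤ c) (hg : ∀ y, ‖g y‖ ≤ c) (J : Dy)
    (hq : 1 ≤ q) : lm g J q ≤ c ^ 2 * 4 * len J := by
  have hl := len_pos J
  calc lm g J q ≤ ∫ y, c ^ 2 * (wt J y)⁻¹ := by
        refine integral_mono_of_nonneg (Filter.Eventually.of_forall fun y => ?_)
          ((wt_inv_integrable J).const_mul _) (Filter.Eventually.of_forall fun y => ?_)
        · have := wt_pos J y; simp only [Pi.zero_apply]; positivity
        · have hw := wt_pos J y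
          simp only
          gcongr
          · exact hg y
          · exact le_self_pow₀ (one_le_wt J y) (by omega)
    _ = c ^ 2 * (π * len J) := by rw [integral_const_mul, wt_inv_integral]
    _ ≤ _ := by
        have := Real.pi_le_four
        rw [mul_assoc]
        gcongr

lemma tree_size (hφ : WP N KK φ) (hq : 1 ≤ q) (hN : q + 3 ≤ N) (hE : MeasurableSet E)
    (hfm : Measurable f) (hf1 : ∀ x, ‖f x‖ ≤ 1) (hf0 : ∀ x, x ∉ E → f x = 0) (hρ : 0 ≤ ρ)
    (T : Finset Tile) {J : Dy} {ξ : ℝ} {κ : ℤ} (hL : 2 ≤ L)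
    (hT : ∀ Q ∈ T, InTree J ξ κ Q) (hκ : 7 ≤ |κ|) (hKK : (|κ| : ℝ) + 1 ≤ KK)
    (hsp : ∀ Q ∈ T, Sparse L s₀ r Q) (hJ : Dens E ρ J) (hd : ∀ Q ∈ T, Dens E ρ Q.I) :
    ∑ Q ∈ T, len Q.I * wc f φ Q ^ 2 ≤ C5 N q * ρ ^ 2 * len J := by
  have hlJ := len_pos J
  rcases T.eq_empty_or_nonempty with rfl | hTn
  · simp only [Finset.sum_empty]; have := C5_pos N q; positivity
  have hS : (T.image Tile.I).Nonempty := hTn.image _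
  set A : ℝ := 2 * 4 ^ N with hA
  have hA0 : 0 ≤ A := by positivity
  have hξ : ∀ Q ∈ T, |Q.fr - ξ| ≤ KK * pw Q.I.1 := by
    intro Q hQ
    have h := fr_intree (hT Q hQ)
    have hp := pw_pos Q.I.1
    have h1 : (κ : ℝ) ≤ |(κ : ℝ)| := le_abs_self _
    have h2 : -(κ : ℝ) ≤ |(κ : ℝ)| := neg_le_abs _
    rw [abs_le]; constructor <;> nlinarith
  set g := emo hS (-ξ) f with hg
  have hgm : Measurable g := emo_meas hS _ _
  have hgb : ∀ y, ‖g y‖ ≤ 12 * ρ := emo_bound hS hE hf1 hf0 hρ (by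
    intro I hI
    obtain ⟨Q, hQ, rfl⟩ := Finset.mem_image.1 hI
    exact hd Q hQ) _
  set Kq : Tile → ℝ → ℝ := fun Q y =>
    pw (-|Q.I.1 - (LL hS y).1|) * (pw Q.I.1 * (wt Q.I y ^ 2)⁻¹) with hKq
  have hKm : ∀ Q, Measurable (Kq Q) := by
    intro Q
    have h1 : Measurable fun y => pw (-|Q.I.1 - (LL hS y).1|) :=
      (measurable_of_countable (fun L : Dy => pw (-|Q.I.1 - L.1|))).comp (LL_meas hS)
    exact h1.mul (measurable_const.mul ((wt_cont Q.I).measurable.pow_const 2).inv)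
  have hK0 : ∀ Q y, 0 ≤ Kq Q y := by
    intro Q y
    have := pw_pos (-|Q.I.1 - (LL hS y).1|); have := pw_pos Q.I.1; have := wt_pos Q.I y
    simp only [hKq]; positivity
  have hK1 : ∀ Q y, Kq Q y ≤ pw Q.I.1 * (wt Q.I y)⁻¹ := by
    intro Q y
    have h1 : pw (-|Q.I.1 - (LL hS y).1|) ≤ 1 := by
      rw [← pw_zero]; exact pw_mono (by have := abs_nonneg (Q.I.1 - (LL hS y).1); omega)
    have h2 := pw_pos Q.I.1; have h3 := wt_pos Q.I y
    simp only [hKq]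
    refine (mul_le_of_le_one_left (by positivity) h1).trans ?_
    gcongr
    exact le_self_pow₀ (one_le_wt Q.I y) (by norm_num)
  have hKi : ∀ Q, Integrable (Kq Q) := by
    intro Q
    refine ((wt_inv_integrable Q.I).const_mul (pw Q.I.1)).mono' (hKm Q).aestronglyMeasurable
      (Filter.Eventually.of_forall fun y => ?_)
    rw [Real.norm_of_nonneg (hK0 Q y)]; exact hK1 Q y
  set c : Tile → ℝ := fun Q => ∫ y in E, Kq Q y with hc
  have hc0 : ∀ Q, 0 ≤ c Q := fun Q => integral_nonneg fun y => hK0 Q y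
  have hfE : ∀ y, ‖f y‖ ≤ E.indicator (fun _ => (1 : ℝ)) y := by
    intro y
    by_cases hy : y ∈ E
    · rw [Set.indicator_of_mem hy]; exact hf1 y
    · rw [hf0 y hy, norm_zero]; exact Set.indicator_nonneg (fun _ _ => zero_le_one) _
  -- main pointwise estimate
  have hmain : ∀ Q ∈ T, wc f φ Q ≤ wc g φ Q + A * c Q := by
    intro Q hQ
    have hdiff := emo_diff hS hφ (by omega) (Finset.mem_image_of_mem _ hQ) (hξ Q hQ)
    have hφi := wu_integrable hφ (by omega) hfm hf1 Q
    have hHm : Measurable fun y => f y * (φ Q y - emo hS ξ (φ Q) y) :=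
      hfm.mul ((hφ.cont Q).measurable.sub (emo_meas hS _ _))
    have hHb : ∀ y, ‖f y * (φ Q y - emo hS ξ (φ Q) y)‖ ≤ E.indicator (fun y => A * Kq Q y) y := by
      intro y
      rw [norm_mul]
      by_cases hy : y ∈ E
      · rw [Set.indicator_of_mem hy]
        calc _ ≤ 1 * ‖φ Q y - emo hS ξ (φ Q) y‖ := by gcongr; exact hf1 y
          _ ≤ _ := by rw [one_mul]; exact hdiff y
      · rw [hf0 y hy, norm_zero, zero_mul, Set.indicator_of_notMem hy]
    have hAi : Integrable (E.indicator fun y => A * Kq Q y) := ((hKi Q).const_mul A).indicator hE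
    have hHi : Integrable fun y => f y * (φ Q y - emo hS ξ (φ Q) y) :=
      hAi.mono' hHm.aestronglyMeasurable (Filter.Eventually.of_forall hHb)
    have hei : Integrable fun y => f y * emo hS ξ (φ Q) y := by
      have := hφi.sub hHi
      refine this.congr (Filter.Eventually.of_forall fun y => ?_)
      simp only [Pi.sub_apply]; ring
    have hgi := wu_integrable hφ (by omega) hgm hgb Q
    have e : wu f φ Q = wu g φ Q + ∫ y, f y * (φ Q y - emo hS ξ (φ Q) y) := by
      unfold wu
      rw [hg, ← emo_adj hS ξ hei hgi, ← integral_add hei hHi]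
      congr 1; ext y; ring
    unfold wc
    rw [e]
    refine (norm_add_le _ _).trans ?_
    gcongr
    refine (norm_integral_le_of_norm_le hAi (Filter.Eventually.of_forall hHb)).trans ?_
    rw [integral_indicator hE, integral_const_mul]
  have hsup : ∀ Q ∈ T, c Q ≤ 16 * ρ := by
    intro Q hQ
    have hp := pw_pos Q.I.1
    calc c Q ≤ ∫ y in E, pw Q.I.1 * (wt Q.I y)⁻¹ :=
          integral_mono (hKi Q).integrableOn ((wt_inv_integrable Q.I).const_mul _).integrableOn
            (hK1 Q)
      _ = pw Q.I.1 * ∫ y in E, (wt Q.I y)⁻¹ := integral_const_mul _ _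
      _ ≤ pw Q.I.1 * (16 * ρ * len Q.I) := by gcongr; exact dens_int hE hρ (hd Q hQ)
      _ = 16 * ρ * (pw Q.I.1 * len Q.I) := by ring
      _ = _ := by rw [pw_mul_len, mul_one]
  have hsum : ∑ Q ∈ T, len Q.I * c Q ≤ 208 * (16 * ρ * len J) := by
    simp only [hc, ← integral_const_mul]
    rw [← integral_finsetSum _ fun Q _ => ((hKi Q).const_mul _).integrableOn]
    calc ∫ y in E, ∑ Q ∈ T, len Q.I * Kq Q y ≤ ∫ y in E, 208 * (wt J y)⁻¹ := by
          refine integral_mono (integrable_finsetSum _ fun Q _ => ((hKi Q).const_mul _).integrableOn)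
            ((wt_inv_integrable J).const_mul _).integrableOn fun y => ?_
          have hwJ := wt_pos J y
          calc ∑ Q ∈ T, len Q.I * Kq Q y
              ≤ ∑ Q ∈ T, (pw (-|Q.I.1 - (LL hS y).1|) * (wt Q.I y)⁻¹) * (4 * (wt J y)⁻¹) := by
                refine Finset.sum_le_sum fun Q hQ => ?_
                have hw := wt_pos Q.I y
                have hp := pw_pos (-|Q.I.1 - (LL hS y).1|)
                have h1 : (wt Q.I y)⁻¹ ≤ 4 * (wt J y)⁻¹ := by
                  rw [inv_le_iff_one_le_mul₀ hw, mul_right_comm, ← div_eq_mul_inv, one_le_div hwJ]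
                  exact wt_le_of_sub (hT Q hQ).1 y
                calc len Q.I * Kq Q y = (len Q.I * pw Q.I.1) *
                      ((pw (-|Q.I.1 - (LL hS y).1|) * (wt Q.I y)⁻¹) * (wt Q.I y)⁻¹) := by
                      simp only [hKq]; rw [pow_two, mul_inv]; ring
                  _ ≤ _ := by
                      rw [len_mul_pw, one_mul]
                      gcongr
            _ ≤ 52 * (4 * (wt J y)⁻¹) := by
                rw [← Finset.sum_mul]
                gcongr
                exact tree_kernel_sum T hT _ y
            _ = _ := by ring
      _ = 208 * ∫ y in E, (wt J y)⁻¹ := integral_const_mul _ _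
      _ ≤ _ := by gcongr; exact dens_int hE hρ hJ
  have hgtree := bessel_tree hφ hq hN hgm hgb T hL hT hκ hsp
  have hlm := lm_const (q := q) hgm (by positivity) hgb J hq
  calc ∑ Q ∈ T, len Q.I * wc f φ Q ^ 2
      ≤ ∑ Q ∈ T, (2 * (len Q.I * wc g φ Q ^ 2) + 2 * (A * (16 * ρ)) * A * (len Q.I * c Q)) := by
        refine Finset.sum_le_sum fun Q hQ => ?_
        have hl := len_pos Q.I
        have h0 := wc_nonneg f φ Q
        have h1 := hmain Q hQ
        have h2 := hsup Q hQ
        have h3 := hc0 Q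
        have h4 : wc f φ Q ^ 2 ≤ (wc g φ Q + A * c Q) ^ 2 := by gcongr
        have h5 : (A * c Q) * (A * c Q) ≤ (A * (16 * ρ)) * (A * c Q) := by gcongr
        have h6 : wc f φ Q ^ 2 ≤ 2 * wc g φ Q ^ 2 + 2 * ((A * (16 * ρ)) * (A * c Q)) := by
          nlinarith [sq_nonneg (wc g φ Q - A * c Q)]
        calc _ ≤ len Q.I * (2 * wc g φ Q ^ 2 + 2 * ((A * (16 * ρ)) * (A * c Q))) := by gcongr
          _ = _ := by ring
    _ = 2 * ∑ Q ∈ T, len Q.I * wc g φ Q ^ 2 + 2 * (A * (16 * ρ)) * A * ∑ Q ∈ T, len Q.I * c Q := by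
        rw [Finset.sum_add_distrib, Finset.mul_sum, Finset.mul_sum]
    _ ≤ 2 * ((16 * 16 ^ q * 13) * ((12 * ρ) ^ 2 * 4 * len J)) +
        2 * (A * (16 * ρ)) * A * (208 * (16 * ρ * len J)) := by
        gcongr
        exact hgtree.trans (by gcongr)
    _ = _ := by unfold C5; ring

end
end

noncomputable section

section
variable {E : Set ℝ} {f : ℝ → ℂ} {ρ : ℝ} {N q : ℕ} {KK : ℝ} {φ : Tile → ℝ → ℂ} {L s₀ r : ℤ}
  {D : Finset Dy} {𝒬 : Finset Tile} {C2 : ℤ}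

def C6 (q : ℕ) : ℝ := 16 * 16 ^ q * (13 + 2 * 13312)
lemma C6_pos (q : ℕ) : 0 < C6 q := by unfold C6; positivity

lemma size_good (hφ : WP N KK φ) (hq : 1 ≤ q) (hN : q + 3 ≤ N) (hE : MeasurableSet E)
    (hfm : Measurable f) (hf1 : ∀ x, ‖f x‖ ≤ 1) (hf0 : ∀ x, x ∉ E → f x = 0) (hρ : 0 ≤ ρ)
    (hL : 2 ≤ L) (hKK : (C2 : ℝ) + 1 ≤ KK) (hsp : ∀ Q ∈ 𝒬, Sparse L s₀ r Q)
    (hD : ∀ I ∈ D, Dens E ρ I) (hQD : ∀ Q ∈ 𝒬, Q.I ∈ D) :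
    SizeLe D (wc f φ) C2 𝒬 (√(C5 N q) * ρ) := by
  intro J hJ ξ κ hκ hκ2 T hT hTT
  rw [mul_pow, Real.sq_sqrt (C5_pos N q).le]
  refine tree_size hφ hq hN hE hfm hf1 hf0 hρ T hL hTT hκ ?_ (fun Q hQ => hsp Q (hT hQ)) (hD J hJ)
    fun Q hQ => hD _ (hQD Q (hT hQ))
  have : ((|κ| : ℤ) : ℝ) ≤ C2 := by exact_mod_cast hκ2
  push_cast at this
  linarith

lemma pack_of_lm (hφ : WP N KK φ) (hq : 1 ≤ q) (hN : q + 3 ≤ N)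
    (hfm : Measurable f) (hf1 : ∀ x, ‖f x‖ ≤ 1) {θ : ℝ}
    (hL : 2 ≤ L) (hsp : ∀ Q ∈ 𝒬, Sparse L s₀ r Q) (hθ : ∀ K ∈ D, lm f K q ≤ θ * len K) :
    Pack D (wc f φ) 𝒬 (C6 q * θ) := by
  intro lam W hlam hW hWQ K hK hKW
  refine (bessel_forest hφ hq hN hfm hf1 hL hlam hW (fun t ht Q hQ => hsp Q (hWQ t ht hQ)) K
    hKW).trans ?_
  rw [mul_assoc (C6 q)]
  exact mul_le_mul_of_nonneg_left (hθ K hK) (C6_pos q).le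

lemma size_of_lm (hφ : WP N KK φ) (hq : 1 ≤ q) (hN : q + 3 ≤ N)
    (hfm : Measurable f) (hf1 : ∀ x, ‖f x‖ ≤ 1) {θ : ℝ} (hθ0 : 0 ≤ θ)
    (hL : 2 ≤ L) (hsp : ∀ Q ∈ 𝒬, Sparse L s₀ r Q) (hθ : ∀ K ∈ D, lm f K q ≤ θ * len K) :
    SizeLe D (wc f φ) C2 𝒬 (√(C6 q * θ)) := by
  intro J hJ ξ κ hκ hκ2 T hT hTT
  have := C6_pos q
  rw [Real.sq_sqrt (by positivity)]
  refine (bessel_tree hφ hq hN hfm hf1 T hL hTT hκ (fun Q hQ => hsp Q (hT hQ))).trans ?_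
  rw [mul_assoc (C6 q)]
  refine mul_le_mul ?_ (hθ J hJ) (lm_nonneg _ _ _) this.le
  unfold C6
  gcongr; norm_num

lemma lm_dens (hE : MeasurableSet E)
    (hf1 : ∀ x, ‖f x‖ ≤ 1) (hf0 : ∀ x, x ∉ E → f x = 0) (hρ : 0 ≤ ρ) (hq : 1 ≤ q) {K : Dy}
    (h : Dens E ρ K) : lm f K q ≤ (16 * ρ) * len K := by
  refine le_trans ?_ (dens_int hE hρ h)
  rw [← integral_indicator hE]
  refine integral_mono_of_nonneg (Filter.Eventually.of_forall fun y => ?_)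
    ((wt_inv_integrable K).indicator hE) (Filter.Eventually.of_forall fun y => ?_)
  · have := wt_pos K y; simp only [Pi.zero_apply]; positivity
  · have hw := wt_pos K y
    simp only
    by_cases hy : y ∈ E
    · rw [Set.indicator_of_mem hy]
      calc ‖f y‖ ^ 2 * (wt K y ^ (2 * q))⁻¹ ≤ 1 ^ 2 * (wt K y)⁻¹ := by
            gcongr
            · exact hf1 y
            · exact le_self_pow₀ (one_le_wt K y) (by omega)
        _ = _ := by ring
    · rw [hf0 y hy, Set.indicator_of_notMem hy]; simp

def thl (q l : ℕ) : ℝ := 4 * 4 ^ (2 * q - 1) * ((1 / 4) ^ (2 * q - 1)) ^ l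
lemma thl_pos (q l : ℕ) : 0 < thl q l := by unfold thl; positivity

lemma lm_far (hfm : Measurable f) (hf1 : ∀ x, ‖f x‖ ≤ 1) (hq : 1 ≤ q) {K : Dy} {l : ℕ}
    (h : 1 ≤ l → ∀ x, |x - cen K| ≤ 2 ^ (l - 1) * len K → f x = 0) : lm f K q ≤ thl q l * len K := by
  have hl := len_pos K
  rcases l with _ | l
  · refine (lm_const hfm (by norm_num : (0 : ℝ) ≤ 1) hf1 K hq).trans ?_
    unfold thl
    have : (1 : ℝ) ≤ 4 ^ (2 * q - 1) := one_le_pow₀ (by norm_num)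
    gcongr ?_ * len K
    simp; linarith
  · have h' : ∀ x, |x - cen K| ≤ 2 ^ l * len K → f x = 0 := h (by omega)
    calc lm f K q ≤ ∫ y, ((1 / 4) ^ l) ^ (2 * q - 1) * (wt K y)⁻¹ := by
          refine integral_mono_of_nonneg (Filter.Eventually.of_forall fun y => ?_)
            ((wt_inv_integrable K).const_mul _) (Filter.Eventually.of_forall fun y => ?_)
          · have := wt_pos K y; simp only [Pi.zero_apply]; positivity
          · have hw := wt_pos K y
            simp only
            by_cases hy : |y - cen K| ≤ 2 ^ l * len K
            · rw [h' y hy]; simp; positivity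
            · push Not at hy
              have h1 : (4 : ℝ) ^ l ≤ wt K y := by
                have h2 : (2 : ℝ) ^ l ≤ |pw K.1 * (y - cen K)| := by
                  rw [abs_mul, abs_of_pos (pw_pos _)]
                  calc (2 : ℝ) ^ l = pw K.1 * (2 ^ l * len K) := by
                        rw [mul_left_comm, pw_mul_len, mul_one]
                    _ ≤ _ := mul_le_mul_of_nonneg_left hy.le (pw_pos _).le
                unfold wt bw
                rw [← sq_abs, show (4 : ℝ) ^ l = (2 ^ l) ^ 2 by
                  rw [← pow_mul, mul_comm, pow_mul]; norm_num]
                have : ((2 : ℝ) ^ l) ^ 2 ≤ |pw K.1 * (y - cen K)| ^ 2 := by gcongr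
                linarith
              have h3 : ((1 : ℝ) / 4) ^ l = (4 ^ l)⁻¹ := by rw [one_div, inv_pow]
              calc ‖f y‖ ^ 2 * (wt K y ^ (2 * q))⁻¹ ≤ 1 ^ 2 * (wt K y ^ (2 * q))⁻¹ := by
                    gcongr; exact hf1 y
                _ = (wt K y ^ (2 * q - 1))⁻¹ * (wt K y)⁻¹ := by
                    rw [← mul_inv, ← pow_succ, show 2 * q - 1 + 1 = 2 * q by omega]; ring
                _ ≤ _ := by
                    rw [h3, inv_pow]
                    gcongr
      _ = ((1 / 4) ^ l) ^ (2 * q - 1) * (π * len K) := by rw [integral_const_mul, wt_inv_integral]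
      _ ≤ ((1 / 4) ^ l) ^ (2 * q - 1) * (4 * len K) := by gcongr; exact Real.pi_le_four
      _ = thl q (l + 1) * len K := by
          unfold thl
          rw [pow_succ, ← pow_mul, ← pow_mul, mul_comm l]
          have : (4 : ℝ) ^ (2 * q - 1) * (1 / 4) ^ (2 * q - 1) = 1 := by
            rw [← mul_pow]; norm_num
          linear_combination (-(4 * ((1 / 4 : ℝ) ^ ((2 * q - 1) * l)) * len K)) * this
end

/-! ### Vitali -/
lemma vitali_le {E : Set ℝ} (hE : MeasurableSet E) (hEf : volume E < ⊤) {lam : ℝ} (hlam : 0 < lam)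
    (s : Set (ℝ × ℝ)) (h : ∀ p ∈ s, 0 < p.2 ∧
      ENNReal.ofReal (2 * p.2 * lam) ≤ volume (E ∩ Set.Icc (p.1 - p.2) (p.1 + p.2))) :
    volume (⋃ p ∈ s, Set.Icc (p.1 - p.2) (p.1 + p.2)) ≤ ENNReal.ofReal (5 / lam) * volume E := by
  obtain ⟨u, hus, hud, huc⟩ := Vitali.exists_disjoint_subfamily_covering_enlargement_closedBall s
    (fun p => p.1) (fun p => p.2) (volume.real E / (2 * lam)) (by
      intro p hp
      obtain ⟨h1, h2⟩ := h p hp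
      have h3 := h2.trans (measure_mono Set.inter_subset_left)
      rw [ENNReal.ofReal_le_iff_le_toReal hEf.ne] at h3
      rw [le_div_iff₀ (by positivity)]
      change _ ≤ volume.real E at h3
      linarith) 5 (by norm_num)
  have hcount : u.Countable := by
    refine hud.countable_of_nonempty_interior fun p hp => ?_
    rw [Real.closedBall_eq_Icc, interior_Icc]
    have := (h p (hus hp)).1
    exact Set.nonempty_Ioo.2 (by linarith)
  calc volume (⋃ p ∈ s, Set.Icc (p.1 - p.2) (p.1 + p.2))
      ≤ volume (⋃ p ∈ u, Metric.closedBall p.1 (5 * p.2)) := by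
        refine measure_mono (Set.iUnion₂_subset fun p hp => ?_)
        obtain ⟨b, hb, hsub⟩ := huc p hp
        rw [← Real.closedBall_eq_Icc]
        exact hsub.trans (Set.subset_biUnion_of_mem (u := fun p : ℝ × ℝ =>
          Metric.closedBall p.1 (5 * p.2)) hb)
    _ ≤ ∑' p : u, volume (Metric.closedBall p.1.1 (5 * p.1.2)) := measure_biUnion_le _ hcount _
    _ ≤ ∑' p : u, ENNReal.ofReal (5 / lam) * volume (E ∩ Metric.closedBall p.1.1 p.1.2) := by
        refine ENNReal.tsum_le_tsum fun p => ?_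
        obtain ⟨h1, h2⟩ := h p.1 (hus p.2)
        rw [Real.volume_closedBall, Real.closedBall_eq_Icc]
        refine le_trans ?_ (mul_le_mul_right h2 _)
        rw [← ENNReal.ofReal_mul (by positivity)]
        apply ENNReal.ofReal_le_ofReal
        apply le_of_eq; field_simp
    _ = ENNReal.ofReal (5 / lam) * volume (⋃ p ∈ u, E ∩ Metric.closedBall p.1 p.2) := by
        rw [ENNReal.tsum_mul_left, measure_biUnion hcount]
        · exact fun p hp p' hp' hne => (hud hp hp' hne).mono Set.inter_subset_right
            Set.inter_subset_right
        · exact fun p _ => hE.inter Metric.isClosed_closedBall.measurableSet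
    _ ≤ _ := by
        gcongr
        exact Set.iUnion₂_subset fun p _ => Set.inter_subset_left

/-- exceptional set -/
def Exc (E : Set ℝ) (lam : ℝ) : Set ℝ := {x | ∃ r, 0 < r ∧
  ENNReal.ofReal (2 * r * lam) < volume (E ∩ Set.Icc (x - r) (x + r))}

lemma Exc_open (E : Set ℝ) {lam : ℝ} (hlam : 0 < lam) : IsOpen (Exc E lam) := by
  rw [Metric.isOpen_iff]
  rintro x ⟨r, hr, h⟩
  have hc : Filter.Tendsto (fun t : ℝ => ENNReal.ofReal (2 * t * lam)) (nhds r)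
      (nhds (ENNReal.ofReal (2 * r * lam))) := by
    apply ENNReal.tendsto_ofReal
    exact Continuous.tendsto (by fun_prop) r
  have h2 := hc.eventually (gt_mem_nhds h)
  obtain ⟨ε, hε, h3⟩ := Metric.eventually_nhds_iff.1 h2
  refine ⟨ε / 2, by positivity, fun y hy => ?_⟩
  rw [Metric.mem_ball, Real.dist_eq] at hy
  refine ⟨r + ε / 2, by positivity, ?_⟩
  refine lt_of_lt_of_le (h3 (y := r + ε / 2) ?_) (measure_mono ?_)
  · rw [Real.dist_eq, add_sub_cancel_left, abs_of_pos (by positivity)]; linarith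
  · intro z hz
    rw [abs_lt] at hy
    exact ⟨hz.1, by linarith [hz.2.1], by linarith [hz.2.2]⟩

lemma Exc_vol {E : Set ℝ} (hE : MeasurableSet E) (hEf : volume E < ⊤) {lam : ℝ} (hlam : 0 < lam) :
    volume (Exc E lam) ≤ ENNReal.ofReal (5 / lam) * volume E := by
  refine le_trans (measure_mono ?_) (vitali_le hE hEf hlam {p | 0 < p.2 ∧
      ENNReal.ofReal (2 * p.2 * lam) ≤ volume (E ∩ Set.Icc (p.1 - p.2) (p.1 + p.2))} fun p hp => hp)
  rintro x ⟨r, hr, h⟩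
  refine Set.mem_biUnion (x := ((x, r) : ℝ × ℝ)) ⟨hr, h.le⟩ ?_
  exact ⟨by simp only; linarith, by simp only; linarith⟩

/-! ### sup density -/
lemma exists_dens_level {E : Set ℝ} (hE : volume E ≠ 0) (I : Dy) :
    ∃ d : ℕ, Dens E ((1 / 2) ^ d) I ∧ ∃ r, len I ≤ r ∧
      ENNReal.ofReal (2 * r * (1 / 2) ^ (d + 1)) ≤ volume (E ∩ Set.Icc (cen I - r) (cen I + r)) := by
  have hl := len_pos I
  by_contra hcon
  push Not at hcon
  have hall : ∀ d : ℕ, Dens E ((1 / 2) ^ d) I := by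
    intro d
    induction d with
    | zero =>
      intro r hr
      refine (measure_mono Set.inter_subset_right).trans ?_
      rw [Real.volume_Icc]
      apply ENNReal.ofReal_le_ofReal
      simp; linarith
    | succ d ih => exact fun r hr => (hcon d ih r hr).le
  have hzero : ∀ r, len I ≤ r → volume (E ∩ Set.Icc (cen I - r) (cen I + r)) = 0 := by
    intro r hr
    refine le_antisymm ?_ bot_le
    have ht : Filter.Tendsto (fun d : ℕ => ENNReal.ofReal (2 * r * (1 / 2) ^ d)) Filter.atTop
        (nhds 0) := by
      rw [← ENNReal.ofReal_zero]
      apply ENNReal.tendsto_ofReal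
      have := (tendsto_pow_atTop_nhds_zero_of_lt_one (r := (1 / 2 : ℝ)) (by norm_num)
        (by norm_num)).const_mul (2 * r)
      simpa using this
    exact ge_of_tendsto' ht fun d => hall d r hr
  apply hE
  have hcov : E ⊆ ⋃ k : ℕ, E ∩ Set.Icc (cen I - (len I + k)) (cen I + (len I + k)) := by
    intro x hx
    obtain ⟨k, hk⟩ := exists_nat_ge |x - cen I|
    rw [abs_le] at hk
    exact Set.mem_iUnion.2 ⟨k, hx, by linarith, by linarith⟩
  refine measure_mono_null hcov (measure_iUnion_null fun k => hzero _ ?_)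
  have : (0 : ℝ) ≤ k := Nat.cast_nonneg k
  linarith

lemma UU_level {E : Set ℝ} (hE : MeasurableSet E) (hEf : volume E < ⊤) (D : Finset Dy) (d : ℕ)
    (h : ∀ I ∈ D, ∃ r, len I ≤ r ∧
      ENNReal.ofReal (2 * r * (1 / 2) ^ (d + 1)) ≤ volume (E ∩ Set.Icc (cen I - r) (cen I + r))) :
    volume.real (UU D) ≤ 10 * 2 ^ d * volume.real E := by
  have h1 := vitali_le hE hEf (lam := (1 / 2) ^ (d + 1)) (by positivity)
    {p | 0 < p.2 ∧ ENNReal.ofReal (2 * p.2 * (1 / 2) ^ (d + 1)) ≤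
      volume (E ∩ Set.Icc (p.1 - p.2) (p.1 + p.2))} fun p hp => hp
  have h2 : volume (UU D) ≤ ENNReal.ofReal (5 / (1 / 2) ^ (d + 1)) * volume E := by
    refine le_trans (measure_mono ?_) h1
    intro x hx
    unfold UU at hx
    obtain ⟨I, hI, hxI⟩ := Set.mem_iUnion₂.1 hx
    obtain ⟨r, hr, hv⟩ := h I hI
    have hl := len_pos I
    refine Set.mem_biUnion (x := ((cen I, r) : ℝ × ℝ)) ⟨by simp only; linarith, hv⟩ ?_
    have := abs_le.1 (dist_cen_le hxI)
    exact ⟨by simp only; linarith, by simp only; linarith⟩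
  have h3 := ENNReal.toReal_mono (ENNReal.mul_ne_top ENNReal.ofReal_ne_top hEf.ne) h2
  rw [ENNReal.toReal_mul, ENNReal.toReal_ofReal (by positivity)] at h3
  refine h3.trans (le_of_eq ?_)
  rw [Measure.real, one_div, inv_pow, div_inv_eq_mul, pow_succ]; ring
end

noncomputable section

lemma exists_w {n k : ℕ} (hkn : 2 * k < n) {a : Fin n → ℝ} (ha : ∀ i, a i < 1)
    (hreg : ∀ S : Finset (Fin n), S.Nonempty → ∑ i ∈ S, a i < ((n : ℝ) - 2 * k + S.card) / 2) :
    ∃ w : Fin n → ℝ, (∀ i, 0 ≤ w i) ∧ (∀ i, w i < 1 / 2) ∧ (∀ i, w i < 1 - a i) ∧ ∑ i, w i = k := by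
  set u : Fin n → ℝ := fun i => min (1 / 2) (1 - a i) with hu
  have hu0 : ∀ i, 0 < u i := fun i => lt_min (by norm_num) (by linarith [ha i])
  have hkn' : 2 * (k : ℝ) < n := by exact_mod_cast hkn
  have hsum : (k : ℝ) < ∑ i, u i := by
    set R := Finset.univ.filter fun i => 1 / 2 < a i with hR
    have e : ∑ i, u i = ∑ i ∈ R, (1 - a i) + ∑ i ∈ Finset.univ.filter (fun i => ¬ 1 / 2 < a i), (1 / 2 : ℝ) := by
      rw [← Finset.sum_filter_add_sum_filter_not Finset.univ (fun i => 1 / 2 < a i)]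
      congr 1
      · refine Finset.sum_congr rfl fun i hi => ?_
        rw [Finset.mem_filter] at hi
        exact min_eq_right (by linarith [hi.2])
      · refine Finset.sum_congr rfl fun i hi => ?_
        rw [Finset.mem_filter] at hi
        exact min_eq_left (by linarith [hi.2])
    have hcard : ((Finset.univ.filter (fun i => ¬ 1 / 2 < a i)).card : ℝ) = n - R.card := by
      have := Finset.card_filter_add_card_filter_not (s := (Finset.univ : Finset (Fin n))) (fun i => 1 / 2 < a i)
      rw [Finset.card_univ, Fintype.card_fin] at this
      rw [eq_sub_iff_add_eq, add_comm]; exact_mod_cast this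
    rw [e, Finset.sum_sub_distrib, Finset.sum_const, Finset.sum_const, nsmul_eq_mul, nsmul_eq_mul, hcard]
    rcases R.eq_empty_or_nonempty with h | h
    · rw [h]; simp; linarith
    · have := hreg R h; linarith
  have hs0 : 0 < ∑ i, u i := lt_of_le_of_lt (Nat.cast_nonneg k) hsum
  have ht : (k : ℝ) / ∑ i, u i < 1 := (div_lt_one hs0).2 hsum
  refine ⟨fun i => k / (∑ i, u i) * u i, fun i => ?_, fun i => ?_, fun i => ?_, ?_⟩
  · have := hu0 i; positivity
  · exact (mul_lt_of_lt_one_left (hu0 i) ht).trans_le (min_le_left _ _)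
  · exact (mul_lt_of_lt_one_left (hu0 i) ht).trans_le (min_le_right _ _)
  · rw [← Finset.mul_sum, div_mul_cancel₀ _ hs0.ne']

lemma term_le {v Y H S5 S6 w α γ : ℝ} (κ : ℕ) (hv : 0 < v) (hY : 0 < Y) (hH : 0 < H) (h5 : 0 < S5)
    (h6 : 0 < S6) (hγα : γ ≤ α) (hρ : (1 / 2 : ℝ) ^ κ ≤ H * (Y * v)) :
    (10 * 2 ^ κ * v) ^ γ * ((S5 * (1 / 2) ^ κ) ^ (1 - 2 * w) * (S6 * (1 / 2) ^ κ) ^ w) ≤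
      10 ^ γ * S5 ^ (1 - 2 * w) * S6 ^ w * H ^ (α - γ) * v ^ α * Y ^ (α - γ) *
        ((1 / 2 : ℝ) ^ (1 - w - α)) ^ κ := by
  set ρ : ℝ := (1 / 2) ^ κ with hρd
  have hρ0 : 0 < ρ := by positivity
  have h2 : (2 : ℝ) ^ κ = ρ⁻¹ := by rw [hρd, one_div, inv_pow, inv_inv]
  have hx : ((1 / 2 : ℝ) ^ (1 - w - α)) ^ κ = ρ ^ (1 - w - α) := by
    rw [hρd, ← Real.rpow_natCast, ← Real.rpow_natCast, ← Real.rpow_mul (by norm_num),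
      ← Real.rpow_mul (by norm_num), mul_comm]
  have hle : ρ ^ (α - γ) ≤ H ^ (α - γ) * (Y ^ (α - γ) * v ^ (α - γ)) := by
    rw [← Real.mul_rpow hY.le hv.le, ← Real.mul_rpow hH.le (by positivity)]
    exact Real.rpow_le_rpow hρ0.le hρ (by linarith)
  have hvv : v ^ γ * v ^ (α - γ) = v ^ α := by rw [← Real.rpow_add hv]; congr 1; ring
  have hρρ : (ρ⁻¹) ^ γ * ρ ^ (1 - 2 * w) * ρ ^ w = ρ ^ (α - γ) * ρ ^ (1 - w - α) := by
    rw [Real.inv_rpow hρ0.le, ← Real.rpow_neg hρ0.le, ← Real.rpow_add hρ0, ← Real.rpow_add hρ0,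
      ← Real.rpow_add hρ0]
    congr 1; ring
  rw [hx, h2, Real.mul_rpow (by positivity) hv.le, Real.mul_rpow (by norm_num) (by positivity),
    Real.mul_rpow h5.le hρ0.le, Real.mul_rpow h6.le hρ0.le]
  calc 10 ^ γ * ρ⁻¹ ^ γ * v ^ γ * (S5 ^ (1 - 2 * w) * ρ ^ (1 - 2 * w) * (S6 ^ w * ρ ^ w))
      = 10 ^ γ * S5 ^ (1 - 2 * w) * S6 ^ w * v ^ γ * (ρ⁻¹ ^ γ * ρ ^ (1 - 2 * w) * ρ ^ w) := by ring
    _ = 10 ^ γ * S5 ^ (1 - 2 * w) * S6 ^ w * v ^ γ * (ρ ^ (α - γ) * ρ ^ (1 - w - α)) := by rw [hρρ]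
    _ ≤ 10 ^ γ * S5 ^ (1 - 2 * w) * S6 ^ w * v ^ γ *
        ((H ^ (α - γ) * (Y ^ (α - γ) * v ^ (α - γ))) * ρ ^ (1 - w - α)) := by gcongr
    _ = _ := by rw [← hvv]; ring

lemma class_calc {n : ℕ} {a w : Fin n → ℝ} (j : Fin n) (haj : a j < 0) (hapos : ∀ i, i ≠ j → 0 ≤ a i)
    (hasum : ∑ i, a i = 1) {q : ℕ} {H S5 S6 S7 : ℝ} (hH : 0 < H) (h5 : 0 < S5) (h6 : 0 < S6)
    (h7 : 0 < S7) : ∃ C : ℝ, 0 ≤ C ∧ ∀ (v : Fin n → ℝ) (κ : Fin n → ℕ) (U : ℝ), (∀ i, 0 < v i) → 0 ≤ U →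
      (∀ i, i ≠ j → U ≤ 10 * 2 ^ κ i * v i) →
      (∀ i, i ≠ j → (1 / 2 : ℝ) ^ κ i ≤ H * (2 ^ κ j / v j * v i)) →
      U * ∏ i, (if i = j then √(S7 * thl q (κ j)) ^ (1 - 2 * w i) * (S7 * thl q (κ j)) ^ w i else
        (S5 * (1 / 2) ^ κ i) ^ (1 - 2 * w i) * (S6 * (1 / 2) ^ κ i) ^ w i) ≤
      C * (∏ i, v i ^ a i) * ∏ i, (if i = j then (1 / 2) ^ (2 * q - 1) * 2 ^ (- a j) else
        (1 / 2 : ℝ) ^ (1 - w i - a i)) ^ κ i := by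
  set γ : Fin n → ℝ := fun i => a i / (1 - a j) with hγ
  have hsumj : ∑ i ∈ Finset.univ.erase j, a i = 1 - a j := by
    rw [← hasum, ← Finset.add_sum_erase _ _ (Finset.mem_univ j)]; ring
  have hγs : ∑ i ∈ Finset.univ.erase j, γ i = 1 := by
    simp only [hγ]
    rw [← Finset.sum_div, hsumj, div_self (by linarith)]
  have hγa : ∀ i, i ≠ j → γ i ≤ a i := fun i hi => div_le_self (hapos i hi) (by linarith)
  have hγ0 : ∀ i, i ≠ j → 0 ≤ γ i := fun i hi => div_nonneg (hapos i hi) (by linarith)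
  set c : Fin n → ℝ := fun i => 10 ^ γ i * S5 ^ (1 - 2 * w i) * S6 ^ w i * H ^ (a i - γ i) with hc
  have hc0 : ∀ i, 0 ≤ c i := fun i => by simp only [hc]; positivity
  refine ⟨(∏ i ∈ Finset.univ.erase j, c i) * √(S7 * (4 * 4 ^ (2 * q - 1))),
    mul_nonneg (Finset.prod_nonneg fun i _ => hc0 i) (Real.sqrt_nonneg _), ?_⟩
  intro v κ U hv hU hU1 hρ
  have hY : 0 < 2 ^ κ j / v j := by have := hv j; positivity
  set Y := 2 ^ κ j / v j with hYd
  have hUp : U ≤ ∏ i ∈ Finset.univ.erase j, (10 * 2 ^ κ i * v i) ^ γ i := by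
    calc U = U ^ (∑ i ∈ Finset.univ.erase j, γ i) := by rw [hγs, Real.rpow_one]
      _ = ∏ i ∈ Finset.univ.erase j, U ^ γ i := by
          rcases hU.eq_or_lt with h | h
          · rw [← h]
            rw [hγs, Real.rpow_one]
            symm
            obtain ⟨i, hi, hne⟩ : ∃ i ∈ Finset.univ.erase j, γ i ≠ 0 := by
              by_contra hcon
              push Not at hcon
              rw [Finset.sum_eq_zero hcon] at hγs
              exact zero_ne_one hγs
            exact Finset.prod_eq_zero hi (Real.zero_rpow hne)
          · exact Real.rpow_sum_of_pos h _ _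
      _ ≤ _ := by
          refine Finset.prod_le_prod (fun i _ => by positivity) fun i hi => ?_
          have hij := (Finset.mem_erase.1 hi).1
          exact Real.rpow_le_rpow hU (hU1 i hij) (hγ0 i hij)
  rw [← Finset.mul_prod_erase Finset.univ (fun i => if i = j then _ else _) (Finset.mem_univ j),
    ← Finset.mul_prod_erase Finset.univ (fun i => v i ^ a i) (Finset.mem_univ j),
    ← Finset.mul_prod_erase Finset.univ (fun i => (if i = j then _ else _ : ℝ) ^ κ i) (Finset.mem_univ j)]
  simp only [if_true]
  have er : ∀ (F G : Fin n → ℝ), ∏ i ∈ Finset.univ.erase j, (if i = j then F i else G i) =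
      ∏ i ∈ Finset.univ.erase j, G i := by
    intro F G
    refine Finset.prod_congr rfl fun i hi => if_neg (Finset.mem_erase.1 hi).1
  rw [er (fun i => √(S7 * thl q (κ j)) ^ (1 - 2 * w i) * (S7 * thl q (κ j)) ^ w i)]
  have er2 : ∏ i ∈ Finset.univ.erase j, (if i = j then (1 / 2) ^ (2 * q - 1) * 2 ^ (- a j) else
        (1 / 2 : ℝ) ^ (1 - w i - a i)) ^ κ i =
      ∏ i ∈ Finset.univ.erase j, ((1 / 2 : ℝ) ^ (1 - w i - a i)) ^ κ i := by
    refine Finset.prod_congr rfl fun i hi => by rw [if_neg (Finset.mem_erase.1 hi).1]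
  rw [er2]
  have hTj : √(S7 * thl q (κ j)) ^ (1 - 2 * w j) * (S7 * thl q (κ j)) ^ w j =
      √(S7 * (4 * 4 ^ (2 * q - 1))) * ((1 / 2) ^ (2 * q - 1)) ^ κ j := by
    have ht := thl_pos q (κ j)
    have hX : 0 < √(S7 * thl q (κ j)) := Real.sqrt_pos.2 (by positivity)
    have e1 : (S7 * thl q (κ j)) ^ w j = √(S7 * thl q (κ j)) ^ (2 * w j) := by
      rw [Real.rpow_mul hX.le, Real.rpow_two, Real.sq_sqrt (by positivity)]
    rw [e1, ← Real.rpow_add hX, sub_add_cancel, Real.rpow_one]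
    unfold thl
    rw [← mul_assoc, Real.sqrt_mul (by positivity)]
    congr 1
    rw [show (((1 / 4 : ℝ) ^ (2 * q - 1)) ^ κ j) = (((1 / 2) ^ (2 * q - 1)) ^ κ j) ^ 2 by
      rw [← pow_mul, ← pow_mul, ← pow_mul, show (1 / 4 : ℝ) = (1 / 2) ^ 2 by norm_num, ← pow_mul]; congr 1; ring, Real.sqrt_sq (by positivity)]
  rw [hTj]
  have hYs : ∏ i ∈ Finset.univ.erase j, Y ^ (a i - γ i) = Y ^ (- a j) := by
    rw [← Real.rpow_sum_of_pos hY, Finset.sum_sub_distrib, hsumj, hγs]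
    congr 1; ring
  have hmain : (∏ i ∈ Finset.univ.erase j, (10 * 2 ^ κ i * v i) ^ γ i) *
      ∏ i ∈ Finset.univ.erase j, ((S5 * (1 / 2) ^ κ i) ^ (1 - 2 * w i) * (S6 * (1 / 2) ^ κ i) ^ w i) ≤
      (∏ i ∈ Finset.univ.erase j, c i) * (∏ i ∈ Finset.univ.erase j, v i ^ a i) * Y ^ (- a j) *
      ∏ i ∈ Finset.univ.erase j, ((1 / 2 : ℝ) ^ (1 - w i - a i)) ^ κ i := by
    rw [← hYs, ← Finset.prod_mul_distrib, ← Finset.prod_mul_distrib, ← Finset.prod_mul_distrib,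
      ← Finset.prod_mul_distrib]
    refine Finset.prod_le_prod (fun i _ => by have := hv i; positivity) fun i hi => ?_
    have hij := (Finset.mem_erase.1 hi).1
    exact term_le (κ i) (hv i) hY hH h5 h6 (hγa i hij) (hρ i hij)
  have hYv : Y ^ (- a j) = v j ^ a j * ((2 : ℝ) ^ (- a j)) ^ κ j := by
    rw [hYd, Real.div_rpow (by positivity) (hv j).le, Real.rpow_neg (hv j).le, div_inv_eq_mul, mul_comm]
    congr 1
    rw [← Real.rpow_natCast, ← Real.rpow_natCast, ← Real.rpow_mul (by norm_num),
      ← Real.rpow_mul (by norm_num), mul_comm]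
  set A := √(S7 * (4 * 4 ^ (2 * q - 1))) with hA
  have hA0 : 0 ≤ A := Real.sqrt_nonneg _
  set X : ℝ := ((1 / 2) ^ (2 * q - 1)) ^ κ j with hX
  have hX0 : 0 ≤ X := by positivity
  set G := ∏ i ∈ Finset.univ.erase j, ((S5 * (1 / 2) ^ κ i) ^ (1 - 2 * w i) * (S6 * (1 / 2) ^ κ i) ^ w i)
    with hG
  have hG0 : 0 ≤ G := Finset.prod_nonneg fun i _ => by positivity
  calc U * (A * X * G) = (U * G) * (A * X) := by ring
    _ ≤ ((∏ i ∈ Finset.univ.erase j, (10 * 2 ^ κ i * v i) ^ γ i) * G) * (A * X) := by gcongr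
    _ ≤ _ := mul_le_mul_of_nonneg_right hmain (by positivity)
    _ = _ := by
        rw [hYv, mul_pow]
        ring
end

noncomputable section

def Om {n : ℕ} (E : Fin n → Set ℝ) (j : Fin n) : Set ℝ :=
  ⋃ i ∈ Finset.univ.erase j, Exc (E i) (10 * n * (volume.real (E i) / volume.real (E j)))

lemma vreal_pos {E : Set ℝ} (h0 : volume E ≠ 0) (hf : volume E < ⊤) : 0 < volume.real E :=
  ENNReal.toReal_pos h0 hf.ne

section
variable {n : ℕ} {E : Fin n → Set ℝ} (j : Fin n)

lemma lam_pos (h0 : ∀ i, volume (E i) ≠ 0) (hf : ∀ i, volume (E i) < ⊤) (i : Fin n) :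
    0 < 10 * (n : ℝ) * (volume.real (E i) / volume.real (E j)) := by
  have hn : (0 : ℝ) < n := by exact_mod_cast j.pos
  have h1 := vreal_pos (h0 i) (hf i)
  have h2 := vreal_pos (h0 j) (hf j)
  positivity

lemma Om_open (h0 : ∀ i, volume (E i) ≠ 0) (hf : ∀ i, volume (E i) < ⊤) : IsOpen (Om E j) :=
  isOpen_biUnion fun i _ => Exc_open _ (lam_pos j h0 hf i)

lemma Om_vol (hE : ∀ i, MeasurableSet (E i)) (h0 : ∀ i, volume (E i) ≠ 0)
    (hf : ∀ i, volume (E i) < ⊤) : volume (Om E j) ≤ ENNReal.ofReal (volume.real (E j) / 2) := by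
  have hn : (0 : ℝ) < n := by exact_mod_cast j.pos
  have hj := vreal_pos (h0 j) (hf j)
  refine (measure_biUnion_finset_le _ _).trans ?_
  have h1 : ∀ i ∈ Finset.univ.erase j,
      volume (Exc (E i) (10 * n * (volume.real (E i) / volume.real (E j)))) ≤
      ENNReal.ofReal (volume.real (E j) / (2 * n)) := by
    intro i _
    have hi := vreal_pos (h0 i) (hf i)
    refine (Exc_vol (hE i) (hf i) (lam_pos j h0 hf i)).trans ?_
    rw [← ENNReal.ofReal_toReal (hf i).ne, ← ENNReal.ofReal_mul (by positivity)]
    apply ENNReal.ofReal_le_ofReal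
    change 5 / (10 * n * (volume.real (E i) / volume.real (E j))) * volume.real (E i) ≤ _
    apply le_of_eq
    field_simp
    norm_num
  refine (Finset.sum_le_sum h1).trans ?_
  rw [← ENNReal.ofReal_sum_of_nonneg (fun i _ => by positivity)]
  apply ENNReal.ofReal_le_ofReal
  rw [Finset.sum_const, nsmul_eq_mul]
  have hc : ((Finset.univ.erase j).card : ℝ) ≤ n := by
    have := Finset.card_le_univ (Finset.univ.erase j)
    rw [Fintype.card_fin] at this
    exact_mod_cast this
  calc ((Finset.univ.erase j).card : ℝ) * (volume.real (E j) / (2 * n))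
      ≤ n * (volume.real (E j) / (2 * n)) := by gcongr
    _ = _ := by field_simp

lemma Om_major (hE : ∀ i, MeasurableSet (E i)) (h0 : ∀ i, volume (E i) ≠ 0)
    (hf : ∀ i, volume (E i) < ⊤) : volume (E j) ≤ 2 * volume (E j \ Om E j) := by
  have h1 := Om_vol j hE h0 hf
  have hj := vreal_pos (h0 j) (hf j)
  have h2 : volume (E j) ≤ volume (E j \ Om E j) + volume (Om E j) := by
    refine (measure_mono (fun x hx => ?_)).trans (measure_union_le _ _)
    by_cases h : x ∈ Om E j
    · exact Or.inr h
    · exact Or.inl ⟨hx, h⟩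
  have hfin : volume (E j \ Om E j) < ⊤ := (measure_mono Set.sdiff_subset).trans_lt (hf j)
  have h3 := h2.trans (add_le_add_right h1 _)
  rw [← ENNReal.ofReal_toReal (hf j).ne, ← ENNReal.ofReal_toReal hfin.ne] at h3 ⊢
  rw [← ENNReal.ofReal_add (by positivity) (by positivity),
    ENNReal.ofReal_le_ofReal_iff (by positivity)] at h3
  rw [show (2 : ℝ≥0∞) = ENNReal.ofReal 2 by norm_num, ← ENNReal.ofReal_mul (by norm_num)]
  apply ENNReal.ofReal_le_ofReal
  have : volume.real (E j) = (volume (E j)).toReal := rfl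
  linarith

lemma Om_ne (hE : ∀ i, MeasurableSet (E i)) (h0 : ∀ i, volume (E i) ≠ 0)
    (hf : ∀ i, volume (E i) < ⊤) : ∃ x, x ∉ Om E j := by
  by_contra h
  push Not at h
  have h1 := Om_vol j hE h0 hf
  rw [Set.eq_univ_of_forall h, Real.volume_univ] at h1
  exact absurd h1 (by simp)

lemma exists_l (hE : ∀ i, MeasurableSet (E i)) (h0 : ∀ i, volume (E i) ≠ 0)
    (hf : ∀ i, volume (E i) < ⊤) (I : Dy) : ∃ l : ℕ,
      (∃ x, x ∉ Om E j ∧ |x - cen I| ≤ 2 ^ l * len I) ∧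
      (1 ≤ l → ∀ x, |x - cen I| ≤ 2 ^ (l - 1) * len I → x ∈ Om E j) := by
  have hex : ∃ l : ℕ, ∃ x, x ∉ Om E j ∧ |x - cen I| ≤ 2 ^ l * len I := by
    obtain ⟨x, hx⟩ := Om_ne j hE h0 hf
    obtain ⟨l, hl⟩ := pow_unbounded_of_one_lt (|x - cen I| / len I) (by norm_num : (1 : ℝ) < 2)
    refine ⟨l, x, hx, ?_⟩
    rw [div_lt_iff₀ (len_pos I)] at hl
    exact hl.le
  refine ⟨Nat.find hex, Nat.find_spec hex, fun h1 x hx => ?_⟩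
  by_contra hc
  exact Nat.find_min hex (m := Nat.find hex - 1) (by omega) ⟨x, hc, hx⟩

lemma rho_le (h0 : ∀ i, volume (E i) ≠ 0)
    (hf : ∀ i, volume (E i) < ⊤) {I : Dy} {l d : ℕ} {i : Fin n} (hij : i ≠ j)
    (hl : ∃ x, x ∉ Om E j ∧ |x - cen I| ≤ 2 ^ l * len I)
    (hd : ∃ r, len I ≤ r ∧
      ENNReal.ofReal (2 * r * (1 / 2) ^ (d + 1)) ≤ volume (E i ∩ Set.Icc (cen I - r) (cen I + r))) :
    (1 / 2 : ℝ) ^ d ≤ (40 * n) * (2 ^ l / volume.real (E j) * volume.real (E i)) := by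
  obtain ⟨x, hx, hxl⟩ := hl
  obtain ⟨r, hr, hrd⟩ := hd
  have hlen := len_pos I
  have hr0 : 0 < r := hlen.trans_le hr
  have hlam := lam_pos j h0 hf i
  set lam := 10 * (n : ℝ) * (volume.real (E i) / volume.real (E j)) with hlamd
  have hx2 : x ∉ Exc (E i) lam := fun h => hx (Set.mem_biUnion (by simp [hij]) h)
  have h1 : volume (E i ∩ Set.Icc (x - (r + 2 ^ l * len I)) (x + (r + 2 ^ l * len I))) ≤
      ENNReal.ofReal (2 * (r + 2 ^ l * len I) * lam) := by
    by_contra hc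
    push Not at hc
    exact hx2 ⟨_, by positivity, hc⟩
  have h2 : volume (E i ∩ Set.Icc (cen I - r) (cen I + r)) ≤
      volume (E i ∩ Set.Icc (x - (r + 2 ^ l * len I)) (x + (r + 2 ^ l * len I))) := by
    apply measure_mono
    apply Set.inter_subset_inter_right
    rw [abs_le] at hxl
    apply Set.Icc_subset_Icc <;> linarith [hxl.1, hxl.2]
  have h3 := (hrd.trans h2).trans h1
  have h2l : (1 : ℝ) ≤ 2 ^ l := one_le_pow₀ (by norm_num)
  rw [ENNReal.ofReal_le_ofReal_iff (by positivity)] at h3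
  have h4 : r + 2 ^ l * len I ≤ 2 * 2 ^ l * r := by
    nlinarith
  have h5 : 2 * r * (1 / 2) ^ (d + 1) ≤ 2 * r * (2 * 2 ^ l * lam) := by
    refine h3.trans ?_
    calc 2 * (r + 2 ^ l * len I) * lam ≤ 2 * (2 * 2 ^ l * r) * lam := by gcongr
      _ = _ := by ring
  have h6 := le_of_mul_le_mul_left h5 (by positivity)
  calc (1 / 2 : ℝ) ^ d = 2 * (1 / 2) ^ (d + 1) := by rw [pow_succ]; ring
    _ ≤ 2 * (2 * 2 ^ l * lam) := by gcongr
    _ = _ := by rw [hlamd]; ring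
end

lemma Geo.mono {n k : ℕ} {C2 C3 : ℤ} {ℙ ℙ' : Finset (MT n)}
    {ext : Finset (Fin n) → (Fin n → ℝ) → Fin n → ℝ} (h : Geo n k C2 C3 ℙ ext) (hs : ℙ' ⊆ ℙ) :
    Geo n k C2 C3 ℙ' ext :=
  ⟨h.agree, fun A hA x P hP => h.c3 A hA x P (hs hP), fun A hA x P hP => h.c2 A hA x P (hs hP),
    fun A hA x P hP => h.two A hA x P (hs hP)⟩

theorem thmB {n k : ℕ} (hk : 1 ≤ k) (hkn : 2 * k < n) {C2 : ℤ} (C3 : ℤ) (hC2 : 7 ≤ C2)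
    {a : Fin n → ℝ} (ha1 : ∀ i, a i < 1) (hasum : ∑ i, a i = 1) (j : Fin n) (haj : a j < 0)
    (hapos : ∀ i, i ≠ j → 0 ≤ a i)
    (hreg : ∀ S : Finset (Fin n), S.Nonempty → ∑ i ∈ S, a i < ((n : ℝ) - 2 * k + S.card) / 2) :
    ∃ C : ℝ, 0 ≤ C ∧ ∀ (E : Fin n → Set ℝ), (∀ i, MeasurableSet (E i)) → (∀ i, volume (E i) ≠ 0) →
      (∀ i, volume (E i) < ⊤) → ∀ F : Fin n → ℝ → ℂ, (∀ i, Measurable (F i)) →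
      (∀ i x, ‖F i x‖ ≤ 1) → (∀ i x, x ∉ E i → F i x = 0) → (∀ x ∈ Om E j, F j x = 0) →
      ∀ (φ : Fin n → Tile → ℝ → ℂ), (∀ i, WP (n + 4) (C2 + 1) (φ i)) →
      ∀ (ℙ : Finset (MT n)) (ext : Finset (Fin n) → (Fin n → ℝ) → Fin n → ℝ) (L s₀ : ℤ) (r : Fin n → ℤ),
      Geo n k C2 C3 ℙ ext → 2 ≤ L → (C2 : ℝ) + 1 < pw L →
      (∀ i, ∀ P ∈ ℙ, Sparse L s₀ (r i) (P.t i)) →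
      ∑ P ∈ ℙ, len P.I * ∏ i, wc (F i) (φ i) (P.t i) ≤ C * ∏ i, (volume (E i)).toReal ^ a i := by
  obtain ⟨w, hw0, hw1, hwa, hws⟩ := exists_w hkn ha1 hreg
  have hn0 : (0 : ℝ) < n := by exact_mod_cast j.pos
  obtain ⟨CA, hCA, hA⟩ := thmA hk hkn.le C3 hC2 hw0 hw1 hws
  have hC5 : 0 < √(C5 (n + 4) (n + 1)) := Real.sqrt_pos.2 (C5_pos _ _)
  have hC6 := C6_pos (n + 1)
  obtain ⟨CB, hCB, hB⟩ := class_calc (w := w) (q := n + 1) j haj hapos hasum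
    (by positivity : 0 < 40 * (n : ℝ)) hC5 (by positivity : 0 < C6 (n + 1) * 16) hC6
  set β : Fin n → ℝ := fun i => if i = j then (1 / 2) ^ (2 * (n + 1) - 1) * 2 ^ (- a j) else
        (1 / 2 : ℝ) ^ (1 - w i - a i) with hβ
  have hβ0 : ∀ i, 0 ≤ β i := fun i => by simp only [hβ]; split_ifs <;> positivity
  have hβ1 : ∀ i, β i < 1 := by
    intro i
    simp only [hβ]
    split_ifs with h
    · have hajn : - a j ≤ n := by
        have h1 : ∑ i ∈ Finset.univ.erase j, a i ≤ ∑ i ∈ Finset.univ.erase j, (1 : ℝ) :=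
          Finset.sum_le_sum fun i _ => (ha1 i).le
        rw [← Finset.add_sum_erase _ _ (Finset.mem_univ j)] at hasum
        rw [Finset.sum_const, nsmul_eq_mul, mul_one, Finset.card_erase_of_mem (Finset.mem_univ j),
          Finset.card_univ, Fintype.card_fin] at h1
        have h2 : ((n - 1 : ℕ) : ℝ) ≤ n := by exact_mod_cast Nat.sub_le n 1
        linarith
      have h2 : (2 : ℝ) ^ (- a j) ≤ 2 ^ n := by
        rw [← Real.rpow_natCast]
        exact Real.rpow_le_rpow_of_exponent_le (by norm_num) hajn
      calc (1 / 2 : ℝ) ^ (2 * (n + 1) - 1) * 2 ^ (- a j) ≤ (1 / 2 : ℝ) ^ (2 * (n + 1) - 1) * 2 ^ n := by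
            gcongr
        _ = (1 / 2) ^ (n + 1) := by
            rw [show 2 * (n + 1) - 1 = (n + 1) + n by omega, pow_add, mul_assoc, ← mul_pow]; norm_num
        _ < 1 := pow_lt_one₀ (by norm_num) (by norm_num) (by omega)
    · exact Real.rpow_lt_one (by norm_num) (by norm_num) (by linarith [hwa i])
  refine ⟨CA * CB * ∏ i, (1 - β i)⁻¹, mul_nonneg (mul_nonneg hCA hCB)
    (Finset.prod_nonneg fun i _ => inv_nonneg.2 (by linarith [hβ1 i])), ?_⟩
  intro E hE h0 hf F hFm hF1 hF0 hFj φ hφ ℙ ext L s₀ r hg hL hL2 hsp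
  choose lv hlv1 hlv2 using exists_l j hE h0 hf
  choose dv hdv1 hdv2 using fun i => exists_dens_level (h0 i)
  set key : MT n → Fin n → ℕ := fun P i => if i = j then lv P.I else dv i P.I with hkey
  have hv : ∀ i, 0 < volume.real (E i) := fun i => vreal_pos (h0 i) (hf i)
  have hclass : ∀ κ ∈ ℙ.image key, ∑ P ∈ ℙ with key P = κ, len P.I * ∏ i, wc (F i) (φ i) (P.t i) ≤
      (CA * CB * ∏ i, (volume (E i)).toReal ^ a i) * ∏ i, β i ^ κ i := by
    intro κ hκ
    set ℙ' := ℙ.filter (fun P => key P = κ) with hℙ'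
    have hsub : ℙ' ⊆ ℙ := Finset.filter_subset _ _
    set D := ℙ'.image MT.I with hD
    have hDl : ∀ I ∈ D, lv I = κ j := by
      intro I hI
      obtain ⟨P, hP, rfl⟩ := Finset.mem_image.1 hI
      have := (Finset.mem_filter.1 hP).2
      rw [← this]; simp [hkey]
    have hDd : ∀ i, i ≠ j → ∀ I ∈ D, dv i I = κ i := by
      intro i hi I hI
      obtain ⟨P, hP, rfl⟩ := Finset.mem_image.1 hI
      have := (Finset.mem_filter.1 hP).2
      rw [← this]; simp [hkey, hi]
    have hspi : ∀ i, ∀ Q ∈ ℙ'.image (fun P => P.t i), Sparse L s₀ (r i) Q := by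
      intro i Q hQ
      obtain ⟨P, hP, rfl⟩ := Finset.mem_image.1 hQ
      exact hsp i P (hsub hP)
    have hQD : ∀ i, ∀ Q ∈ ℙ'.image (fun P => P.t i), Q.I ∈ D := by
      intro i Q hQ
      obtain ⟨P, hP, rfl⟩ := Finset.mem_image.1 hQ
      exact Finset.mem_image_of_mem _ hP
    set q := n + 1 with hq
    have ht := thl_pos q (κ j)
    set σ : Fin n → ℝ := fun i => if i = j then √(C6 q * thl q (κ j)) else √(C5 (n + 4) q) * (1 / 2) ^ κ i
      with hσ
    set e : Fin n → ℝ := fun i => if i = j then C6 q * thl q (κ j) else C6 q * 16 * (1 / 2) ^ κ i with he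
    have hfar : ∀ K ∈ D, lm (F j) K q ≤ thl q (κ j) * len K := by
      intro K hK
      refine lm_far (hFm j) (hF1 j) (by omega) fun h1 x hx => hFj x ?_
      have := hlv2 K
      rw [hDl K hK] at this
      exact this h1 x hx
    have hdens : ∀ i, i ≠ j → ∀ I ∈ D, Dens (E i) ((1 / 2) ^ κ i) I := by
      intro i hi I hI
      rw [← hDd i hi I hI]; exact hdv1 i I
    have hdens2 : ∀ i, i ≠ j → ∀ I ∈ D, ∃ r, len I ≤ r ∧
      ENNReal.ofReal (2 * r * (1 / 2) ^ (κ i + 1)) ≤ volume (E i ∩ Set.Icc (cen I - r) (cen I + r)) := by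
      intro i hi I hI
      rw [← hDd i hi I hI]; exact hdv2 i I
    have hmain := hA ℙ' ext L s₀ r (fun i => wc (F i) (φ i)) σ e (hg.mono hsub) hL2
      (fun i Q => wc_nonneg _ _ _) (fun i P hP => hsp i P (hsub hP))
      (fun i => by simp only [hσ]; split_ifs <;> positivity)
      (fun i => by simp only [he]; split_ifs <;> positivity)
      (by
        intro i
        by_cases hi : i = j
        · subst hi
          simp only [hσ, if_true]
          exact size_of_lm (hφ i) (by omega) (by omega) (hFm i) (hF1 i) ht.le hL (hspi i) hfar
        · simp only [hσ, if_neg hi]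
          exact size_good (hφ i) (by omega) (by omega) (hE i) (hFm i) (hF1 i) (hF0 i) (by positivity) hL
            le_rfl (hspi i) (hdens i hi) (hQD i))
      (by
        intro i
        by_cases hi : i = j
        · subst hi
          simp only [he, if_true]
          exact pack_of_lm (hφ i) (by omega) (by omega) (hFm i) (hF1 i) hL (hspi i) hfar
        · simp only [he, if_neg hi]
          rw [mul_assoc]
          exact pack_of_lm (hφ i) (by omega) (by omega) (hFm i) (hF1 i) hL (hspi i)
            fun K hK => lm_dens (hE i) (hF1 i) (hF0 i) (by positivity) (by omega) (hdens i hi K hK))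
    refine hmain.trans ?_
    have hUn : 0 ≤ volume.real (UU D) := measureReal_nonneg
    have hDne : D.Nonempty := by
      obtain ⟨P, hP, hPκ⟩ := Finset.mem_image.1 hκ
      exact ⟨P.I, Finset.mem_image_of_mem _ (Finset.mem_filter.2 ⟨hP, hPκ⟩)⟩
    obtain ⟨I, hI⟩ := hDne
    have h2 := hB (fun i => volume.real (E i)) κ (volume.real (UU D)) hv hUn
      (fun i hi => UU_level (hE i) (hf i) D (κ i) (hdens2 i hi))
      (fun i hi => rho_le j h0 hf hi (hDl I hI ▸ hlv1 I) (hdens2 i hi I hI))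
    have hprod : ∏ i, σ i ^ (1 - 2 * w i) * e i ^ w i = ∏ i, (if i = j then √(C6 q * thl q (κ j)) ^ (1 - 2 * w i) * (C6 q * thl q (κ j)) ^ w i else
        (√(C5 (n + 4) q) * (1 / 2) ^ κ i) ^ (1 - 2 * w i) * (C6 q * 16 * (1 / 2) ^ κ i) ^ w i) := by
      refine Finset.prod_congr rfl fun i _ => ?_
      simp only [hσ, he]
      split_ifs <;> rfl
    rw [hprod, mul_assoc CA, mul_assoc CA, mul_assoc CA]
    refine mul_le_mul_of_nonneg_left ?_ hCA
    exact h2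
  have hfib : ∑ P ∈ ℙ, len P.I * ∏ i, wc (F i) (φ i) (P.t i) =
      ∑ κ ∈ ℙ.image key, ∑ P ∈ ℙ with key P = κ, len P.I * ∏ i, wc (F i) (φ i) (P.t i) :=
    (Finset.sum_fiberwise_of_maps_to (fun P hP => Finset.mem_image_of_mem key hP) _).symm
  rw [hfib]
  refine (Finset.sum_le_sum hclass).trans ?_
  rw [← Finset.mul_sum]
  have hP0 : 0 ≤ ∏ i, (volume (E i)).toReal ^ a i := Finset.prod_nonneg fun i _ => by positivity
  calc _ ≤ (CA * CB * ∏ i, (volume (E i)).toReal ^ a i) * ∏ i, (1 - β i)⁻¹ :=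
        mul_le_mul_of_nonneg_left (sum_geom_pi hβ0 hβ1 _) (by positivity)
    _ = _ := by ring
end

noncomputable section

/-- smooth bump, one on [-1,1], supported in [-2,2] -/
def xt (x : ℝ) : ℝ := smoothTransition (x + 2) * smoothTransition (2 - x)

lemma xt_one {x : ℝ} (h : |x| ≤ 1) : xt x = 1 := by
  rw [abs_le] at h
  unfold xt
  rw [smoothTransition.one_of_one_le (by linarith), smoothTransition.one_of_one_le (by linarith), mul_one]
lemma xt_zero {x : ℝ} (h : 2 ≤ |x|) : xt x = 0 := by
  unfold xt
  rcases le_abs.1 h with h | h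
  · rw [smoothTransition.zero_of_nonpos (x := 2 - x) (by linarith), mul_zero]
  · rw [smoothTransition.zero_of_nonpos (x := x + 2) (by linarith), zero_mul]
lemma xt_smooth : ContDiff ℝ (⊤ : ℕ∞) xt := by
  unfold xt
  exact (smoothTransition.contDiff.comp (contDiff_id.add contDiff_const)).mul
    (smoothTransition.contDiff.comp (contDiff_const.sub contDiff_id))
lemma xt_nonneg (x : ℝ) : 0 ≤ xt x := mul_nonneg (smoothTransition.nonneg _) (smoothTransition.nonneg _)
lemma xt_le_one (x : ℝ) : xt x ≤ 1 :=
  mul_le_one₀ (smoothTransition.le_one _) (smoothTransition.nonneg _) (smoothTransition.le_one _)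

/-- frequency cutoff of a packet, modulated -/
def axf (s v : ℤ) (u : ℝ) (ξ : ℝ) : ℂ := (xt (pw (-s) * ξ - v) : ℂ) * ex u ξ

lemma axf_zero {s v : ℤ} {u ξ : ℝ} (h : 2 * pw s < |ξ - pw s * v|) : axf s v u ξ = 0 := by
  unfold axf
  rw [xt_zero, ofReal_zero, zero_mul]
  have h1 := pw_pos (-s)
  have : |pw (-s) * ξ - v| = pw (-s) * |ξ - pw s * v| := by
    rw [← abs_of_pos h1, ← abs_mul, abs_of_pos h1, mul_sub, ← mul_assoc, pw_neg_mul, one_mul]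
  rw [this]
  have h2 := mul_lt_mul_of_pos_left h h1
  rw [mul_left_comm, pw_neg_mul] at h2
  linarith

lemma axf_smooth (s v : ℤ) (u : ℝ) : ContDiff ℝ (⊤ : ℕ∞) (axf s v u) := by
  unfold axf ex
  refine ContDiff.mul ?_ ?_
  · exact Complex.ofRealCLM.contDiff.comp (xt_smooth.comp (by fun_prop))
  · refine ContDiff.cexp ?_
    exact (contDiff_const.mul Complex.ofRealCLM.contDiff).mul contDiff_const

lemma axf_supp (s v : ℤ) (u : ℝ) : HasCompactSupport (axf s v u) := by
  refine HasCompactSupport.intro (isCompact_closedBall (pw s * v : ℝ) (2 * pw s)) fun x hx => ?_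
  apply axf_zero
  simpa [Real.dist_eq] using hx

def ax (s v : ℤ) (u : ℝ) : SchwartzMap ℝ ℂ := (axf_supp s v u).toSchwartzMap (axf_smooth s v u)

lemma ax_apply (s v : ℤ) (u ξ : ℝ) : ax s v u ξ = axf s v u ξ := rfl

/-- the base wave packet -/
def pk (s v : ℤ) (u : ℝ) : SchwartzMap ℝ ℂ := 𝓕 (ax s v u)

lemma pk_coe (s v : ℤ) (u y : ℝ) : pk s v u y = 𝓕 (axf s v u) y := rfl

def psi0 : SchwartzMap ℝ ℂ := pk 0 0 0

lemma psi0_eq (y : ℝ) : psi0 y = ∫ ξ, (xt ξ : ℂ) * ex (-y) ξ := by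
  unfold psi0
  rw [pk_coe, Real.fourier_real_eq_integral_exp_smul]
  congr 1; ext ξ
  unfold axf ex
  simp only [neg_zero, pw_zero, one_mul, Int.cast_zero, sub_zero, ofReal_zero, smul_eq_mul,
    mul_zero, zero_mul, Complex.exp_zero, mul_one]
  rw [mul_comm]; congr 2; push_cast; ring

lemma pk_eq (s v : ℤ) (u y : ℝ) :
    pk s v u y = (pw s : ℂ) * ex (pw s * v) (u - y) * psi0 (pw s * (y - u)) := by
  have hp := pw_pos s
  rw [pk_coe, Real.fourier_real_eq_integral_exp_smul, psi0_eq]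
  have h := MeasureTheory.Measure.integral_comp_mul_left
    (fun ξ => cexp (↑(-2 * π * ξ * y) * I) • axf s v u ξ) (pw s)
  rw [abs_of_pos (inv_pos.2 hp)] at h
  have h2 : ∫ ξ, cexp (↑(-2 * π * ξ * y) * I) • axf s v u ξ =
      pw s * ∫ x, cexp (↑(-2 * π * (pw s * x) * y) * I) • axf s v u (pw s * x) := by
    rw [h, Complex.real_smul, ← mul_assoc, ← ofReal_mul, mul_inv_cancel₀ hp.ne', ofReal_one, one_mul]
  rw [h2, mul_assoc]
  congr 1
  rw [← integral_const_mul, ← integral_add_right_eq_self _ (v : ℝ)]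
  congr 1; ext t
  unfold axf ex
  rw [← mul_assoc (pw (-s)), pw_neg_mul, one_mul, add_sub_cancel_right, smul_eq_mul,
    mul_left_comm, ← Complex.exp_add, mul_left_comm (cexp _), ← Complex.exp_add]
  congr 2
  push_cast; ring

lemma psi0_decay (N : ℕ) : ∃ C : ℝ, 0 < C ∧ ∀ t, ‖psi0 t‖ ≤ C * (bw t ^ N)⁻¹ ∧
    ‖deriv psi0 t‖ ≤ C * (bw t ^ N)⁻¹ := by
  have key : ∀ f : SchwartzMap ℝ ℂ, ∃ C : ℝ, ∀ t, ‖f t‖ ≤ C * (bw t ^ N)⁻¹ := by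
    intro f
    refine ⟨2 ^ (2 * N) * (Finset.Iic ((2 * N, 0) : ℕ × ℕ)).sup
      (fun m => SchwartzMap.seminorm ℝ m.1 m.2) f, fun t => ?_⟩
    have h := SchwartzMap.one_add_le_sup_seminorm_apply (𝕜 := ℝ) (m := (2 * N, 0)) le_rfl le_rfl f t
    rw [norm_iteratedFDeriv_zero] at h
    rw [← div_eq_mul_inv, le_div_iff₀ (pow_pos (bw_pos t) N), mul_comm]
    refine le_trans ?_ h
    rw [pow_mul]
    have : bw t ≤ (1 + ‖t‖) ^ 2 := by
      unfold bw; rw [Real.norm_eq_abs]; nlinarith [abs_nonneg t, sq_abs t]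
    have := bw_pos t
    gcongr
  obtain ⟨C1, h1⟩ := key psi0
  obtain ⟨C2, h2⟩ := key (SchwartzMap.derivCLM ℝ ℂ psi0)
  refine ⟨max 1 (max C1 C2), lt_max_of_lt_left one_pos, fun t => ⟨(h1 t).trans ?_, (h2 t).trans ?_⟩⟩
  · have : 0 ≤ (bw t ^ N)⁻¹ := by have := bw_pos t; positivity
    gcongr; exact (le_max_left _ _).trans (le_max_right _ _)
  · have : 0 ≤ (bw t ^ N)⁻¹ := by have := bw_pos t; positivity
    gcongr; exact (le_max_right _ _).trans (le_max_right _ _)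

/-- weight transfer -/
lemma bw_shift {x w Z : ℝ} (N : ℕ) (hw : |w| ≤ Z) :
    (bw x ^ N)⁻¹ ≤ (2 * bw Z) ^ N * (bw (x + w) ^ N)⁻¹ := by
  have h1 := bw_pos x
  have h2 := bw_pos (x + w)
  have h3 := bw_pos Z
  rw [← div_eq_mul_inv, le_div_iff₀ (by positivity), inv_mul_le_iff₀ (by positivity), ← mul_pow]
  refine pow_le_pow_left₀ h2.le ((bw_peetre x w).trans ?_) N
  have h4 : bw w ≤ bw Z := bw_mono (hw.trans (le_abs_self Z))
  calc 2 * bw x * bw w ≤ 2 * bw x * bw Z := by gcongr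
    _ = _ := by ring

lemma supp_mulc {K : Set ℝ} (hK : IsClosed K) (a : SchwartzMap ℝ ℂ) (ha : ∀ x ∉ K, a x = 0) (c : ℝ) :
    ∃ b : SchwartzMap ℝ ℂ, (∀ x ∉ K, b x = 0) ∧ ∀ y, (𝓕 b) y = ((y - c : ℝ) : ℂ) * (𝓕 a) y := by
  refine ⟨(2 * π * I : ℂ)⁻¹ • SchwartzMap.derivCLM ℂ ℂ a + (-(c : ℂ)) • a, fun x hx => ?_, fun y => ?_⟩
  · have h : deriv a x = 0 := by
      have : (a : ℝ → ℂ) =ᶠ[nhds x] fun _ => 0 := by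
        filter_upwards [hK.isOpen_compl.mem_nhds hx] with z hz using ha z hz
      rw [this.deriv_eq]; simp
    simp [h, ha x hx]
  · have h1 : 𝓕 (SchwartzMap.derivCLM ℂ ℂ a) y = (2 * π * I * y) * 𝓕 a y := by
      have := congrFun (Real.fourier_deriv a.integrable a.differentiable
        (SchwartzMap.derivCLM ℂ ℂ a).integrable) y
      exact this
    rw [FourierTransform.fourier_add, FourierTransform.fourier_smul, FourierTransform.fourier_smul]
    simp only [add_apply, smul_apply, smul_eq_mul]
    rw [h1]
    have : (2 * π * I : ℂ) ≠ 0 := by simp [Real.pi_ne_zero]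
    field_simp
    push_cast; ring

lemma supp_bw {K : Set ℝ} (hK : IsClosed K) (c r : ℝ) (q : ℕ) :
    ∀ a : SchwartzMap ℝ ℂ, (∀ x ∉ K, a x = 0) →
    ∃ b : SchwartzMap ℝ ℂ, (∀ x ∉ K, b x = 0) ∧
      ∀ y, (𝓕 b) y = ((bw (r * (y - c)) ^ q : ℝ) : ℂ) * (𝓕 a) y := by
  induction q with
  | zero => intro a ha; exact ⟨a, ha, fun y => by simp⟩
  | succ q ih =>
    intro a ha
    obtain ⟨b, hb, hby⟩ := ih a ha
    obtain ⟨b1, hb1, hb1y⟩ := supp_mulc hK b hb c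
    obtain ⟨b2, hb2, hb2y⟩ := supp_mulc hK b1 hb1 c
    refine ⟨b + ((r ^ 2 : ℝ) : ℂ) • b2, fun x hx => by simp [hb x hx, hb2 x hx], fun y => ?_⟩
    rw [FourierTransform.fourier_add, FourierTransform.fourier_smul]
    simp only [add_apply, smul_apply, smul_eq_mul]
    rw [hb2y, hb1y, hby]
    unfold bw
    push_cast; ring

lemma pk_orth {s v s' v' : ℤ} (h : 2 * (pw s + pw s') < |pw s * v - pw s' * v'|) (u u' c r : ℝ) (q : ℕ) :
    ∫ y, ((bw (r * (y - c)) ^ q : ℝ) : ℂ) * (pk s v u y * (starRingEnd ℂ) (pk s' v' u' y)) = 0 := by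
  set K : Set ℝ := Metric.closedBall (pw s * v) (2 * pw s) with hKd
  obtain ⟨b, hb, hby⟩ := supp_bw (K := K) Metric.isClosed_closedBall c r q (ax s v u) (fun x hx => by
    rw [ax_apply]; apply axf_zero; simpa [hKd, Real.dist_eq] using hx)
  have h1 := SchwartzMap.integral_inner_fourier_fourier (ax s' v' u') b
  have h2 : ∀ x, inner ℂ (ax s' v' u' x) (b x) = 0 := by
    intro x
    by_cases hx : x ∈ K
    · have : ax s' v' u' x = 0 := by
        rw [ax_apply]; apply axf_zero
        rw [hKd, Metric.mem_closedBall, Real.dist_eq] at hx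
        have := abs_sub_le (pw s * v) x (pw s' * v')
        rw [abs_sub_comm (pw s * v) x] at this
        linarith
      rw [this, inner_zero_left]
    · rw [hb x hx, inner_zero_right]
  rw [integral_congr_ae (Filter.Eventually.of_forall h2), integral_zero] at h1
  rw [← h1]
  congr 1; ext y
  rw [RCLike.inner_apply, hby, mul_assoc]
  rfl

/-- frequency localized lipschitz bound for the mother function -/
lemma psi_lip {N : ℕ} {C K : ℝ} (hC : 0 < C) (hK : 0 ≤ K)
    (h : ∀ t, ‖psi0 t‖ ≤ C * (bw t ^ N)⁻¹ ∧ ‖deriv psi0 t‖ ≤ C * (bw t ^ N)⁻¹) {δ t t' : ℝ}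
    (hδ : |δ| ≤ K) (htt : |t - t'| ≤ 1) :
    ‖psi0 t * ex δ t - psi0 t' * ex δ t'‖ ≤
      (C * (1 + 2 * π * K) * 4 ^ N) * |t - t'| * (bw t ^ N)⁻¹ := by
  have hd : ∀ x ∈ Set.uIcc t t', HasDerivWithinAt (fun x : ℝ => psi0 x * ex δ x)
      (deriv psi0 x * ex δ x + psi0 x * (ex δ x * (2 * π * δ * I))) (Set.uIcc t t') x := by
    intro x _
    refine HasDerivAt.hasDerivWithinAt ?_
    refine (psi0.differentiable x).hasDerivAt.mul ?_
    unfold ex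
    have h1 : HasDerivAt (fun y : ℝ => (2 * π * δ * y * I : ℂ)) (2 * π * δ * I) x := by
      have := ((Complex.ofRealCLM.hasDerivAt (x := x)).const_mul (2 * π * δ : ℂ)).mul_const I
      simpa using this
    exact h1.cexp
  have hb : ∀ x ∈ Set.uIcc t t', ‖deriv psi0 x * ex δ x + psi0 x * (ex δ x * (2 * π * δ * I))‖ ≤
      C * (1 + 2 * π * K) * 4 ^ N * (bw t ^ N)⁻¹ := by
    intro x hx
    have hxt : |t - x| ≤ 1 := by
      have := Set.abs_sub_left_of_mem_uIcc hx
      rw [abs_sub_comm t x, ]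
      rw [abs_sub_comm t t'] at htt
      linarith
    have hbx : (bw x ^ N)⁻¹ ≤ 4 ^ N * (bw t ^ N)⁻¹ := by
      have := bw_shift (x := x) (w := t - x) (Z := 1) N hxt
      rw [add_sub_cancel] at this
      have e : 2 * bw 1 = 4 := by unfold bw; norm_num
      rwa [e] at this
    have h0 : 0 ≤ (bw x ^ N)⁻¹ := by have := bw_pos x; positivity
    refine (norm_add_le _ _).trans ?_
    rw [norm_mul, norm_mul, norm_mul, ex_norm, mul_one, one_mul]
    have h3 : ‖(2 * π * δ * I : ℂ)‖ ≤ 2 * π * K := by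
      rw [norm_mul, norm_mul, norm_mul, Complex.norm_I, Complex.norm_real, Complex.norm_real]
      simp only [RCLike.norm_ofNat, Real.norm_eq_abs, abs_of_pos Real.pi_pos, mul_one]
      gcongr
    calc ‖deriv psi0 x‖ + ‖psi0 x‖ * ‖(2 * π * δ * I : ℂ)‖
        ≤ C * (bw x ^ N)⁻¹ + C * (bw x ^ N)⁻¹ * (2 * π * K) := by
          have := h x
          gcongr
          · exact this.2
          · exact this.1
      _ = C * (1 + 2 * π * K) * (bw x ^ N)⁻¹ := by ring
      _ ≤ C * (1 + 2 * π * K) * (4 ^ N * (bw t ^ N)⁻¹) := by gcongr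
      _ = _ := by ring
  have := Convex.norm_image_sub_le_of_norm_hasDerivWithin_le hd hb (convex_uIcc t t')
    Set.right_mem_uIcc Set.left_mem_uIcc
  rw [Real.norm_eq_abs] at this
  calc _ ≤ _ := this
    _ = _ := by ring

theorem wp_exists (N : ℕ) {K : ℝ} (hK : 0 ≤ K) : ∃ C : ℝ, 0 < C ∧ ∀ (Z : ℝ) (u : Tile → ℝ), 0 ≤ Z →
    (∀ Q, |u Q - cen Q.I| ≤ len Q.I * Z) →
    WP N K (fun Q y => ((C * (2 * bw Z) ^ N : ℝ) : ℂ)⁻¹ * pk Q.I.1 Q.v (u Q) y) := by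
  obtain ⟨C0, hC0, hdec⟩ := psi0_decay N
  set C := C0 * (1 + 2 * π * K) * 4 ^ N with hC
  have hCp : 0 < C := by positivity
  have hCC : C0 ≤ C := by
    rw [hC, mul_assoc]
    refine le_mul_of_one_le_right hC0.le ?_
    have h1 : (1 : ℝ) ≤ 4 ^ N := one_le_pow₀ (by norm_num)
    have h2 : 1 ≤ 1 + 2 * π * K := by have : 0 ≤ 2 * π * K := by positivity
                                      linarith
    exact one_le_mul_of_one_le_of_one_le h2 h1
  refine ⟨C, hCp, fun Z u hZ hu => ?_⟩
  have hbZ := bw_pos Z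
  set A := C * (2 * bw Z) ^ N with hA
  have hAp : 0 < A := by positivity
  have hshift : ∀ (Q : Tile) (y : ℝ), (bw (pw Q.I.1 * (y - u Q)) ^ N)⁻¹ ≤
      (2 * bw Z) ^ N * (bw (pw Q.I.1 * (y - cen Q.I)) ^ N)⁻¹ := by
    intro Q y
    have hp := pw_pos Q.I.1
    have := bw_shift (x := pw Q.I.1 * (y - u Q)) (w := pw Q.I.1 * (u Q - cen Q.I)) (Z := Z) N (by
      rw [abs_mul, abs_of_pos hp]
      calc pw Q.I.1 * |u Q - cen Q.I| ≤ pw Q.I.1 * (len Q.I * Z) := by gcongr; exact hu Q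
        _ = Z := by rw [← mul_assoc, pw_mul_len, one_mul])
    rwa [← mul_add, sub_add_sub_cancel] at this
  have hnA : ‖((A : ℝ) : ℂ)⁻¹‖ = A⁻¹ := by rw [norm_inv, Complex.norm_real, Real.norm_of_nonneg hAp.le]
  refine ⟨fun Q => continuous_const.mul (pk Q.I.1 Q.v (u Q)).continuous, ?_, ?_, ?_⟩
  · intro Q y
    have hp := pw_pos Q.I.1
    rw [norm_mul, hnA, pk_eq, norm_mul, norm_mul, ex_norm, mul_one, Complex.norm_real,
      Real.norm_of_nonneg hp.le, inv_mul_le_iff₀ hAp]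
    calc pw Q.I.1 * ‖psi0 (pw Q.I.1 * (y - u Q))‖
        ≤ pw Q.I.1 * (C * ((2 * bw Z) ^ N * (bw (pw Q.I.1 * (y - cen Q.I)) ^ N)⁻¹)) := by
          refine mul_le_mul_of_nonneg_left ((hdec _).1.trans ?_) hp.le
          exact mul_le_mul hCC (hshift Q y) (by have := bw_pos (pw Q.I.1 * (y - u Q)); positivity) hCp.le
      _ = _ := by rw [hA]; ring
  · intro Q R hQR c r q
    have h := pk_orth (s := Q.I.1) (v := Q.v) (s' := R.I.1) (v' := R.v) hQR (u Q) (u R) c r q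
    calc _ = ∫ y, (((A : ℝ) : ℂ)⁻¹ * (starRingEnd ℂ) ((A : ℝ) : ℂ)⁻¹) * (((bw (r * (y - c)) ^ q : ℝ) : ℂ) *
          (pk Q.I.1 Q.v (u Q) y * (starRingEnd ℂ) (pk R.I.1 R.v (u R) y))) := by
          congr 1; ext y; rw [map_mul]; ring
      _ = 0 := by rw [integral_const_mul, h, mul_zero]
  · intro Q ξ hξ y y' hyy
    have hp := pw_pos Q.I.1
    set s := Q.I.1 with hs
    set δ := pw (-s) * (ξ - Q.fr) with hδ
    have hform : ∀ y, ((A : ℝ) : ℂ)⁻¹ * pk s Q.v (u Q) y * ex ξ y =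
        ((A : ℝ) : ℂ)⁻¹ * (pw s : ℂ) * ex ξ (u Q) * (psi0 (pw s * (y - u Q)) * ex δ (pw s * (y - u Q))) := by
      intro y
      rw [pk_eq]
      have : ex (pw s * Q.v) (u Q - y) * ex ξ y = ex ξ (u Q) * ex δ (pw s * (y - u Q)) := by
        unfold ex
        rw [← Complex.exp_add, ← Complex.exp_add]
        congr 1
        have e : (δ : ℂ) * (pw s : ℂ) = ξ - pw s * Q.v := by
          rw [← ofReal_mul, hδ, mul_right_comm, pw_neg_mul, one_mul]
          unfold Tile.fr
          push_cast; ring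
        push_cast
        linear_combination (-(2 * π * (y - u Q) * I) : ℂ) * e
      linear_combination ((A : ℝ) : ℂ)⁻¹ * (pw s : ℂ) * psi0 (pw s * (y - u Q)) * this
    rw [hform, hform, ← mul_sub, norm_mul, norm_mul, norm_mul, hnA, ex_norm, Complex.norm_real,
      Real.norm_of_nonneg hp.le, mul_one]
    have hδK : |δ| ≤ K := by
      rw [hδ, abs_mul, abs_of_pos (pw_pos _), abs_sub_comm]
      calc pw (-s) * |Q.fr - ξ| ≤ pw (-s) * (K * pw s) := by
            gcongr; exact (pw_pos _).le
        _ = K := by rw [mul_left_comm, pw_neg_mul, mul_one]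
    have he : pw s * (y - u Q) - pw s * (y' - u Q) = pw s * (y - y') := by ring
    have htt : |pw s * (y - u Q) - pw s * (y' - u Q)| ≤ 1 := by
      rw [he, abs_mul, abs_of_pos hp]
      calc pw s * |y - y'| ≤ pw s * len Q.I := by gcongr
        _ = 1 := pw_mul_len _
    have h := psi_lip hC0 hK hdec hδK htt
    rw [he, abs_mul, abs_of_pos hp] at h
    rw [mul_assoc, inv_mul_le_iff₀ hAp]
    calc pw s * _ ≤ pw s * (C * (pw s * |y - y'|) * ((2 * bw Z) ^ N * (bw (pw s * (y - cen Q.I)) ^ N)⁻¹)) := by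
          refine mul_le_mul_of_nonneg_left (h.trans ?_) hp.le
          exact mul_le_mul_of_nonneg_left (hshift Q y) (by positivity)
      _ = _ := by rw [hA]; ring
end

noncomputable section

def qf {n : ℕ} (w : Fin n → ℝ) : ℝ := ∑ i, w i ^ 2

lemma exists_Pr {n : ℕ} (Γ' : Submodule ℝ (Fin n → ℝ)) :
    ∃ Pr : (Fin n → ℝ) →L[ℝ] (Fin n → ℝ), (∀ ξ, ξ - Pr ξ ∈ Γ') ∧ ∀ ξ ∈ Γ', Pr ξ = 0 := by
  obtain ⟨W, hW⟩ := Submodule.exists_isCompl Γ'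
  refine ⟨LinearMap.toContinuousLinearMap ((W.subtype).comp (W.projectionOnto Γ' hW.symm)), ?_, ?_⟩
  · intro ξ
    have hk := Submodule.ker_projectionOnto hW.symm
    have h2 : ξ - (W.projectionOnto Γ' hW.symm ξ : Fin n → ℝ) ∈ (W.projectionOnto Γ' hW.symm).ker := by
      rw [LinearMap.mem_ker, map_sub, Submodule.projectionOnto_apply_left, sub_self]
    exact hk.le h2
  · intro ξ hξ
    rw [← Submodule.ker_projectionOnto hW.symm, LinearMap.mem_ker] at hξ
    simp [hξ]

lemma exists_ext {n k : ℕ} (Γ' : Submodule ℝ (Fin n → ℝ)) (hnd : NonDegenerate n k Γ') :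
    ∃ (ext : Finset (Fin n) → (Fin n → ℝ) → Fin n → ℝ) (CΓ : ℝ), 0 ≤ CΓ ∧
      (∀ A x, ext A x ∈ Γ') ∧ (∀ A : Finset (Fin n), A.card = k → ∀ x, ∀ i ∈ A, ext A x i = x i) ∧
      ∀ A : Finset (Fin n), A.card = k → ∀ γ ∈ Γ', ∀ t : ℝ, 0 ≤ t → (∀ i ∈ A, |γ i| ≤ t) →
        ∀ i, |γ i| ≤ CΓ * t := by
  have key : ∀ A : Finset (Fin n), ∃ (e : (Fin n → ℝ) → Fin n → ℝ) (C : ℝ), 0 ≤ C ∧ (∀ x, e x ∈ Γ') ∧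
      (A.card = k → (∀ x, ∀ i ∈ A, e x i = x i) ∧ ∀ γ ∈ Γ', ∀ t : ℝ, 0 ≤ t → (∀ i ∈ A, |γ i| ≤ t) →
        ∀ i, |γ i| ≤ C * t) := by
    intro A
    by_cases hA : A.card = k
    · set ι := A.orderEmbOfFin hA with hι
      set T : Γ' →ₗ[ℝ] (Fin k → ℝ) :=
        { toFun := fun ξ s => (ξ : Fin n → ℝ) (ι s)
          map_add' := fun x y => rfl
          map_smul' := fun c x => rfl } with hT
      have hbij : Function.Bijective T := hnd ι ι.strictMono
      set e := LinearEquiv.ofBijective T hbij with he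
      set S := LinearMap.toContinuousLinearMap ((Γ'.subtype).comp e.symm.toLinearMap) with hS
      have hSΓ : ∀ y, S y ∈ Γ' := fun y => (e.symm y).2
      have hSe : ∀ y s, S y (ι s) = y s := by
        intro y s
        have : T (e.symm y) = y := e.apply_symm_apply y
        exact congrFun this s
      refine ⟨fun x => S (fun s => x (ι s)), ‖S‖, norm_nonneg _, fun x => hSΓ _, fun _ => ⟨?_, ?_⟩⟩
      · intro x i hi
        obtain ⟨s, rfl⟩ : ∃ s, ι s = i := by
          have := A.range_orderEmbOfFin hA
          have h2 : i ∈ Set.range ι := by rw [this]; exact hi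
          exact h2
        exact hSe _ s
      · intro γ hγ t ht h i
        have h1 : S (fun s => γ (ι s)) = γ := by
          have : e.symm (T ⟨γ, hγ⟩) = ⟨γ, hγ⟩ := e.symm_apply_apply ⟨γ, hγ⟩
          exact congrArg Subtype.val this
        calc |γ i| ≤ ‖γ‖ := by rw [← Real.norm_eq_abs]; exact norm_le_pi_norm γ i
          _ = ‖S (fun s => γ (ι s))‖ := by rw [h1]
          _ ≤ ‖S‖ * ‖fun s => γ (ι s)‖ := S.le_opNorm _
          _ ≤ ‖S‖ * t := by
              gcongr
              rw [pi_norm_le_iff_of_nonneg ht]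
              intro s
              exact h _ (A.orderEmbOfFin_mem hA s)
    · exact ⟨fun _ => 0, 0, le_rfl, fun _ => Γ'.zero_mem, fun h => absurd h hA⟩
  choose e C hC he hk using key
  refine ⟨e, ∑ A, C A, Finset.sum_nonneg fun A _ => hC A, he, fun A hA => (hk A hA).1, ?_⟩
  intro A hA γ hγ t ht h i
  refine ((hk A hA).2 γ hγ t ht h i).trans ?_
  gcongr
  exact Finset.single_le_sum (fun A _ => hC A) (Finset.mem_univ A)

lemma kap_close {n : ℕ} (P : MT n) (i : Fin n) (x : ℝ) :
    |(P.v i : ℝ) - pw (-P.I.1) * x| ≤ |(kap P i x : ℝ)| + 1 ∧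
    |(kap P i x : ℝ)| ≤ |(P.v i : ℝ) - pw (-P.I.1) * x| + 1 := by
  have h1 := Int.floor_le (pw (-P.I.1) * x)
  have h2 := Int.lt_floor_add_one (pw (-P.I.1) * x)
  have e : (kap P i x : ℝ) = (P.v i : ℝ) - ⌊pw (-P.I.1) * x⌋ := by unfold kap; push_cast; rfl
  have h3 : |((P.v i : ℝ) - pw (-P.I.1) * x) - kap P i x| ≤ 1 := by
    rw [e, abs_le]; constructor <;> linarith
  constructor
  · have := abs_sub_abs_le_abs_sub ((P.v i : ℝ) - pw (-P.I.1) * x) (kap P i x); linarith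
  · have := abs_sub_abs_le_abs_sub (kap P i x : ℝ) ((P.v i : ℝ) - pw (-P.I.1) * x)
    rw [abs_sub_comm] at h3; linarith

lemma qf_le {n : ℕ} {w : Fin n → ℝ} : qf w ≤ n * ‖w‖ ^ 2 := by
  unfold qf
  calc ∑ i, w i ^ 2 ≤ ∑ i : Fin n, ‖w‖ ^ 2 := by
        refine Finset.sum_le_sum fun i _ => ?_
        rw [← sq_abs]
        have := norm_le_pi_norm w i
        rw [Real.norm_eq_abs] at this
        gcongr
    _ = _ := by simp

lemma le_qf {n : ℕ} {w : Fin n → ℝ} : ‖w‖ ≤ √(qf w) := by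
  rw [pi_norm_le_iff_of_nonneg (Real.sqrt_nonneg _)]
  intro i
  rw [Real.norm_eq_abs]
  apply Real.abs_le_sqrt
  exact Finset.single_le_sum (f := fun i => w i ^ 2) (fun i _ => sq_nonneg _) (Finset.mem_univ i)

theorem geo_exists {n k : ℕ} (Γ' : Submodule ℝ (Fin n → ℝ)) (hΓ : (Γ' : Set (Fin n → ℝ)) ⊆ GammaSet n)
    (hnd : NonDegenerate n k Γ') {Pr : (Fin n → ℝ) →L[ℝ] (Fin n → ℝ)}
    (hP1 : ∀ ξ, ξ - Pr ξ ∈ Γ') (hP2 : ∀ ξ ∈ Γ', Pr ξ = 0) :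
    ∃ (b : ℝ) (C2 C3 : ℤ) (ext : Finset (Fin n) → (Fin n → ℝ) → Fin n → ℝ), 0 < b ∧ 7 ≤ C2 ∧
      ∀ ℙ : Finset (MT n), (∀ P ∈ ℙ, ∃ u : Fin n → ℝ, ∑ i, u i = 0 ∧ (∀ i, |u i - P.v i| ≤ 1) ∧
        b ≤ qf (Pr u) ∧ qf (Pr u) ≤ 4 * (b + 1)) → Geo n k C2 C3 ℙ ext := by
  obtain ⟨ext, CΓ, hCΓ, hext, hagree, hbound⟩ := exists_ext Γ' hnd
  set b : ℝ := n * (‖Pr‖ * (8 * n + 1)) ^ 2 + 1 with hb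
  have hb0 : 0 < b := by positivity
  set R := √(4 * (b + 1)) with hR
  have hR0 : 0 ≤ R := Real.sqrt_nonneg _
  set f : ℝ → ℝ := fun K0 => 1 + R + CΓ * (R + K0 + 2) + 1 with hf
  set C2 : ℤ := max 7 ⌈f 6⌉ with hC2
  set C3 : ℤ := ⌈f C2⌉ with hC3
  have hdil : ∀ A x (s : ℤ), (fun i => pw s * ext A x i) ∈ Γ' := fun A x s => Γ'.smul_mem (pw s) (hext A x)
  have gen : ∀ (A : Finset (Fin n)), A.card = k → ∀ x (P : MT n) (K0 : ℝ), 0 ≤ K0 →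
      (∃ u : Fin n → ℝ, ∑ i, u i = 0 ∧ (∀ i, |u i - P.v i| ≤ 1) ∧
        b ≤ qf (Pr u) ∧ qf (Pr u) ≤ 4 * (b + 1)) → (∀ i ∈ A, |(kap P i (x i) : ℝ)| ≤ K0) →
      ∀ i, |(kap P i (ext A x i) : ℝ)| ≤ f K0 := by
    rintro A hA x P K0 hK0 ⟨u, hu0, hu1, hu2, hu3⟩ hx i
    set γ : Fin n → ℝ := fun i => pw (-P.I.1) * ext A x i with hγ
    have hPu : ∀ i, |u i - (u - Pr u) i| ≤ R := by
      intro i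
      rw [Pi.sub_apply, sub_sub_cancel, ← Real.norm_eq_abs]
      exact (norm_le_pi_norm _ i).trans (le_qf.trans (Real.sqrt_le_sqrt hu3))
    have h1 : ∀ i ∈ A, |((u - Pr u) - γ) i| ≤ R + K0 + 2 := by
      intro i hi
      have a1 := hPu i
      have a2 := hu1 i
      have a3 := (kap_close P i (x i)).1
      have a4 := hx i hi
      have e : γ i = pw (-P.I.1) * x i := by simp only [hγ]; rw [hagree A hA x i hi]
      rw [Pi.sub_apply, e]
      rw [abs_le] at a1 a2 ⊢
      have a5 := a3.trans (add_le_add_left a4 1)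
      rw [abs_le] at a5
      constructor <;> linarith [a1.1, a1.2, a2.1, a2.2, a5.1, a5.2]
    have h2 := hbound A hA _ (Γ'.sub_mem (hP1 u) (hdil A x (-P.I.1))) (R + K0 + 2) (by linarith) h1 i
    have h3 := (kap_close P i (ext A x i)).2
    refine h3.trans ?_
    simp only [hf]
    have a1 := hPu i
    have a2 := hu1 i
    rw [Pi.sub_apply] at h2
    change |(u - Pr u) i - pw (-P.I.1) * ext A x i| ≤ _ at h2
    gcongr
    rw [abs_le] at a1 a2 h2 ⊢
    constructor <;> linarith [a1.1, a1.2, a2.1, a2.2, h2.1, h2.2]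
  refine ⟨b, C2, C3, ext, hb0, le_max_left _ _, fun ℙ hℙ => ⟨hagree, ?_, ?_, ?_⟩⟩
  · intro A hA x P hP hx i
    have := gen A hA x P C2 (by have : (7 : ℤ) ≤ C2 := le_max_left _ _
                                have : (7 : ℝ) ≤ C2 := by exact_mod_cast this
                                linarith) (hℙ P hP) (fun i hi => by exact_mod_cast hx i hi) i
    have h2 := this.trans (Int.le_ceil (f C2))
    exact_mod_cast h2
  · intro A hA x P hP hx i
    have := gen A hA x P 6 (by norm_num) (hℙ P hP) (fun i hi => by exact_mod_cast hx i hi) i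
    have h2 := this.trans (Int.le_ceil (f 6))
    have h3 : |kap P i (ext A x i)| ≤ ⌈f 6⌉ := by exact_mod_cast h2
    exact h3.trans (le_max_right _ _)
  · intro A hA x P hP hx
    obtain ⟨u, hu0, hu1, hu2, hu3⟩ := hℙ P hP
    by_contra hcon
    push Not at hcon
    set γ : Fin n → ℝ := fun i => pw (-P.I.1) * ext A x i with hγ
    have hγΓ : γ ∈ Γ' := hdil A x (-P.I.1)
    have hγs : ∑ i, γ i = 0 := hΓ hγΓ
    set δ : Fin n → ℝ := fun i => u i - γ i with hδ
    have hδs : ∑ i, δ i = 0 := by simp only [hδ]; rw [Finset.sum_sub_distrib, hu0, hγs, sub_zero]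
    have hsmall : ∀ i, |kap P i (ext A x i)| < 7 → |δ i| ≤ 8 := by
      intro i hi
      have h6 : |kap P i (ext A x i)| ≤ 6 := by omega
      have h6' : |(kap P i (ext A x i) : ℝ)| ≤ 6 := by exact_mod_cast h6
      have a1 := (kap_close P i (ext A x i)).1.trans (add_le_add_left h6' 1)
      have a2 := hu1 i
      simp only [hδ, hγ]
      rw [abs_le] at a1 a2 ⊢
      constructor <;> linarith [a1.1, a1.2, a2.1, a2.2]
    have hn1 : ∀ i : Fin n, (1 : ℝ) ≤ n := fun i => by exact_mod_cast i.pos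
    have hall : ∀ i, |δ i| ≤ 8 * n := by
      intro i
      by_cases hi : 7 ≤ |kap P i (ext A x i)|
      · have ho : ∀ i' ∈ Finset.univ.erase i, |δ i'| ≤ 8 := fun i' hi' =>
          hsmall i' (hcon i i' (Finset.ne_of_mem_erase hi').symm hi)
        have e : δ i = -∑ i' ∈ Finset.univ.erase i, δ i' := by
          rw [← Finset.add_sum_erase _ _ (Finset.mem_univ i)] at hδs; linarith
        rw [e, abs_neg]
        refine (Finset.abs_sum_le_sum_abs _ _).trans ((Finset.sum_le_card_nsmul _ _ _ ho).trans ?_)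
        rw [nsmul_eq_mul, mul_comm]
        have hc : ((Finset.univ.erase i).card : ℝ) ≤ n := by
          have := Finset.card_le_univ (Finset.univ.erase i)
          rw [Fintype.card_fin] at this
          exact_mod_cast this
        linarith
      · have := hsmall i (by omega)
        linarith [hn1 i]
    have hδn : ‖δ‖ ≤ 8 * n + 1 := by
      rw [pi_norm_le_iff_of_nonneg (by positivity)]
      intro i; rw [Real.norm_eq_abs]; linarith [hall i]
    have hPδ : Pr u = Pr δ := by
      have : δ = u - γ := rfl
      rw [this, map_sub, hP2 γ hγΓ, sub_zero]
    have h5 : qf (Pr u) ≤ n * (‖Pr‖ * (8 * n + 1)) ^ 2 := by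
      rw [hPδ]
      refine qf_le.trans ?_
      gcongr
      exact (Pr.le_opNorm δ).trans (by gcongr)
    linarith
end

noncomputable section

structure DB {E : Type*} [NormedAddCommGroup E] [NormedSpace ℝ E] (M : ℕ) (K : ℝ) (f : E → ℂ) : Prop where
  cd : ContDiff ℝ (M : ℕ∞) f
  bd : ∀ a ≤ M, ∀ u, ‖iteratedFDeriv ℝ a f u‖ ≤ K

section DBsec
variable {E : Type*} [NormedAddCommGroup E] [NormedSpace ℝ E]
variable {G : Type*} [NormedAddCommGroup G] [NormedSpace ℝ G]

lemma choose_sum_bd {a M : ℕ} (ha : a ≤ M) {K1 K2 : ℝ} (h1 : 0 ≤ K1) (h2 : 0 ≤ K2) {p q : ℕ → ℝ}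
    (hp0 : ∀ i, 0 ≤ p i) (hq0 : ∀ i, 0 ≤ q i)
    (hp : ∀ i ≤ a, p i ≤ K1) (hq : ∀ i ≤ a, q i ≤ K2) :
    ∑ i ∈ Finset.range (a + 1), (a.choose i : ℝ) * p i * q (a - i) ≤ 2 ^ M * (K1 * K2) := by
  calc _ ≤ ∑ i ∈ Finset.range (a + 1), (a.choose i : ℝ) * (K1 * K2) := by
        apply Finset.sum_le_sum
        intro i hi
        have hi' : i ≤ a := by simpa [Nat.lt_succ_iff] using hi
        rw [mul_assoc]
        exact mul_le_mul_of_nonneg_left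
          (mul_le_mul (hp i hi') (hq _ (Nat.sub_le _ _)) (hq0 _) h1) (by positivity)
    _ = 2 ^ a * (K1 * K2) := by
        rw [← Finset.sum_mul]
        congr 1
        exact_mod_cast Nat.sum_range_choose a
    _ ≤ _ := by
        have : (2:ℝ) ^ a ≤ 2 ^ M := pow_le_pow_right₀ (by norm_num) ha
        have := mul_nonneg h1 h2
        gcongr

lemma DB.nonneg {M : ℕ} {K : ℝ} {f : E → ℂ} (h : DB M K f) : 0 ≤ K :=
  (norm_nonneg _).trans (h.bd 0 (Nat.zero_le _) 0)

lemma DB.mul {M : ℕ} {K1 K2 : ℝ} {f g : E → ℂ} (hf : DB M K1 f) (hg : DB M K2 g) :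
    DB M (2 ^ M * (K1 * K2)) (fun u => f u * g u) where
  cd := hf.cd.mul hg.cd
  bd a ha u := by
    refine (norm_iteratedFDeriv_mul_le hf.cd hg.cd u (n := a) (by exact_mod_cast ha)).trans ?_
    exact choose_sum_bd ha hf.nonneg hg.nonneg (p := fun i => ‖iteratedFDeriv ℝ i f u‖)
      (q := fun i => ‖iteratedFDeriv ℝ i g u‖) (fun _ => norm_nonneg _) (fun _ => norm_nonneg _)
      (fun i hi => hf.bd i (hi.trans ha) u) (fun i hi => hg.bd i (hi.trans ha) u)

lemma DB.comp_lin {M : ℕ} {K : ℝ} {f : E → ℂ} (hf : DB M K f) (g : G →L[ℝ] E) :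
    DB M (K * (1 + ‖g‖) ^ M) (fun u => f (g u)) where
  cd := hf.cd.comp g.contDiff
  bd a ha u := by
    have h := g.iteratedFDeriv_comp_right hf.cd u (i := a) (by exact_mod_cast ha)
    have h2 : (f ∘ g) = fun u => f (g u) := rfl
    rw [h2] at h
    rw [h]
    refine (ContinuousMultilinearMap.norm_compContinuousLinearMap_le _ _).trans ?_
    have h3 : ∏ _i : Fin a, ‖g‖ ≤ (1 + ‖g‖) ^ M := by
      rw [Finset.prod_const, Finset.card_univ, Fintype.card_fin]
      have h0 := norm_nonneg g
      calc ‖g‖ ^ a ≤ (1 + ‖g‖) ^ a := by gcongr; linarith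
        _ ≤ _ := pow_le_pow_right₀ (by linarith) ha
    exact mul_le_mul (hf.bd a ha _) h3 (by positivity) hf.nonneg

lemma DB.comp_sub {M : ℕ} {K : ℝ} {f : E → ℂ} (hf : DB M K f) (c : E) :
    DB M K (fun u => f (u - c)) where
  cd := hf.cd.comp (contDiff_id.sub contDiff_const)
  bd a ha u := by
    rw [iteratedFDeriv_comp_sub]
    exact hf.bd a ha _

lemma DB.const_one (M : ℕ) : DB M 1 (fun _ : E => (1:ℂ)) where
  cd := contDiff_const
  bd a ha u := by
    rcases Nat.eq_zero_or_pos a with rfl | h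
    · simp
    · rw [iteratedFDeriv_const_of_ne h.ne']
      simp

lemma DB.prod {ι : Type*} (M : ℕ) (K : ℝ) (S : Finset ι) : ∃ K', ∀ f : ι → E → ℂ, (∀ i, DB M K (f i)) →
    DB M K' (fun u => ∏ i ∈ S, f i u) := by
  induction S using Finset.induction_on with
  | empty => exact ⟨1, fun f _ => by simpa using DB.const_one M⟩
  | insert i S hi ih =>
    obtain ⟨K', h⟩ := ih
    refine ⟨2 ^ M * (K * K'), fun f hf => ?_⟩
    simp_rw [Finset.prod_insert hi]
    exact (hf i).mul (h f hf)

lemma DB.of_cpt [FiniteDimensional ℝ E] (M : ℕ) {f : E → ℂ} (hf : ContDiff ℝ (M : ℕ∞) f) (hc : HasCompactSupport f) :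
    ∃ K, DB M K f := by
  have : ∀ a : ℕ, ∃ K, 0 ≤ K ∧ (a ≤ M → ∀ u, ‖iteratedFDeriv ℝ a f u‖ ≤ K) := by
    intro a
    by_cases ha : a ≤ M
    · have hcont := hf.continuous_iteratedFDeriv (m := a) (by exact_mod_cast ha)
      obtain ⟨K, hK⟩ := hcont.bounded_above_of_compact_support (hc.iteratedFDeriv a)
      exact ⟨K, (norm_nonneg _).trans (hK 0), fun _ => hK⟩
    · exact ⟨0, le_rfl, fun h => absurd h ha⟩
  choose K hK0 hK using this
  refine ⟨∑ a ∈ Finset.range (M + 1), K a, hf, fun a ha u => (hK a ha u).trans ?_⟩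
  exact Finset.single_le_sum (f := K) (fun i _ => hK0 i) (by simp; omega)
end DBsec

/-! cutoffs -/
def chi (x : ℝ) : ℝ := smoothTransition (x + 1) - smoothTransition x
def tht (b t : ℝ) : ℝ := smoothTransition (t - b) - smoothTransition (t / 4 - b)

lemma chi_nonneg (x : ℝ) : 0 ≤ chi x := sub_nonneg.2 (smoothTransition.monotone (by linarith))
lemma chi_zero {x : ℝ} (h : 1 ≤ |x|) : chi x = 0 := by
  unfold chi
  rcases le_abs.1 h with h | h
  · rw [smoothTransition.one_of_one_le (by linarith), smoothTransition.one_of_one_le h, sub_self]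
  · rw [smoothTransition.zero_of_nonpos (by linarith), smoothTransition.zero_of_nonpos (by linarith), sub_self]
lemma chi_smooth : ContDiff ℝ (⊤ : ℕ∞) chi := by
  unfold chi
  exact (smoothTransition.contDiff.comp (by fun_prop)).sub smoothTransition.contDiff
lemma chi_cont : Continuous chi := chi_smooth.continuous
lemma tht_nonneg (b : ℝ) {t : ℝ} (ht : 0 ≤ t) : 0 ≤ tht b t :=
  sub_nonneg.2 (smoothTransition.monotone (by linarith))
lemma tht_zero_lo {b t : ℝ} (hb : 0 < b) (h : t ≤ b) : tht b t = 0 := by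
  unfold tht
  rw [smoothTransition.zero_of_nonpos (by linarith), smoothTransition.zero_of_nonpos (by linarith), sub_self]
lemma tht_zero_hi {b t : ℝ} (hb : 0 < b) (h : 4 * (b + 1) ≤ t) : tht b t = 0 := by
  unfold tht
  rw [smoothTransition.one_of_one_le (by linarith), smoothTransition.one_of_one_le (by linarith), sub_self]
lemma tht_smooth (b : ℝ) : ContDiff ℝ (⊤ : ℕ∞) (tht b) := by
  unfold tht
  exact (smoothTransition.contDiff.comp (by fun_prop)).sub (smoothTransition.contDiff.comp (by fun_prop))
lemma tht_cont (b : ℝ) : Continuous (tht b) := (tht_smooth b).continuous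

lemma qf_nonneg {n : ℕ} (w : Fin n → ℝ) : 0 ≤ qf w := Finset.sum_nonneg fun i _ => sq_nonneg _
lemma qf_smooth {n : ℕ} : ContDiff ℝ (⊤ : ℕ∞) (qf (n := n)) := by
  unfold qf
  fun_prop
lemma qf_cont {n : ℕ} : Continuous (qf (n := n)) := qf_smooth.continuous
lemma qf_smul {n : ℕ} (c : ℝ) (w : Fin n → ℝ) : qf (c • w) = c ^ 2 * qf w := by
  unfold qf
  rw [Finset.mul_sum]
  exact Finset.sum_congr rfl fun i _ => by simp [mul_pow]

/-- the space of parameters -/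
abbrev VV (n : ℕ) := EuclideanSpace ℝ (Fin (n - 1))

lemma gammaParam_add (n : ℕ) (x y : Fin (n - 1) → ℝ) :
    gammaParam n (x + y) = gammaParam n x + gammaParam n y := by
  ext i
  simp only [gammaParam, Pi.add_apply]
  split_ifs
  · rfl
  · rw [Finset.sum_add_distrib]; ring
lemma gammaParam_smul (n : ℕ) (c : ℝ) (x : Fin (n - 1) → ℝ) :
    gammaParam n (c • x) = c • gammaParam n x := by
  ext i
  simp only [gammaParam, Pi.smul_apply, smul_eq_mul]
  split_ifs
  · rfl
  · rw [← Finset.mul_sum]; ring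
lemma gammaParam_sum {n : ℕ} (hn : 1 ≤ n) (x : Fin (n - 1) → ℝ) : ∑ i, gammaParam n x i = 0 := by
  obtain ⟨d, rfl⟩ : ∃ d, n = d + 1 := ⟨n - 1, by omega⟩
  rw [Fin.sum_univ_castSucc]
  simp [gammaParam]

/-- `gammaParam` as a continuous linear map -/
def gLin (n : ℕ) : VV n →L[ℝ] (Fin n → ℝ) :=
  LinearMap.toContinuousLinearMap
    { toFun := fun u => gammaParam n u.ofLp
      map_add' := fun x y => gammaParam_add n _ _
      map_smul' := fun c x => gammaParam_smul n c _ }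
lemma gLin_apply (n : ℕ) (u : VV n) : gLin n u = gammaParam n u.ofLp := rfl

lemma gLin_coord (n : ℕ) (u : VV n) (i : Fin (n - 1)) : gLin n u ⟨i, by omega⟩ = u i := by
  rw [gLin_apply]; simp [gammaParam]

def hcut {n : ℕ} (Pr : (Fin n → ℝ) →L[ℝ] (Fin n → ℝ)) (b : ℝ) (ν : Fin n → ℤ) (ξ : Fin n → ℝ) : ℝ :=
  tht b (qf (Pr ξ)) * ∏ i, chi (ξ i - ν i)

def GG {n : ℕ} (Pr : (Fin n → ℝ) →L[ℝ] (Fin n → ℝ)) (b : ℝ) (m : (Fin n → ℝ) → ℂ) (s : ℤ) (ν : Fin n → ℤ)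
    (u : VV n) : ℂ := m (pw s • gLin n u) * (hcut Pr b ν (gLin n u) : ℂ)

lemma hcut_DB {n : ℕ} (Pr : (Fin n → ℝ) →L[ℝ] (Fin n → ℝ)) {b : ℝ} (hb : 0 < b) (M : ℕ) :
    ∃ K, ∀ ν, DB M K (fun u : VV n => (hcut Pr b ν (gLin n u) : ℂ)) := by
  obtain ⟨K1, h1⟩ : ∃ K, DB M K (fun w : Fin n → ℝ => (tht b (qf w) : ℂ)) := by
    apply DB.of_cpt
    · have : ContDiff ℝ (⊤ : ℕ∞) (fun w : Fin n → ℝ => (tht b (qf w) : ℂ)) :=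
        Complex.ofRealCLM.contDiff.comp ((tht_smooth b).comp qf_smooth)
      exact this.of_le (by exact_mod_cast le_top)
    · apply HasCompactSupport.intro (isCompact_closedBall (0 : Fin n → ℝ) (√(4 * (b + 1))))
      intro w hw
      rw [mem_closedBall_zero_iff, not_le] at hw
      rw [tht_zero_hi hb, ofReal_zero]
      have h2 := hw.trans_le le_qf
      exact (Real.sqrt_lt_sqrt_iff (by positivity)).1 h2 |>.le
  obtain ⟨K2, h2⟩ : ∃ K, DB M K (fun w : ℝ => (chi w : ℂ)) := by
    apply DB.of_cpt
    · have : ContDiff ℝ (⊤ : ℕ∞) (fun w : ℝ => (chi w : ℂ)) :=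
        Complex.ofRealCLM.contDiff.comp chi_smooth
      exact this.of_le (by exact_mod_cast le_top)
    · apply HasCompactSupport.intro (isCompact_closedBall (0 : ℝ) 1)
      intro w hw
      rw [mem_closedBall_zero_iff, not_le] at hw
      rw [chi_zero hw.le, ofReal_zero]
  set Li : Fin n → (VV n →L[ℝ] ℝ) := fun i => (ContinuousLinearMap.proj i).comp (gLin n) with hLi
  set K3 := ∑ i, K2 * (1 + ‖Li i‖) ^ M with hK3
  obtain ⟨K4, h4⟩ := DB.prod (E := VV n) M K3 (Finset.univ : Finset (Fin n))
  refine ⟨2 ^ M * ((K1 * (1 + ‖Pr.comp (gLin n)‖) ^ M) * K4), fun ν => ?_⟩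
  have e : (fun u : VV n => (hcut Pr b ν (gLin n u) : ℂ)) = fun u =>
      (tht b (qf ((Pr.comp (gLin n)) u)) : ℂ) * ∏ i, (chi (Li i u - ν i) : ℂ) := by
    ext u
    simp [hcut, hLi]
  rw [e]
  refine (h1.comp_lin (Pr.comp (gLin n))).mul (h4 _ fun i => ?_)
  have h5 := (h2.comp_sub (ν i : ℝ)).comp_lin (Li i)
  refine ⟨h5.cd, fun a ha u => (h5.bd a ha u).trans ?_⟩
  have := h2.nonneg
  exact Finset.single_le_sum (f := fun i => K2 * (1 + ‖Li i‖) ^ M) (fun i _ => by positivity) (Finset.mem_univ i)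
end

noncomputable section

variable {n : ℕ}

lemma dist_lower {Γ' : Submodule ℝ (Fin n → ℝ)} {Pr : (Fin n → ℝ) →L[ℝ] (Fin n → ℝ)}
    (hP2 : ∀ ξ ∈ Γ', Pr ξ = 0) {b : ℝ} {ξ : Fin n → ℝ} (h : b ≤ qf (Pr ξ)) (s : ℤ) :
    pw s * (√(b / (n + 1)) / (‖Pr‖ + 1)) ≤ Metric.infDist (pw s • ξ) (Γ' : Set (Fin n → ℝ)) := by
  rw [Metric.le_infDist ⟨0, Γ'.zero_mem⟩]
  intro y hy
  have h1 : Pr (pw s • ξ - y) = pw s • Pr ξ := by rw [map_sub, map_smul, hP2 y hy, sub_zero]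
  have h2 := Pr.le_opNorm (pw s • ξ - y)
  rw [h1, norm_smul, Real.norm_of_nonneg (pw_pos s).le] at h2
  have h3 : √(b / (n + 1)) ≤ ‖Pr ξ‖ := by
    apply Real.sqrt_le_iff.2 ⟨norm_nonneg _, ?_⟩
    rw [div_le_iff₀ (by positivity)]
    have := qf_le (w := Pr ξ)
    nlinarith [sq_nonneg ‖Pr ξ‖]
  rw [dist_eq_norm, ← mul_div_assoc, div_le_iff₀ (by positivity)]
  have h4 := mul_le_mul_of_nonneg_left h3 (pw_pos s).le
  nlinarith [norm_nonneg (pw s • ξ - y), norm_nonneg Pr]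

lemma multilin_gamma {a : ℕ} (D : ContinuousMultilinearMap ℝ (fun _ : Fin a => (Fin n → ℝ)) ℂ) {Q : ℝ}
    (h : ∀ v : Fin a → (Fin n → ℝ), (∀ s, v s ∈ GammaSet n) → (∀ s, ‖v s‖ ≤ 1) → ‖D v‖ ≤ Q)
    (v : Fin a → (Fin n → ℝ)) (hv : ∀ s, v s ∈ GammaSet n) : ‖D v‖ ≤ Q * ∏ s, ‖v s‖ := by
  by_cases h0 : ∃ s, v s = 0
  · obtain ⟨s, hs⟩ := h0
    rw [D.map_coord_zero s hs, norm_zero, Finset.prod_eq_zero (Finset.mem_univ s) (by rw [hs, norm_zero]),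
      mul_zero]
  · push Not at h0
    have e : v = fun s => ‖v s‖ • (‖v s‖⁻¹ • v s) := by
      ext1 s
      rw [smul_smul, mul_inv_cancel₀ (norm_ne_zero_iff.2 (h0 s)), one_smul]
    have e2 : D v = (∏ s, ‖v s‖) • D (fun s => ‖v s‖⁻¹ • v s) := by
      conv_lhs => rw [e]
      exact D.map_smul_univ _ _
    rw [e2, norm_smul, Real.norm_of_nonneg (Finset.prod_nonneg fun _ _ => norm_nonneg _), mul_comm]
    refine mul_le_mul_of_nonneg_right (h _ (fun s => ?_) (fun s => ?_)) (Finset.prod_nonneg fun _ _ => norm_nonneg _)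
    · have := hv s
      simp only [GammaSet, Set.mem_ofPred_eq] at this ⊢
      simp [← Finset.mul_sum, this]
    · rw [norm_smul, norm_inv, norm_norm, inv_mul_cancel₀ (norm_ne_zero_iff.2 (h0 s))]

lemma GG_bd (hn : 2 ≤ n) {Γ' : Submodule ℝ (Fin n → ℝ)} {Pr : (Fin n → ℝ) →L[ℝ] (Fin n → ℝ)}
    (hP2 : ∀ ξ ∈ Γ', Pr ξ = 0) {b : ℝ} (hb : 0 < b) (M : ℕ) (B : ℝ) :
    ∃ K, ∀ m, SymbolEst n Γ' M B m → ∀ s ν, DB M K (GG Pr b m s ν) := by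
  obtain ⟨K, hK⟩ := hcut_DB (n := n) Pr hb M
  set R : ℝ := √(b / (n + 1)) / (‖Pr‖ + 1) with hR
  have hR0 : 0 < R := by positivity
  set Q : ℝ := 1 + ‖gLin n‖ / R with hQ
  have hQ1 : 1 ≤ Q := by rw [hQ]; have : 0 ≤ ‖gLin n‖ / R := by positivity
                         linarith
  have hK0 : 0 ≤ K := (hK 0).nonneg
  refine ⟨2 ^ M * (|B| * Q ^ M * K), fun m hm s ν => ?_⟩
  obtain ⟨hm1, hm2, hm3⟩ := hm
  have hB0 : 0 ≤ B := (norm_nonneg _).trans (hm1 0 (by simp [GammaSet]))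
  have hC0 : 0 ≤ 2 ^ M * (|B| * Q ^ M * K) := by positivity
  have hΓo : IsOpen ((Γ' : Set (Fin n → ℝ))ᶜ) := (Submodule.closed_of_finiteDimensional Γ').isOpen_compl
  set g : VV n →L[ℝ] (Fin n → ℝ) := pw s • gLin n with hg
  set U : Set (VV n) := g ⁻¹' ((Γ' : Set (Fin n → ℝ))ᶜ) with hU
  have hUo : IsOpen U := hΓo.preimage g.continuous
  have hmU : ContDiffOn ℝ (M : ℕ∞) (fun u => m (g u)) U := hm2.comp g.contDiff.contDiffOn (fun x hx => hx)
  have hcU := (hK ν).cd.contDiffOn (s := U)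
  have main : ∀ u, ContDiffAt ℝ (M : ℕ∞) (GG Pr b m s ν) u ∧
      ∀ a ≤ M, ‖iteratedFDeriv ℝ a (GG Pr b m s ν) u‖ ≤ 2 ^ M * (|B| * Q ^ M * K) := by
    intro u
    by_cases hu : qf (Pr (gLin n u)) < b
    · have hz : GG Pr b m s ν =ᶠ[nhds u] fun _ => 0 := by
        have ho : IsOpen {u : VV n | qf (Pr (gLin n u)) < b} :=
          isOpen_lt (qf_cont.comp (Pr.continuous.comp (gLin n).continuous)) continuous_const
        filter_upwards [ho.mem_nhds hu] with x hx
        simp only [GG, hcut]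
        rw [tht_zero_lo hb (le_of_lt hx)]
        simp
      refine ⟨contDiffAt_const.congr_of_eventuallyEq hz, fun a ha => ?_⟩
      rw [(hz.iteratedFDeriv ℝ a).eq_of_nhds]
      have : iteratedFDeriv ℝ a (fun _ : VV n => (0:ℂ)) u = 0 := by
        simp
      rw [this, norm_zero]
      exact hC0
    · push Not at hu
      have hd := dist_lower hP2 hu s
      rw [← hR] at hd
      have hpos : 0 < Metric.infDist (pw s • gLin n u) (Γ' : Set (Fin n → ℝ)) :=
        lt_of_lt_of_le (mul_pos (pw_pos s) hR0) hd
      have huU : u ∈ U := by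
        intro hmem
        have h0 : Metric.infDist (pw s • gLin n u) (Γ' : Set (Fin n → ℝ)) = 0 :=
          Metric.infDist_zero_of_mem hmem
        linarith
      have hprod : ContDiffOn ℝ (M : ℕ∞) (GG Pr b m s ν) U := hmU.mul hcU
      refine ⟨hprod.contDiffAt (hUo.mem_nhds huU), fun a ha => ?_⟩
      rw [← iteratedFDerivWithin_of_isOpen a hUo huU]
      have hb1 := norm_iteratedFDerivWithin_mul_le hmU hcU hUo.uniqueDiffOn huU (n := a) (by exact_mod_cast ha)
      refine hb1.trans (choose_sum_bd ha (K1 := |B| * Q ^ M) (K2 := K) (by positivity) hK0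
        (p := fun i => ‖iteratedFDerivWithin ℝ i (fun u => m (g u)) U u‖)
        (q := fun i => ‖iteratedFDerivWithin ℝ i (fun u => (hcut Pr b ν (gLin n u) : ℂ)) U u‖)
        (fun _ => norm_nonneg _) (fun _ => norm_nonneg _) (fun i hi => ?_) (fun i hi => ?_))
      · have hi' : i ≤ M := hi.trans ha
        have e := g.iteratedFDerivWithin_comp_right hm2 hΓo.uniqueDiffOn hUo.uniqueDiffOn (x := u) huU
          (i := i) (by exact_mod_cast hi')
        have e2 : (m ∘ g) = fun u => m (g u) := rfl
        rw [e2] at e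
        simp only [hU] at *
        rw [e]
        have hpQ : Q ^ i ≤ Q ^ M := pow_le_pow_right₀ hQ1 hi'
        refine le_trans ?_ (mul_le_mul_of_nonneg_left hpQ (abs_nonneg B))
        refine ContinuousMultilinearMap.opNorm_le_bound (by positivity) fun v => ?_
        rw [ContinuousMultilinearMap.compContinuousLinearMap_apply]
        refine (multilin_gamma _ (hm3 i hi' (g u) huU) _ (fun t => ?_)).trans ?_
        · have := gammaParam_sum (n := n) (by omega) (v t).ofLp
          simp only [GammaSet, Set.mem_ofPred_eq, hg, smul_apply, Pi.smul_apply, smul_eq_mul]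
          rw [← Finset.mul_sum, gLin_apply, this, mul_zero]
        · have hgv : ∀ t, ‖g (v t)‖ ≤ pw s * ‖gLin n‖ * ‖v t‖ := by
            intro t
            rw [hg, smul_apply, norm_smul, Real.norm_of_nonneg (pw_pos s).le, mul_assoc]
            exact mul_le_mul_of_nonneg_left ((gLin n).le_opNorm _) (pw_pos s).le
          have hgp : ∏ t, ‖g (v t)‖ ≤ (pw s * ‖gLin n‖) ^ i * ∏ t, ‖v t‖ := by
            refine (Finset.prod_le_prod (fun _ _ => norm_nonneg _) (fun t _ => hgv t)).trans_eq ?_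
            rw [Finset.prod_mul_distrib, Finset.prod_const, Finset.card_univ, Fintype.card_fin]
          have hgu : g u = pw s • gLin n u := rfl
          rw [hgu, abs_of_nonneg hB0]
          have hd2 : B / Metric.infDist (pw s • gLin n u) (Γ' : Set (Fin n → ℝ)) ^ i ≤ B / (pw s * R) ^ i := by
            have := mul_pos (pw_pos s) hR0
            gcongr
          have hP0 : 0 ≤ ∏ t, ‖v t‖ := Finset.prod_nonneg fun _ _ => norm_nonneg _
          have hps := pw_pos s
          calc _ ≤ B / (pw s * R) ^ i * ((pw s * ‖gLin n‖) ^ i * ∏ t, ‖v t‖) :=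
                mul_le_mul hd2 hgp (Finset.prod_nonneg fun _ _ => norm_nonneg _) (by positivity)
            _ = B * (‖gLin n‖ / R) ^ i * ∏ t, ‖v t‖ := by
                rw [div_pow, mul_pow, mul_pow]; field_simp
            _ ≤ _ := by
                gcongr
                rw [hQ]; linarith
      · change ‖iteratedFDerivWithin ℝ i (fun u => (hcut Pr b ν (gLin n u) : ℂ)) U u‖ ≤ K
        rw [iteratedFDerivWithin_of_isOpen i hUo huU]
        exact (hK ν).bd i (hi.trans ha) u
  exact ⟨contDiff_iff_contDiffAt.2 fun u => (main u).1, fun a ha u => (main u).2 a ha⟩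

lemma GG_supp (hn : 2 ≤ n) {Pr : (Fin n → ℝ) →L[ℝ] (Fin n → ℝ)} {b : ℝ} {m : (Fin n → ℝ) → ℂ} {s : ℤ} {ν : Fin n → ℤ} :
    ∃ c : VV n, ∀ u, u ∉ Metric.closedBall c (n : ℝ) → GG Pr b m s ν u = 0 := by
  refine ⟨WithLp.toLp 2 (fun i : Fin (n - 1) => (ν ⟨i, by omega⟩ : ℝ)), fun u hu => ?_⟩
  by_contra hne
  apply hu
  have hc : ∀ i : Fin n, |gLin n u i - ν i| ≤ 1 := by
    intro i
    by_contra h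
    push Not at h
    apply hne
    simp only [GG, hcut]
    rw [Finset.prod_eq_zero (Finset.mem_univ i) (chi_zero h.le)]
    simp
  rw [Metric.mem_closedBall, EuclideanSpace.dist_eq]
  apply Real.sqrt_le_iff.2 ⟨by positivity, ?_⟩
  calc _ ≤ ∑ _i : Fin (n - 1), (1:ℝ) := by
        apply Finset.sum_le_sum
        intro i _
        have h1 := hc ⟨i, by omega⟩
        rw [gLin_coord, ← Real.dist_eq] at h1
        have h0 : 0 ≤ dist (u i) (ν ⟨i, by omega⟩ : ℝ) := dist_nonneg
        change dist (u i) (ν ⟨i, by omega⟩ : ℝ) ^ 2 ≤ 1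
        exact pow_le_one₀ h0 h1
    _ ≤ _ := by
        have h5 : ((n - 1 : ℕ) : ℝ) ≤ n := by exact_mod_cast Nat.sub_le n 1
        have h6 : (1:ℝ) ≤ n := by exact_mod_cast (by omega : 1 ≤ n)
        simp
        nlinarith

/-- the Fourier transforms of the pieces decay uniformly -/
lemma GG_decay (hn : 2 ≤ n) {Γ' : Submodule ℝ (Fin n → ℝ)} {Pr : (Fin n → ℝ) →L[ℝ] (Fin n → ℝ)}
    (hP2 : ∀ ξ ∈ Γ', Pr ξ = 0) {b : ℝ} (hb : 0 < b) (M : ℕ) (B : ℝ) :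
    ∃ CG, 0 ≤ CG ∧ ∀ m, SymbolEst n Γ' M B m → ∀ s ν, Continuous (GG Pr b m s ν) ∧ Integrable (GG Pr b m s ν) ∧
      ∀ z, (1 + ‖z‖) ^ M * ‖𝓕 (GG Pr b m s ν) z‖ ≤ CG := by
  obtain ⟨K, hK⟩ := GG_bd hn hP2 hb M B
  set vol : ℝ := (volume : Measure (VV n)).real (Metric.closedBall 0 (n:ℝ)) with hvol
  have hvol0 : 0 ≤ vol := measureReal_nonneg
  set c : ℕ → ℝ := fun N => 2 ^ N * ((N + 1) * (|K| * vol)) with hc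
  have hc0 : ∀ N, 0 ≤ c N := fun N => by simp only [hc]; positivity
  refine ⟨2 ^ M * (c 0 + c M), mul_nonneg (by positivity) (add_nonneg (hc0 _) (hc0 _)), fun m hm s ν => ?_⟩
  have hD := hK m hm s ν
  obtain ⟨c0, hc0'⟩ := GG_supp hn (Pr := Pr) (b := b) (m := m) (s := s) (ν := ν)
  have hcs : HasCompactSupport (GG Pr b m s ν) := HasCompactSupport.intro (isCompact_closedBall _ _) hc0'
  have hcont := hD.cd.continuous
  have hia : ∀ a ≤ M, Integrable (fun v => ‖iteratedFDeriv ℝ a (GG Pr b m s ν) v‖) ∧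
      ∫ v, ‖iteratedFDeriv ℝ a (GG Pr b m s ν) v‖ ≤ |K| * vol := by
    intro a ha
    have h1 := hD.cd.continuous_iteratedFDeriv (m := a) (by exact_mod_cast ha)
    have hz : ∀ v ∉ Metric.closedBall c0 (n:ℝ), iteratedFDeriv ℝ a (GG Pr b m s ν) v = 0 := by
      intro v hv
      have h2 : tsupport (iteratedFDeriv ℝ a (GG Pr b m s ν)) ⊆ Metric.closedBall c0 (n:ℝ) := by
        refine (tsupport_iteratedFDeriv_subset a).trans ?_
        refine closure_minimal (fun x hx => ?_) Metric.isClosed_closedBall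
        by_contra h
        exact hx (hc0' x h)
      exact image_eq_zero_of_notMem_tsupport (fun h => hv (h2 h))
    refine ⟨(h1.integrable_of_hasCompactSupport (hcs.iteratedFDeriv a)).norm, ?_⟩
    have e : ∫ v, ‖iteratedFDeriv ℝ a (GG Pr b m s ν) v‖ =
        ∫ v in Metric.closedBall c0 (n:ℝ), ‖iteratedFDeriv ℝ a (GG Pr b m s ν) v‖ :=
      (setIntegral_eq_integral_of_forall_compl_eq_zero (fun v hv => by rw [hz v hv, norm_zero])).symm
    rw [e]
    have h3 := norm_setIntegral_le_of_norm_le_const (μ := volume) (s := Metric.closedBall c0 (n:ℝ))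
      (f := fun v => ‖iteratedFDeriv ℝ a (GG Pr b m s ν) v‖) (C := |K|) measure_closedBall_lt_top
      (fun v _ => by rw [norm_norm]; exact (hD.bd a ha v).trans (le_abs_self K))
    refine (le_abs_self _).trans (h3.trans_eq ?_)
    rw [hvol, measureReal_def, measureReal_def, Measure.addHaar_closedBall_center]
  have key : ∀ N ≤ M, ∀ z, ‖z‖ ^ N * ‖𝓕 (GG Pr b m s ν) z‖ ≤ c N := by
    intro N hN z
    have h := Real.pow_mul_norm_iteratedFDeriv_fourier_le (K := 0) (N := N) (f := GG Pr b m s ν)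
      (hD.cd.of_le (by exact_mod_cast hN)) (fun k a hk ha => by
        have hk0 : k = 0 := by simpa using hk
        subst hk0
        have ha' : a ≤ N := by exact_mod_cast ha
        simpa using (hia a (ha'.trans hN)).1) (k := 0) (n := N) le_rfl le_rfl z
    rw [norm_iteratedFDeriv_zero] at h
    refine h.trans ?_
    simp only [hc, Finset.sum_product, zero_add, Finset.range_one, Finset.sum_singleton, pow_zero, one_mul,
      Nat.cast_zero, mul_zero]
    refine mul_le_mul_of_nonneg_left ?_ (by positivity)
    calc _ ≤ ∑ _a ∈ Finset.range (N + 1), |K| * vol := Finset.sum_le_sum fun a ha =>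
          (hia a (by have := Finset.mem_range.1 ha; omega)).2
      _ = _ := by simp
  refine ⟨hcont, hcont.integrable_of_hasCompactSupport hcs, fun z => ?_⟩
  have h1 := key 0 (Nat.zero_le _) z
  have h2 := key M le_rfl z
  rw [pow_zero, one_mul] at h1
  have h3 : (1 + ‖z‖) ^ M ≤ 2 ^ M * (1 + ‖z‖ ^ M) := by
    have hz := norm_nonneg z
    calc (1 + ‖z‖) ^ M ≤ (2 * max 1 ‖z‖) ^ M := by
          gcongr
          have := le_max_left 1 ‖z‖
          have := le_max_right 1 ‖z‖
          linarith
      _ = 2 ^ M * (max 1 ‖z‖) ^ M := by rw [mul_pow]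
      _ ≤ _ := by
          gcongr
          rcases le_total 1 ‖z‖ with h | h
          · rw [max_eq_right h]; linarith
          · rw [max_eq_left h, one_pow]
            have : 0 ≤ ‖z‖ ^ M := by positivity
            linarith
  calc _ ≤ 2 ^ M * (1 + ‖z‖ ^ M) * ‖𝓕 (GG Pr b m s ν) z‖ := by gcongr
    _ = 2 ^ M * (‖𝓕 (GG Pr b m s ν) z‖ + ‖z‖ ^ M * ‖𝓕 (GG Pr b m s ν) z‖) := by ring
    _ ≤ _ := by gcongr
end

noncomputable section

lemma ex_add (a b y : ℝ) : ex (a + b) y = ex a y * ex b y := by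
  unfold ex; rw [← Complex.exp_add]; congr 1; push_cast; ring
lemma ex_sum {ι : Type*} (S : Finset ι) (a : ℝ) (y : ι → ℝ) : ex a (∑ i ∈ S, y i) = ∏ i ∈ S, ex a (y i) := by
  unfold ex
  rw [← Complex.exp_sum]; congr 1; push_cast
  rw [Finset.mul_sum, Finset.sum_mul]

/-- Fourier-localized pairing at `x` -/
def gI (F : ℝ → ℂ) (s v : ℤ) (x : ℝ) : ℂ := ∫ y, F y * pk s v x y
def Af (F : ℝ → ℂ) (s v : ℤ) (ξ : ℝ) : ℂ := 𝓕 F ξ * (xt (pw (-s) * ξ - v) : ℂ)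

variable {F : ℝ → ℂ}

lemma four_cont (hF : Integrable F) : Continuous (𝓕 F) :=
  VectorFourier.fourierIntegral_continuous Real.continuous_fourierChar (L := innerₗ ℝ) continuous_inner hF

lemma gI_eq (hF : Integrable F) (s v : ℤ) (x : ℝ) : gI F s v x = ∫ ξ, Af F s v ξ * ex x ξ := by
  have h1 : Integrable (axf s v x) :=
    (axf_smooth s v x).continuous.integrable_of_hasCompactSupport (axf_supp s v x)
  have h : ∫ ξ, 𝓕 F ξ • axf s v x ξ = ∫ y, F y • 𝓕 (axf s v x) y := by
    simpa using! (VectorFourier.integral_fourierIntegral_smul_eq_flip (L := innerₗ ℝ)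
      Real.continuous_fourierChar continuous_inner hF h1)
  unfold gI
  simp_rw [pk_coe]
  simp only [smul_eq_mul] at h
  rw [← h]
  congr 1; ext ξ
  unfold Af axf
  ring

lemma Af_cont (hF : Integrable F) (s v : ℤ) : Continuous (Af F s v) := by
  unfold Af
  exact (four_cont hF).mul (Complex.continuous_ofReal.comp (xt_smooth.continuous.comp (by fun_prop)))

lemma Af_supp (s v : ℤ) : HasCompactSupport (Af F s v) := by
  refine HasCompactSupport.intro (isCompact_closedBall (pw s * v : ℝ) (2 * pw s)) fun x hx => ?_
  have h0 : axf s v 0 x = 0 := by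
    apply axf_zero
    simpa [Real.dist_eq] using hx
  have h1 : axf s v 0 x = (xt (pw (-s) * x - v) : ℂ) := by simp [axf, ex]
  unfold Af
  rw [← h1, h0, mul_zero]

lemma Af_int (hF : Integrable F) (s v : ℤ) : Integrable (Af F s v) :=
  (Af_cont hF s v).integrable_of_hasCompactSupport (Af_supp s v)

lemma gI_inv (hF : Integrable F) (s v : ℤ) : gI F s v = 𝓕⁻ (Af F s v) := by
  ext x
  rw [gI_eq hF, Real.fourierInv_eq']
  congr 1; ext ξ
  rw [smul_eq_mul, mul_comm]
  congr 1
  unfold ex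
  congr 1
  simp
  ring

lemma gI_cont (hF : Integrable F) (s v : ℤ) : Continuous (gI F s v) := by
  have e : gI F s v = fun x => 𝓕 (Af F s v) (-x) := by
    rw [gI_inv hF]
    ext x
    rw [Real.fourierInv_eq_fourier_neg]
  rw [e]
  exact (four_cont (Af_int hF s v)).comp continuous_neg

lemma gI_int (hF : Integrable F) (s v : ℤ) : Integrable (gI F s v) := by
  have h1 : Integrable (fun t => pk s v 0 (-t)) := (pk s v 0).integrable.comp_neg
  have h2 := hF.integrable_convolution (L := ContinuousLinearMap.mul ℝ ℂ) h1
  convert h2 using 1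
  ext x
  rw [convolution_def]
  unfold gI
  congr 1; ext y
  simp only [ContinuousLinearMap.mul_apply']
  congr 1
  rw [pk_eq, pk_eq]
  congr 2
  · congr 1; ring
  · ring

lemma four_gI (hF : Integrable F) (s v : ℤ) : 𝓕 (gI F s v) = Af F s v := by
  have h2 : Integrable (𝓕 (Af F s v)) := by
    have : 𝓕 (Af F s v) = fun x => gI F s v (-x) := by
      ext x
      rw [gI_inv hF, Real.fourierInv_eq_fourier_neg, neg_neg]
    rw [this]
    exact (gI_int hF s v).comp_neg
  rw [gI_inv hF]
  exact (Af_cont hF s v).fourier_fourierInv_eq (Af_int hF s v) h2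

lemma four_eq_ex (g : ℝ → ℂ) (ξ : ℝ) : 𝓕 g (-ξ) = ∫ x, g x * ex x ξ := by
  rw [Real.fourier_real_eq_integral_exp_smul]
  congr 1; ext x
  rw [smul_eq_mul, mul_comm]
  congr 1
  unfold ex
  congr 1
  push_cast; ring

lemma ex_cont2 : Continuous (fun p : ℝ × ℝ => ex p.1 p.2) := by unfold ex; fun_prop

lemma phi_bound {d : ℕ} (A : Fin d → ℝ → ℂ) (hA : ∀ i, Integrable (A i)) (g : ℝ → ℂ) (hg : Integrable g)
    (t : Fin d → ℝ) :
    ‖∫ η : Fin d → ℝ, (∏ i, (A i (η i) * ex (t i) (η i))) * 𝓕 g (-(∑ i, η i))‖ ≤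
      ∫ x, (∏ i, ‖∫ ξ, A i ξ * ex (x + t i) ξ‖) * ‖g x‖ := by
  have hAt : ∀ i, Integrable (fun ξ => A i ξ * ex (t i) ξ) := fun i =>
    (hA i).mul_bdd (c := 1) (ex_cont _).aestronglyMeasurable (Filter.Eventually.of_forall fun ξ => (ex_norm _ _).le)
  have hP : Integrable (fun η : Fin d → ℝ => ∏ i, (A i (η i) * ex (t i) (η i))) :=
    Integrable.fintype_prod (f := fun i ξ => A i ξ * ex (t i) ξ) hAt
  have e1 : ∫ η : Fin d → ℝ, (∏ i, (A i (η i) * ex (t i) (η i))) * 𝓕 g (-(∑ i, η i)) =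
      ∫ η : Fin d → ℝ, ∫ x, (∏ i, (A i (η i) * ex (t i) (η i))) * g x * ex x (∑ i, η i) := by
    congr 1; ext η
    rw [four_eq_ex, ← integral_const_mul]
    congr 1; ext x; ring
  have hI : Integrable (Function.uncurry fun (η : Fin d → ℝ) (x : ℝ) =>
      (∏ i, (A i (η i) * ex (t i) (η i))) * g x * ex x (∑ i, η i)) (volume.prod volume) := by
    refine (hP.mul_prod hg).mul_bdd (c := 1) ?_ (Filter.Eventually.of_forall fun p => (ex_norm _ _).le)
    refine Continuous.aestronglyMeasurable ?_
    have hcs : Continuous (fun p : (Fin d → ℝ) × ℝ => (p.2, ∑ i, p.1 i)) := by fun_prop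
    exact ex_cont2.comp hcs
  rw [e1, integral_integral_swap hI]
  have e2 : ∀ x, ∫ η : Fin d → ℝ, (∏ i, (A i (η i) * ex (t i) (η i))) * g x * ex x (∑ i, η i) =
      (∏ i, ∫ ξ, A i ξ * ex (x + t i) ξ) * g x := by
    intro x
    rw [← integral_fintype_prod_volume_eq_prod (f := fun i ξ => A i ξ * ex (x + t i) ξ), ← integral_mul_const]
    congr 1; ext η
    rw [ex_sum, mul_right_comm, ← Finset.prod_mul_distrib]
    congr 1
    refine Finset.prod_congr rfl fun i _ => ?_
    rw [ex_add]; ring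
  simp_rw [e2]
  refine (norm_integral_le_integral_norm _).trans_eq ?_
  congr 1; ext x
  rw [norm_mul, norm_prod]

def zc {n : ℕ} (z : VV n) (i : Fin n) : ℝ := if h : (i : ℕ) < n - 1 then z ⟨i, h⟩ else 0

lemma zc_le {n : ℕ} (z : VV n) (i : Fin n) : |zc z i| ≤ ‖z‖ := by
  unfold zc
  split_ifs with h
  · exact PiLp.norm_apply_le z ⟨i, h⟩
  · simp

lemma hcut_xt {n : ℕ} (Pr : (Fin n → ℝ) →L[ℝ] (Fin n → ℝ)) (b : ℝ) (ν : Fin n → ℤ) (ξ : Fin n → ℝ) (i : Fin n)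
    (h : hcut Pr b ν ξ ≠ 0) : |ξ i - ν i| ≤ 1 := by
  by_contra hc
  push Not at hc
  apply h
  unfold hcut
  rw [Finset.prod_eq_zero (Finset.mem_univ i) (chi_zero hc.le), mul_zero]

lemma prodgam {d : ℕ} (A : Fin (d + 1) → ℝ → ℂ) (η : Fin d → ℝ) : ∏ i, A i (gammaParam (d + 1) η i) =
    (∏ i : Fin d, A i.castSucc (η i)) * A (Fin.last d) (-(∑ i, η i)) := by
  rw [Fin.prod_univ_castSucc]
  congr 1
  · refine Finset.prod_congr rfl fun i _ => ?_
    simp [gammaParam]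
  · simp [gammaParam]

lemma prodgam_int {d : ℕ} (A : Fin (d + 1) → ℝ → ℂ) (hA : ∀ i, Integrable (A i)) (hc : Continuous (A (Fin.last d)))
    {C : ℝ} (hC : ∀ x, ‖A (Fin.last d) x‖ ≤ C) :
    Integrable (fun η : Fin d → ℝ => ∏ i, A i (gammaParam (d + 1) η i)) := by
  have h1 : Integrable (fun η : Fin d → ℝ => ∏ i : Fin d, A i.castSucc (η i)) :=
    Integrable.fintype_prod (f := fun (i : Fin d) ξ => A i.castSucc ξ) (fun i => hA i.castSucc)
  have h2 := h1.mul_bdd (c := C) (g := fun η => A (Fin.last d) (-(∑ i, η i)))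
    (hc.comp (by fun_prop)).aestronglyMeasurable
    (Filter.Eventually.of_forall fun η => hC _)
  exact h2.congr (Filter.Eventually.of_forall fun η => (prodgam A η).symm)

lemma piece_formula {n : ℕ} (hn : 2 ≤ n) (Pr : (Fin n → ℝ) →L[ℝ] (Fin n → ℝ)) (b : ℝ) (m : (Fin n → ℝ) → ℂ)
    (s : ℤ) (ν : Fin n → ℤ) (hc : Continuous (GG Pr b m s ν)) (hi : Integrable (GG Pr b m s ν))
    (hfi : Integrable (𝓕 (GG Pr b m s ν))) (F : Fin n → ℝ → ℂ) (hF : ∀ i, Integrable (F i)) :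
    ∃ Φ : VV n → ℂ, Integrable (fun z => 𝓕 (GG Pr b m s ν) z * Φ z) ∧
      (∫ η : Fin (n - 1) → ℝ, m (gammaParam n η) * (hcut Pr b ν (pw (-s) • gammaParam n η) : ℂ) *
        ∏ i, 𝓕 (F i) (gammaParam n η i)) = ∫ z, 𝓕 (GG Pr b m s ν) z * Φ z ∧
      ∀ z, ‖Φ z‖ ≤ ∫ x, ∏ i, ‖gI (F i) s (ν i) (x + pw (-s) * zc z i)‖ := by
  obtain ⟨d, rfl⟩ : ∃ d, n = d + 1 := ⟨n - 1, by omega⟩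
  change Fin (d + 1) → ℝ → ℂ at F
  set A : Fin (d + 1) → ℝ → ℂ := fun i => Af (F i) s (ν i) with hA
  set PP : (Fin d → ℝ) → ℂ := fun η => ∏ i, A i (gammaParam (d + 1) η i) with hPP
  have ePP : ∀ η, PP η = (∏ i : Fin d, A i.castSucc (η i)) * A (Fin.last d) (-(∑ i, η i)) :=
    fun η => prodgam A η
  have hPPi : Integrable PP := by
    obtain ⟨C, hC⟩ := (Af_cont (hF (Fin.last d)) s (ν (Fin.last d))).bounded_above_of_compact_support (Af_supp s _)
    exact prodgam_int A (fun i => Af_int (hF _) _ _) (Af_cont (hF (Fin.last d)) s (ν (Fin.last d))) hC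
  set uu : (Fin d → ℝ) → VV (d + 1) := fun η => WithLp.toLp 2 (pw (-s) • η) with huu
  have huuc : Continuous uu := by
    simp only [huu]
    exact (PiLp.continuous_toLp 2 _).comp (by fun_prop)
  have e1 : ∀ η : Fin d → ℝ, m (gammaParam (d + 1) η) * (hcut Pr b ν (pw (-s) • gammaParam (d + 1) η) : ℂ) *
        ∏ i, 𝓕 (F i) (gammaParam (d + 1) η i) = GG Pr b m s ν (uu η) * PP η := by
    intro η
    have hg : gLin (d + 1) (uu η) = pw (-s) • gammaParam (d + 1) η := by
      rw [gLin_apply]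
      exact gammaParam_smul (d + 1) _ _
    unfold GG
    rw [hg, smul_smul, pw_mul_neg, one_smul]
    by_cases h0 : hcut Pr b ν (pw (-s) • gammaParam (d + 1) η) = 0
    · rw [h0]; simp
    · congr 1
      refine Finset.prod_congr rfl fun i _ => ?_
      have := hcut_xt Pr b ν _ i h0
      simp only [hA, Af]
      rw [xt_one (by simpa using this), ofReal_one, mul_one]
  set ee : VV (d + 1) → (Fin d → ℝ) → ℂ := fun z η => ∏ i : Fin d, ex (pw (-s) * z i) (η i) with hee
  have heen : ∀ z η, ‖ee z η‖ = 1 := by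
    intro z η
    simp only [hee, norm_prod, ex_norm, Finset.prod_const_one]
  have heec : Continuous (fun p : (Fin d → ℝ) × VV (d + 1) => ee p.2 p.1) := by
    simp only [hee]
    refine continuous_finsetProd _ fun i _ => ex_cont2.comp (Continuous.prodMk ?_ (by fun_prop))
    exact continuous_const.mul ((EuclideanSpace.proj (𝕜 := ℝ) (i : Fin (d + 1 - 1))).continuous.comp continuous_snd)
  have e2 : ∀ η, GG Pr b m s ν (uu η) = ∫ z, 𝓕 (GG Pr b m s ν) z * ee z η := by
    intro η
    have h := congrFun (hc.fourierInv_fourier_eq hi hfi) (uu η)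
    rw [Real.fourierInv_eq'] at h
    rw [← h]
    congr 1; ext z
    rw [smul_eq_mul, mul_comm]
    congr 1
    simp only [hee, ex]
    rw [← Complex.exp_sum]
    congr 1
    rw [PiLp.inner_apply]
    simp only [huu]
    push_cast
    rw [Finset.mul_sum, Finset.sum_mul]
    refine Finset.sum_congr rfl fun i _ => ?_
    simp
    ring
  have hI : Integrable (Function.uncurry fun (η : Fin d → ℝ) (z : VV (d + 1)) =>
      PP η * 𝓕 (GG Pr b m s ν) z * ee z η) (volume.prod volume) :=
    (hPPi.mul_prod hfi).mul_bdd (c := 1) heec.aestronglyMeasurable (Filter.Eventually.of_forall fun p => (heen _ _).le)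
  have e4 : ∀ z, ∫ η, PP η * 𝓕 (GG Pr b m s ν) z * ee z η = 𝓕 (GG Pr b m s ν) z * ∫ η, PP η * ee z η := by
    intro z
    rw [← integral_const_mul]
    congr 1; ext η; ring
  refine ⟨fun z => ∫ η, PP η * ee z η, ?_, ?_, fun z => ?_⟩
  · have := hI.integral_prod_right
    refine this.congr (Filter.Eventually.of_forall fun z => ?_)
    exact e4 z
  · rw [← integral_congr_ae (Filter.Eventually.of_forall e4), ← integral_integral_swap hI]
    refine integral_congr_ae (Filter.Eventually.of_forall fun η => ?_)
    refine (e1 η).trans ?_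
    rw [e2, mul_comm, ← integral_const_mul]
    congr 1; ext z; ring
  · have h := phi_bound (fun i : Fin d => A i.castSucc) (fun i => Af_int (hF _) _ _)
      (gI (F (Fin.last d)) s (ν (Fin.last d))) (gI_int (hF _) _ _) (fun i => pw (-s) * z i)
    have e5 : ∫ η, PP η * ee z η = ∫ η : Fin d → ℝ, (∏ i, (A i.castSucc (η i) * ex (pw (-s) * z i) (η i))) *
        𝓕 (gI (F (Fin.last d)) s (ν (Fin.last d))) (-(∑ i, η i)) := by
      congr 1; ext η
      rw [ePP, four_gI (hF _), Finset.prod_mul_distrib]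
      simp only [hee]
      ring
    simp only []
    rw [e5]
    refine h.trans_eq ?_
    congr 1; ext x
    rw [Fin.prod_univ_castSucc]
    congr 1
    · refine Finset.prod_congr rfl fun i _ => ?_
      rw [gI_eq (hF _)]
      simp [zc, hA]
    · simp [zc]
end

noncomputable section

variable {n : ℕ}

lemma exists_pw_gt (c : ℝ) : ∃ L : ℕ, 2 ≤ L ∧ c < pw (L : ℤ) := by
  obtain ⟨L, hL⟩ := pow_unbounded_of_one_lt c (one_lt_two)
  refine ⟨L + 2, by omega, hL.trans_le ?_⟩
  rw [pw_natCast]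
  exact pow_le_pow_right₀ (by norm_num) (by omega)

/-- removing sparseness from `thmB` -/
lemma thmB2 {k : ℕ} (hk : 1 ≤ k) (hkn : 2 * k < n) {C2 : ℤ} (C3 : ℤ) (hC2 : 7 ≤ C2)
    {a : Fin n → ℝ} (ha1 : ∀ i, a i < 1) (hasum : ∑ i, a i = 1) (j : Fin n) (haj : a j < 0)
    (hapos : ∀ i, i ≠ j → 0 ≤ a i)
    (hreg : ∀ S : Finset (Fin n), S.Nonempty → ∑ i ∈ S, a i < ((n : ℝ) - 2 * k + S.card) / 2) :
    ∃ C : ℝ, 0 ≤ C ∧ ∀ (E : Fin n → Set ℝ), (∀ i, MeasurableSet (E i)) → (∀ i, volume (E i) ≠ 0) →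
      (∀ i, volume (E i) < ⊤) → ∀ F : Fin n → ℝ → ℂ, (∀ i, Measurable (F i)) →
      (∀ i x, ‖F i x‖ ≤ 1) → (∀ i x, x ∉ E i → F i x = 0) → (∀ x ∈ Om E j, F j x = 0) →
      ∀ (φ : Fin n → Tile → ℝ → ℂ), (∀ i, WP (n + 4) (C2 + 1) (φ i)) →
      ∀ (ℙ : Finset (MT n)) (ext : Finset (Fin n) → (Fin n → ℝ) → Fin n → ℝ),
      Geo n k C2 C3 ℙ ext →
      ∑ P ∈ ℙ, len P.I * ∏ i, wc (F i) (φ i) (P.t i) ≤ C * ∏ i, (volume (E i)).toReal ^ a i := by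
  obtain ⟨C, hC, h⟩ := thmB hk hkn C3 hC2 ha1 hasum j haj hapos hreg
  obtain ⟨L, hL2, hL⟩ := exists_pw_gt ((C2 : ℝ) + 1)
  set cls : Finset (ℤ × (Fin n → ℤ)) := (Finset.Ico 0 (L : ℤ)) ×ˢ (Fintype.piFinset fun _ => Finset.Ico 0 16) with hcls
  refine ⟨cls.card * C, by positivity, fun E hE h0 hf F hFm hF1 hFE hFO φ hφ ℙ ext hG => ?_⟩
  set cl : MT n → ℤ × (Fin n → ℤ) := fun P => (P.I.1 % L, fun i => P.v i % 16) with hcl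
  have hmaps : ∀ P ∈ ℙ, cl P ∈ cls := by
    intro P _
    simp only [hcl, hcls, Finset.mem_product, Fintype.mem_piFinset, Finset.mem_Ico]
    have hLp : (0:ℤ) < L := by omega
    exact ⟨⟨Int.emod_nonneg _ hLp.ne', Int.emod_lt_of_pos _ hLp⟩, fun i =>
      ⟨Int.emod_nonneg _ (by norm_num), Int.emod_lt_of_pos _ (by norm_num)⟩⟩
  rw [← Finset.sum_fiberwise_of_maps_to hmaps]
  calc _ ≤ ∑ _c ∈ cls, C * ∏ i, (volume (E i)).toReal ^ a i := by
        refine Finset.sum_le_sum fun c _ => ?_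
        refine h E hE h0 hf F hFm hF1 hFE hFO φ hφ _ ext L c.1 c.2 (hG.mono (Finset.filter_subset _ _))
          (by exact_mod_cast hL2) hL ?_
        intro i P hP
        have hP2 := (Finset.mem_filter.1 hP).2
        rw [← hP2]
        exact ⟨Int.dvd_self_sub_emod, Int.dvd_self_sub_emod⟩
    _ = _ := by rw [Finset.sum_const, nsmul_eq_mul, mul_assoc]

lemma fixz (F : Fin n → ℝ → ℂ) (hF : ∀ i, Integrable (F i)) {N : ℕ} {K C0 : ℝ} (hC0 : 0 < C0)
    (hwp : ∀ (Z : ℝ) (u : Tile → ℝ), 0 ≤ Z → (∀ Q, |u Q - cen Q.I| ≤ len Q.I * Z) →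
      WP N K (fun Q y => ((C0 * (2 * bw Z) ^ N : ℝ) : ℂ)⁻¹ * pk Q.I.1 Q.v (u Q) y))
    (z : VV n) (ℱ : Finset (ℤ × (Fin n → ℤ))) {D : ℝ}
    (hD : ∀ φ : Fin n → Tile → ℝ → ℂ, (∀ i, WP N K (φ i)) → ∀ ℙ : Finset (MT n), (∀ P ∈ ℙ, (P.I.1, P.v) ∈ ℱ) →
      ∑ P ∈ ℙ, len P.I * ∏ i, wc (F i) (φ i) (P.t i) ≤ D) :
    ∑ q ∈ ℱ, ∫ x, ∏ i, ‖gI (F i) q.1 (q.2 i) (x + pw (-q.1) * zc z i)‖ ≤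
      (C0 * (2 * bw (1 + ‖z‖)) ^ N) ^ n * D := by
  set A : ℝ := C0 * (2 * bw (1 + ‖z‖)) ^ N with hA
  have hA0 : 0 < A := by have := bw_pos (1 + ‖z‖); positivity
  have hmax : ∀ (i : Fin n) (Q : Tile), ∃ x ∈ Set.Icc (Q.I.2 * len Q.I) ((Q.I.2 + 1) * len Q.I),
      ∀ y ∈ Set.Icc (Q.I.2 * len Q.I) ((Q.I.2 + 1) * len Q.I),
        ‖gI (F i) Q.I.1 Q.v (y + pw (-Q.I.1) * zc z i)‖ ≤ ‖gI (F i) Q.I.1 Q.v (x + pw (-Q.I.1) * zc z i)‖ := by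
    intro i Q
    have hl := len_pos Q.I
    obtain ⟨x, hx, hx2⟩ := isCompact_Icc.exists_isMaxOn (s := Set.Icc (Q.I.2 * len Q.I) ((Q.I.2 + 1) * len Q.I))
      (Set.nonempty_Icc.2 (by nlinarith))
      (f := fun y => ‖gI (F i) Q.I.1 Q.v (y + pw (-Q.I.1) * zc z i)‖)
      (((gI_cont (hF i) _ _).comp (by fun_prop)).norm.continuousOn)
    exact ⟨x, hx, fun y hy => hx2 hy⟩
  choose X hX hXm using hmax
  set u : Fin n → Tile → ℝ := fun i Q => X i Q + pw (-Q.I.1) * zc z i with hu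
  set φ : Fin n → Tile → ℝ → ℂ := fun i Q y => ((A : ℝ) : ℂ)⁻¹ * pk Q.I.1 Q.v (u i Q) y with hφd
  have hφ : ∀ i, WP N K (φ i) := by
    intro i
    refine hwp (1 + ‖z‖) (u i) (by positivity) fun Q => ?_
    have h1 := hX i Q
    have h2 := cen_mem Q.I
    unfold dI at h2
    have h3 : |X i Q - cen Q.I| ≤ len Q.I := by
      rw [abs_le]
      constructor <;> nlinarith [h1.1, h1.2, h2.1, h2.2]
    have h4 : |pw (-Q.I.1) * zc z i| ≤ len Q.I * ‖z‖ := by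
      rw [abs_mul, abs_of_pos (pw_pos _)]
      exact mul_le_mul_of_nonneg_left (zc_le z i) (pw_pos _).le
    have : u i Q - cen Q.I = (X i Q - cen Q.I) + pw (-Q.I.1) * zc z i := by simp only [hu]; ring
    rw [this]
    refine (abs_add_le _ _).trans ?_
    linarith
  have hwc : ∀ i Q, ‖gI (F i) Q.I.1 Q.v (u i Q)‖ = A * wc (F i) (φ i) Q := by
    intro i Q
    have e : wu (F i) (φ i) Q = ((A : ℝ) : ℂ)⁻¹ * gI (F i) Q.I.1 Q.v (u i Q) := by
      unfold wu gI
      rw [← integral_const_mul]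
      congr 1; ext y
      simp only [hφd]; ring
    unfold wc
    rw [e, norm_mul, norm_inv, Complex.norm_real, Real.norm_of_nonneg hA0.le, mul_inv_cancel_left₀ hA0.ne']
  set aq : (ℤ × (Fin n → ℤ)) → ℕ → ℝ := fun q T => ∑ p ∈ Finset.Ico (-(T:ℤ)) T,
    A ^ n * (len (q.1, p) * ∏ i, wc (F i) (φ i) ⟨(q.1, p), q.2 i⟩) with haq
  have hJ : ∀ q : ℤ × (Fin n → ℤ), ∃ J : ℕ → ℝ, Filter.Tendsto J Filter.atTop
      (nhds (∫ x, ∏ i, ‖gI (F i) q.1 (q.2 i) (x + pw (-q.1) * zc z i)‖)) ∧ ∀ T, J T ≤ aq q T := by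
    intro q
    have haq0 : ∀ T, 0 ≤ aq q T := fun T => Finset.sum_nonneg fun p _ =>
      mul_nonneg (by positivity) (mul_nonneg (len_pos _).le (Finset.prod_nonneg fun i _ => wc_nonneg _ _ _))
    set h : ℝ → ℝ := fun x => ∏ i, ‖gI (F i) q.1 (q.2 i) (x + pw (-q.1) * zc z i)‖ with hh
    by_cases hIntg : Integrable h
    · set U : ℕ → Set ℝ := fun T => ⋃ p ∈ Finset.Ico (-(T:ℤ)) T, dI (q.1, p) with hU
      have hcov : AECover volume Filter.atTop U := by
        constructor
        · refine Filter.Eventually.of_forall fun x => ?_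
          filter_upwards [Filter.eventually_ge_atTop (⌊x * pw q.1⌋.natAbs + 1)] with T hT
          simp only [hU, Set.mem_iUnion]
          refine ⟨⌊x * pw q.1⌋, ?_, ?_⟩
          · rw [Finset.mem_Ico]; omega
          · exact mem_dI.2 rfl
        · intro T
          exact Finset.measurableSet_biUnion _ fun p _ => dI_meas _
      refine ⟨fun T => ∫ x in U T, h x, hcov.integral_tendsto_of_countably_generated hIntg, fun T => ?_⟩
      simp only [hU]
      rw [integral_biUnion_finset _ (fun p _ => dI_meas _) ?_ (fun p _ => hIntg.integrableOn)]
      · refine Finset.sum_le_sum fun p _ => ?_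
        have hb := norm_setIntegral_le_of_norm_le_const (μ := volume) (s := dI (q.1, p)) (f := h)
          (C := A ^ n * ∏ i, wc (F i) (φ i) ⟨(q.1, p), q.2 i⟩) (by rw [dI_vol]; exact ENNReal.ofReal_lt_top) (by
            intro x hx
            simp only [hh]
            rw [Real.norm_of_nonneg (Finset.prod_nonneg fun _ _ => norm_nonneg _)]
            have : A ^ n * ∏ i, wc (F i) (φ i) ⟨(q.1, p), q.2 i⟩ = ∏ i, (A * wc (F i) (φ i) ⟨(q.1, p), q.2 i⟩) := by
              rw [Finset.prod_mul_distrib, Finset.prod_const, Finset.card_univ, Fintype.card_fin]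
            rw [this]
            refine Finset.prod_le_prod (fun _ _ => norm_nonneg _) fun i _ => ?_
            rw [← hwc]
            exact hXm i ⟨(q.1, p), q.2 i⟩ x (Set.Ico_subset_Icc_self hx))
        rw [dI_vol_real] at hb
        refine (le_abs_self _).trans (hb.trans_eq ?_)
        ring
      · intro p _ p' _ hne
        rw [Function.onFun, Set.disjoint_left]
        intro x hx hx'
        rw [mem_dI] at hx hx'
        exact hne (hx.symm.trans hx')
    · refine ⟨fun _ => 0, ?_, haq0⟩
      rw [integral_undef hIntg]
      exact tendsto_const_nhds
  choose J hJt hJa using hJ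
  refine le_of_tendsto' (tendsto_finsetSum ℱ fun q _ => hJt q) fun T => ?_
  refine (Finset.sum_le_sum fun q _ => hJa q T).trans ?_
  set mk : (ℤ × (Fin n → ℤ)) × ℤ → MT n := fun r => ⟨(r.1.1, r.2), r.1.2⟩ with hmk
  have hinj : Function.Injective mk := by
    intro r r' hr
    simp only [hmk, MT.mk.injEq, Prod.mk.injEq] at hr
    obtain ⟨⟨h1, h2⟩, h3⟩ := hr
    exact Prod.ext (Prod.ext h1 h3) h2
  have hs := hD φ hφ ((ℱ ×ˢ Finset.Ico (-(T:ℤ)) T).image mk) (by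
    intro P hP
    obtain ⟨r, hr, rfl⟩ := Finset.mem_image.1 hP
    exact (Finset.mem_product.1 hr).1)
  rw [Finset.sum_image (fun _ _ _ _ h => hinj h), Finset.sum_product] at hs
  calc _ = A ^ n * ∑ q ∈ ℱ, ∑ p ∈ Finset.Ico (-(T:ℤ)) T,
        (len (q.1, p) * ∏ i, wc (F i) (φ i) ⟨(q.1, p), q.2 i⟩) := by
        simp only [haq, Finset.mul_sum]
    _ ≤ _ := mul_le_mul_of_nonneg_left hs (by positivity)

lemma one_add_norm_int (hn : 2 ≤ n) : Integrable (fun z : VV n => ((1 + ‖z‖) ^ n)⁻¹) := by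
  have h := integrable_one_add_norm (E := VV n) (μ := volume) (r := (n : ℝ)) (by
    rw [finrank_euclideanSpace, Fintype.card_fin]
    exact_mod_cast (by omega : n - 1 < n))
  refine h.congr (Filter.Eventually.of_forall fun z => ?_)
  simp only
  rw [Real.rpow_neg (by positivity), Real.rpow_natCast]

lemma GG_four_int (hn : 2 ≤ n) {M : ℕ} (hM : n ≤ M) {CG : ℝ} {G : VV n → ℂ} (hGi : Integrable G)
    (hd : ∀ z, (1 + ‖z‖) ^ M * ‖𝓕 G z‖ ≤ CG) : Integrable (𝓕 G) := by
  have hc : Continuous (𝓕 G) :=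
    VectorFourier.fourierIntegral_continuous Real.continuous_fourierChar (L := innerₗ (VV n)) continuous_inner hGi
  refine ((one_add_norm_int hn).const_mul CG).mono' hc.aestronglyMeasurable (Filter.Eventually.of_forall fun z => ?_)
  rw [← div_eq_mul_inv, le_div_iff₀ (by positivity), mul_comm]
  refine le_trans (mul_le_mul_of_nonneg_right ?_ (norm_nonneg _)) (hd z)
  exact pow_le_pow_right₀ (by linarith [norm_nonneg z]) hM

def piece (Pr : (Fin n → ℝ) →L[ℝ] (Fin n → ℝ)) (b : ℝ) (m : (Fin n → ℝ) → ℂ) (F : Fin n → ℝ → ℂ)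
    (q : ℤ × (Fin n → ℤ)) (η : Fin (n - 1) → ℝ) : ℂ :=
  m (gammaParam n η) * (hcut Pr b q.2 (pw (-q.1) • gammaParam n η) : ℂ) * ∏ i, 𝓕 (F i) (gammaParam n η i)

lemma sum_pieces (hn : 2 ≤ n) {Pr : (Fin n → ℝ) →L[ℝ] (Fin n → ℝ)} {b : ℝ}
    {N M : ℕ} (hM : M = 2 * N * n + n) {CG : ℝ} (hCG : 0 ≤ CG) {m : (Fin n → ℝ) → ℂ}
    (hG : ∀ s ν, Continuous (GG Pr b m s ν) ∧ Integrable (GG Pr b m s ν) ∧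
      ∀ z, (1 + ‖z‖) ^ M * ‖𝓕 (GG Pr b m s ν) z‖ ≤ CG)
    (F : Fin n → ℝ → ℂ) (hF : ∀ i, Integrable (F i)) {K C0 : ℝ} (hC0 : 0 < C0)
    (hwp : ∀ (Z : ℝ) (u : Tile → ℝ), 0 ≤ Z → (∀ Q, |u Q - cen Q.I| ≤ len Q.I * Z) →
      WP N K (fun Q y => ((C0 * (2 * bw Z) ^ N : ℝ) : ℂ)⁻¹ * pk Q.I.1 Q.v (u Q) y))
    (ℱ : Finset (ℤ × (Fin n → ℤ))) {D : ℝ} (hD0 : 0 ≤ D)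
    (hD : ∀ φ : Fin n → Tile → ℝ → ℂ, (∀ i, WP N K (φ i)) → ∀ ℙ : Finset (MT n), (∀ P ∈ ℙ, (P.I.1, P.v) ∈ ℱ) →
      ∑ P ∈ ℙ, len P.I * ∏ i, wc (F i) (φ i) (P.t i) ≤ D) :
    ‖∑ q ∈ ℱ, ∫ η, piece Pr b m F q η‖ ≤
      CG * (C0 * 4 ^ N) ^ n * (∫ z : VV n, ((1 + ‖z‖) ^ n)⁻¹) * D := by
  have hnM : n ≤ M := by rw [hM]; exact Nat.le_add_left _ _
  have hex := fun q : ℤ × (Fin n → ℤ) => piece_formula hn Pr b m q.1 q.2 (hG q.1 q.2).1 (hG q.1 q.2).2.1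
    (GG_four_int hn hnM (hG q.1 q.2).2.1 (hG q.1 q.2).2.2) F hF
  choose Φ hΦi hΦe hΦb using hex
  have e : ∑ q ∈ ℱ, ∫ η, piece Pr b m F q η = ∫ z, ∑ q ∈ ℱ, 𝓕 (GG Pr b m q.1 q.2) z * Φ q z := by
    rw [integral_finsetSum _ (fun q _ => hΦi q)]
    exact Finset.sum_congr rfl fun q _ => hΦe q
  rw [e]
  have hb : ∀ z : VV n, ‖∑ q ∈ ℱ, 𝓕 (GG Pr b m q.1 q.2) z * Φ q z‖ ≤
      CG * (C0 * 4 ^ N) ^ n * D * ((1 + ‖z‖) ^ n)⁻¹ := by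
    intro z
    have hz1 : 0 < 1 + ‖z‖ := by positivity
    have hA : (C0 * (2 * bw (1 + ‖z‖)) ^ N) ^ n ≤ (C0 * 4 ^ N) ^ n * (1 + ‖z‖) ^ (2 * N * n) := by
      have h1 : 2 * bw (1 + ‖z‖) ≤ 4 * (1 + ‖z‖) ^ 2 := by
        unfold bw
        nlinarith [norm_nonneg z]
      have h0 := bw_pos (1 + ‖z‖)
      calc (C0 * (2 * bw (1 + ‖z‖)) ^ N) ^ n ≤ (C0 * (4 * (1 + ‖z‖) ^ 2) ^ N) ^ n := by gcongr
        _ = _ := by rw [mul_pow (4:ℝ), ← pow_mul, ← mul_assoc, mul_pow, ← pow_mul]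
    have hf := fixz F hF hC0 hwp z ℱ hD
    calc _ ≤ ∑ q ∈ ℱ, ‖𝓕 (GG Pr b m q.1 q.2) z * Φ q z‖ := norm_sum_le _ _
      _ ≤ ∑ q ∈ ℱ, (CG / (1 + ‖z‖) ^ M) * ∫ x, ∏ i, ‖gI (F i) q.1 (q.2 i) (x + pw (-q.1) * zc z i)‖ := by
          refine Finset.sum_le_sum fun q _ => ?_
          rw [norm_mul]
          refine mul_le_mul ?_ (hΦb q z) (norm_nonneg _) (by positivity)
          rw [le_div_iff₀ (by positivity), mul_comm]
          exact (hG q.1 q.2).2.2 z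
      _ = (CG / (1 + ‖z‖) ^ M) * ∑ q ∈ ℱ, ∫ x, ∏ i, ‖gI (F i) q.1 (q.2 i) (x + pw (-q.1) * zc z i)‖ := by
          rw [Finset.mul_sum]
      _ ≤ (CG / (1 + ‖z‖) ^ M) * (((C0 * 4 ^ N) ^ n * (1 + ‖z‖) ^ (2 * N * n)) * D) := by
          refine mul_le_mul_of_nonneg_left (hf.trans ?_) (by positivity)
          exact mul_le_mul_of_nonneg_right hA hD0
      _ = _ := by
          rw [hM, pow_add]
          field_simp
  refine (norm_integral_le_of_norm_le ((one_add_norm_int hn).const_mul _) (Filter.Eventually.of_forall hb)).trans_eq ?_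
  rw [integral_const_mul]
  ring
end

noncomputable section

variable {n : ℕ}

lemma tele_Icc (g : ℤ → ℝ) (V : ℕ) :
    ∑ v ∈ Finset.Icc (-(V:ℤ)) V, (g v - g (v + 1)) = g (-(V:ℤ)) - g (V + 1) := by
  induction V with
  | zero => simp
  | succ V ih =>
    have e : Finset.Icc (-((V + 1 : ℕ):ℤ)) ((V + 1 : ℕ):ℤ) =
        insert ((V:ℤ) + 1) (insert (-(V:ℤ) - 1) (Finset.Icc (-(V:ℤ)) V)) := by
      ext x
      simp only [Finset.mem_insert, Finset.mem_Icc]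
      push_cast
      omega
    rw [e, Finset.sum_insert, Finset.sum_insert, ih]
    · push_cast
      rw [show -(V:ℤ) - 1 + 1 = -V by ring, show -((V:ℤ) + 1) = -V - 1 by ring]
      ring
    · simp
    · simp only [Finset.mem_insert, Finset.mem_Icc]
      omega

lemma chi_sum (x : ℝ) (V : ℕ) :
    ∑ v ∈ Finset.Icc (-(V:ℤ)) V, chi (x - v) = smoothTransition (x + V + 1) - smoothTransition (x - V) := by
  have h := tele_Icc (fun v => smoothTransition (x - v + 1)) V
  push_cast at h
  rw [show x + V + 1 = x - -(V:ℝ) + 1 by ring, show x - (V:ℝ) = x - (V + 1) + 1 by ring, ← h]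
  refine Finset.sum_congr rfl fun v _ => ?_
  unfold chi
  congr 2
  ring

lemma chi_sum_nonneg (x : ℝ) (V : ℕ) : 0 ≤ ∑ v ∈ Finset.Icc (-(V:ℤ)) V, chi (x - v) :=
  Finset.sum_nonneg fun _ _ => chi_nonneg _

lemma chi_sum_le (x : ℝ) (V : ℕ) : ∑ v ∈ Finset.Icc (-(V:ℤ)) V, chi (x - v) ≤ 1 := by
  rw [chi_sum]
  linarith [smoothTransition.le_one (x + V + 1), smoothTransition.nonneg (x - V)]

lemma chi_sum_one {x : ℝ} {V : ℕ} (h : |x| ≤ V) : ∑ v ∈ Finset.Icc (-(V:ℤ)) V, chi (x - v) = 1 := by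
  rw [abs_le] at h
  rw [chi_sum, smoothTransition.one_of_one_le (by linarith [h.1]),
    smoothTransition.zero_of_nonpos (by linarith [h.2]), sub_zero]

lemma tht_sum (b t : ℝ) (T : ℕ) :
    ∑ s ∈ Finset.Icc (-(T:ℤ)) T, tht b (pw (-s) ^ 2 * t) =
      smoothTransition (pw T ^ 2 * t - b) - smoothTransition (pw (-(T + 1)) ^ 2 * t - b) := by
  have h := tele_Icc (fun s => smoothTransition (pw (-s) ^ 2 * t - b)) T
  simp only [neg_neg] at h
  rw [← h]
  refine Finset.sum_congr rfl fun s _ => ?_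
  unfold tht
  congr 3
  have : pw (-(s + 1)) = pw (-s) / 2 := by
    rw [neg_add, pw_add, show pw (-1) = 1 / 2 by norm_num [pw]]
    ring
  rw [this]
  ring

lemma tht_sum_nonneg (b : ℝ) {t : ℝ} (ht : 0 ≤ t) (T : ℕ) :
    0 ≤ ∑ s ∈ Finset.Icc (-(T:ℤ)) T, tht b (pw (-s) ^ 2 * t) :=
  Finset.sum_nonneg fun _ _ => tht_nonneg _ (by positivity)

lemma tht_sum_le (b t : ℝ) (T : ℕ) :
    ∑ s ∈ Finset.Icc (-(T:ℤ)) T, tht b (pw (-s) ^ 2 * t) ≤ 1 := by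
  rw [tht_sum]
  linarith [smoothTransition.le_one (pw T ^ 2 * t - b), smoothTransition.nonneg (pw (-(T + 1)) ^ 2 * t - b)]

lemma tht_sum_one {b t : ℝ} (hb : 0 < b) (ht : 0 < t) :
    ∀ᶠ T : ℕ in Filter.atTop, ∑ s ∈ Finset.Icc (-(T:ℤ)) T, tht b (pw (-s) ^ 2 * t) = 1 := by
  have h1 : Filter.Tendsto (fun T : ℕ => (4:ℝ) ^ T) Filter.atTop Filter.atTop :=
    tendsto_pow_atTop_atTop_of_one_lt (by norm_num)
  filter_upwards [h1.eventually_ge_atTop ((1 + b) / t), h1.eventually_ge_atTop (t / b)] with T h2 h3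
  rw [div_le_iff₀ ht] at h2
  rw [div_le_iff₀ hb] at h3
  have e1 : pw (T:ℤ) ^ 2 = 4 ^ T := by
    rw [pw_natCast, ← pow_mul, mul_comm, pow_mul]; norm_num
  have e2 : pw (-((T:ℤ) + 1)) ^ 2 = (4 * 4 ^ T)⁻¹ := by
    refine eq_inv_of_mul_eq_one_left ?_
    rw [← e1]
    have h := pw_neg_mul ((T:ℤ) + 1)
    have e : pw ((T:ℤ) + 1) = 2 * pw T := by rw [pw_add, show pw 1 = 2 by norm_num [pw]]; ring
    rw [e] at h
    calc _ = (pw (-((T:ℤ) + 1)) * (2 * pw T)) ^ 2 := by ring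
      _ = 1 := by rw [h, one_pow]
  rw [tht_sum, e1, e2, smoothTransition.one_of_one_le (by linarith), smoothTransition.zero_of_nonpos, sub_zero]
  rw [sub_nonpos, inv_mul_le_iff₀ (by positivity)]
  nlinarith [pow_pos (show (0:ℝ) < 4 by norm_num) T]

/-- the truncated index box -/
def qbox (n T : ℕ) : Finset (ℤ × (Fin n → ℤ)) :=
  Finset.Icc (-(T:ℤ)) T ×ˢ Fintype.piFinset fun _ => Finset.Icc (-((4 ^ T : ℕ):ℤ)) (4 ^ T : ℕ)

/-- the truncated partition of unity -/
def WT (Pr : (Fin n → ℝ) →L[ℝ] (Fin n → ℝ)) (b : ℝ) (T : ℕ) (ξ : Fin n → ℝ) : ℝ :=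
  ∑ q ∈ qbox n T, hcut Pr b q.2 (pw (-q.1) • ξ)

lemma WT_eq (Pr : (Fin n → ℝ) →L[ℝ] (Fin n → ℝ)) (b : ℝ) (T : ℕ) (ξ : Fin n → ℝ) :
    WT Pr b T ξ = ∑ s ∈ Finset.Icc (-(T:ℤ)) T, tht b (pw (-s) ^ 2 * qf (Pr ξ)) *
      ∏ i, ∑ v ∈ Finset.Icc (-((4 ^ T : ℕ):ℤ)) (4 ^ T : ℕ), chi (pw (-s) * ξ i - v) := by
  unfold WT qbox
  rw [Finset.sum_product]
  refine Finset.sum_congr rfl fun s _ => ?_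
  rw [Finset.prod_univ_sum, Finset.mul_sum]
  refine Finset.sum_congr rfl fun v _ => ?_
  simp only [hcut, map_smul, qf_smul, Pi.smul_apply, smul_eq_mul]

lemma WT_nonneg (Pr : (Fin n → ℝ) →L[ℝ] (Fin n → ℝ)) (b : ℝ) (T : ℕ) (ξ : Fin n → ℝ) : 0 ≤ WT Pr b T ξ := by
  rw [WT_eq]
  refine Finset.sum_nonneg fun s _ => mul_nonneg (tht_nonneg _ ?_) (Finset.prod_nonneg fun i _ => chi_sum_nonneg _ _)
  have := qf_nonneg (Pr ξ)
  positivity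

lemma WT_le (Pr : (Fin n → ℝ) →L[ℝ] (Fin n → ℝ)) (b : ℝ) (T : ℕ) (ξ : Fin n → ℝ) : WT Pr b T ξ ≤ 1 := by
  rw [WT_eq]
  refine le_trans (Finset.sum_le_sum fun s _ => ?_) (tht_sum_le b (qf (Pr ξ)) T)
  refine mul_le_of_le_one_right (tht_nonneg _ (by have := qf_nonneg (Pr ξ); positivity)) ?_
  exact Finset.prod_le_one (fun i _ => chi_sum_nonneg _ _) fun i _ => chi_sum_le _ _

lemma WT_one {Pr : (Fin n → ℝ) →L[ℝ] (Fin n → ℝ)} {b : ℝ} (hb : 0 < b) {ξ : Fin n → ℝ} (h : 0 < qf (Pr ξ)) :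
    ∀ᶠ T : ℕ in Filter.atTop, WT Pr b T ξ = 1 := by
  have h1 : Filter.Tendsto (fun T : ℕ => (2:ℝ) ^ T) Filter.atTop Filter.atTop :=
    tendsto_pow_atTop_atTop_of_one_lt (by norm_num)
  filter_upwards [tht_sum_one hb h, h1.eventually_ge_atTop ‖ξ‖] with T h2 h3
  rw [WT_eq, ← h2]
  refine Finset.sum_congr rfl fun s hs => ?_
  rw [Finset.prod_eq_one, mul_one]
  intro i _
  refine chi_sum_one ?_
  rw [abs_mul, abs_of_pos (pw_pos _)]
  have h4 : pw (-s) ≤ 2 ^ T := by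
    rw [← pw_natCast]
    exact pw_mono (by have := Finset.mem_Icc.1 hs; omega)
  have h5 : |ξ i| ≤ 2 ^ T := (norm_le_pi_norm ξ i).trans h3
  calc _ ≤ (2:ℝ) ^ T * 2 ^ T := by gcongr
    _ = _ := by push_cast; rw [← mul_pow]; norm_num

lemma hcut_cont (Pr : (Fin n → ℝ) →L[ℝ] (Fin n → ℝ)) (b : ℝ) (ν : Fin n → ℤ) : Continuous (hcut Pr b ν) := by
  unfold hcut
  have h1 := tht_cont b
  have h2 := chi_cont
  have h3 := qf_cont (n := n)
  fun_prop

lemma chi_le_one (x : ℝ) : chi x ≤ 1 := by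
  unfold chi
  linarith [smoothTransition.le_one (x + 1), smoothTransition.nonneg x]

lemma hcut_abs_le (Pr : (Fin n → ℝ) →L[ℝ] (Fin n → ℝ)) (b : ℝ) (ν : Fin n → ℤ) (ξ : Fin n → ℝ) :
    |hcut Pr b ν ξ| ≤ 1 := by
  unfold hcut
  have h0 := tht_nonneg b (qf_nonneg (Pr ξ))
  have h1 : tht b (qf (Pr ξ)) ≤ 1 := by
    unfold tht
    linarith [smoothTransition.le_one (qf (Pr ξ) - b), smoothTransition.nonneg (qf (Pr ξ) / 4 - b)]
  have h2 : 0 ≤ ∏ i, chi (ξ i - ν i) := Finset.prod_nonneg fun i _ => chi_nonneg _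
  have h3 : ∏ i, chi (ξ i - ν i) ≤ 1 := Finset.prod_le_one (fun i _ => chi_nonneg _) fun i _ => chi_le_one _
  rw [abs_of_nonneg (mul_nonneg h0 h2)]
  exact mul_le_one₀ h1 h2 h3

lemma gp_cont : Continuous (gammaParam n) := by
  refine continuous_pi fun i => ?_
  unfold gammaParam
  split_ifs <;> fun_prop

/-- the preimage of `Γ'` is a null set -/
lemma gp_null (hn : 1 ≤ n) {k : ℕ} (hk : k < n - 1) (Γ' : Submodule ℝ (Fin n → ℝ)) (hfr : Module.finrank ℝ Γ' = k) :
    ∀ᵐ η : Fin (n - 1) → ℝ, gammaParam n η ∉ Γ' := by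
  set L : (Fin (n - 1) → ℝ) →ₗ[ℝ] (Fin n → ℝ) :=
    { toFun := gammaParam n, map_add' := gammaParam_add n, map_smul' := gammaParam_smul n } with hL
  have hinj : Function.Injective L := by
    intro x y hxy
    funext i
    have h := congrFun hxy ⟨i, by omega⟩
    simpa [hL, gammaParam] using h
  have hne : Γ'.comap L ≠ ⊤ := by
    intro h
    have h1 : LinearMap.range L ≤ Γ' := by
      rintro _ ⟨x, rfl⟩
      have : x ∈ Γ'.comap L := h ▸ Submodule.mem_top
      exact this
    have h2 := Submodule.finrank_mono h1
    rw [LinearMap.finrank_range_of_inj hinj, hfr, Module.finrank_fin_fun] at h2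
    omega
  have h := Measure.addHaar_submodule (volume : Measure (Fin (n - 1) → ℝ)) _ hne
  rw [ae_iff]
  convert h using 2
  ext η
  simp [hL]

end

noncomputable section

variable {n : ℕ}

lemma hcut_gp_cont (Pr : (Fin n → ℝ) →L[ℝ] (Fin n → ℝ)) (b : ℝ) (ν : Fin n → ℤ) (c : ℝ) :
    Continuous fun η : Fin (n - 1) → ℝ => hcut Pr b ν (c • gammaParam n η) := by
  have h1 : Continuous fun η : Fin (n - 1) → ℝ => c • gammaParam n η := by
    have h := gp_cont (n := n)
    fun_prop
  exact (hcut_cont Pr b ν).comp h1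

lemma hcut_gp_int (Pr : (Fin n → ℝ) →L[ℝ] (Fin n → ℝ)) (b : ℝ) (ν : Fin n → ℤ) (c : ℝ)
    {g : (Fin (n - 1) → ℝ) → ℂ} (hg : Integrable g) :
    Integrable fun η : Fin (n - 1) → ℝ => (hcut Pr b ν (c • gammaParam n η) : ℂ) * g η := by
  have h1 : AEStronglyMeasurable (fun η : Fin (n - 1) → ℝ => (hcut Pr b ν (c • gammaParam n η) : ℂ)) volume :=
    (Complex.continuous_ofReal.comp (hcut_gp_cont Pr b ν c)).aestronglyMeasurable
  refine Integrable.bdd_mul (c := 1) hg h1 (Filter.Eventually.of_forall fun η => ?_)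
  rw [Complex.norm_real]
  exact hcut_abs_le _ _ _ _

lemma lam_bound (hn : 2 ≤ n) {k : ℕ} (hk : k < n - 1) {Γ' : Submodule ℝ (Fin n → ℝ)} (hfr : Module.finrank ℝ Γ' = k)
    {Pr : (Fin n → ℝ) →L[ℝ] (Fin n → ℝ)} (hP1 : ∀ ξ, ξ - Pr ξ ∈ Γ') {b : ℝ} (hb : 0 < b)
    (m : (Fin n → ℝ) → ℂ) (F : Fin n → ℝ → ℂ) {D : ℝ} (hD0 : 0 ≤ D)
    (hD : ∀ ℱ : Finset (ℤ × (Fin n → ℤ)), (∀ q ∈ ℱ, ∃ η, hcut Pr b q.2 (pw (-q.1) • gammaParam n η) ≠ 0) →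
      ‖∑ q ∈ ℱ, ∫ η, piece Pr b m F q η‖ ≤ D) : ‖Lam n m F‖ ≤ D := by
  set g : (Fin (n - 1) → ℝ) → ℂ := fun η => m (gammaParam n η) * ∏ i, 𝓕 (F i) (gammaParam n η i) with hg
  have hLam : Lam n m F = ∫ η, g η := rfl
  by_cases hIntg : Integrable g
  swap
  · rw [hLam, integral_undef hIntg, norm_zero]; exact hD0
  have hWc : ∀ T, Continuous fun η : Fin (n - 1) → ℝ => (WT Pr b T (gammaParam n η) : ℂ) := by
    intro T
    refine Complex.continuous_ofReal.comp ?_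
    unfold WT
    refine continuous_finsetSum _ fun q _ => ?_
    exact hcut_gp_cont Pr b q.2 _
  have hlim : Filter.Tendsto (fun T : ℕ => ∫ η, (WT Pr b T (gammaParam n η) : ℂ) * g η) Filter.atTop
      (nhds (∫ η, g η)) := by
    refine tendsto_integral_of_dominated_convergence (fun η => ‖g η‖) ?_ hIntg.norm ?_ ?_
    · exact fun T => (hWc T).aestronglyMeasurable.mul hIntg.1
    · refine fun T => Filter.Eventually.of_forall fun η => ?_
      rw [norm_mul, Complex.norm_real, Real.norm_eq_abs, abs_of_nonneg (WT_nonneg _ _ _ _)]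
      exact mul_le_of_le_one_left (norm_nonneg _) (WT_le _ _ _ _)
    · filter_upwards [gp_null (by omega) hk Γ' hfr] with η hη
      have hq : 0 < qf (Pr (gammaParam n η)) := by
        refine lt_of_le_of_ne (qf_nonneg _) fun h0 => hη ?_
        have h1 : ‖Pr (gammaParam n η)‖ ≤ 0 := by
          have := le_qf (w := Pr (gammaParam n η))
          rwa [← h0, Real.sqrt_zero] at this
        have h2 := hP1 (gammaParam n η)
        rwa [norm_le_zero_iff.1 h1, sub_zero] at h2
      refine tendsto_const_nhds.congr' ?_
      filter_upwards [WT_one hb hq] with T hT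
      rw [hT, Complex.ofReal_one, one_mul]
  rw [hLam]
  refine le_of_tendsto' hlim.norm fun T => ?_
  have hpi : ∀ q, Integrable (piece Pr b m F q) := by
    intro q
    have h1 : Integrable fun η => (hcut Pr b q.2 (pw (-q.1) • gammaParam n η) : ℂ) * g η :=
      hcut_gp_int Pr b q.2 _ hIntg
    refine h1.congr (Filter.Eventually.of_forall fun η => ?_)
    simp only [piece, hg]
    ring
  have e1 : ∫ η, (WT Pr b T (gammaParam n η) : ℂ) * g η = ∑ q ∈ qbox n T, ∫ η, piece Pr b m F q η := by
    rw [← integral_finsetSum _ fun q _ => hpi q]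
    refine integral_congr_ae (Filter.Eventually.of_forall fun η => ?_)
    simp only [WT, hg, piece]
    push_cast
    rw [Finset.sum_mul]
    refine Finset.sum_congr rfl fun q _ => ?_
    ring
  have e2 : ∑ q ∈ qbox n T, ∫ η, piece Pr b m F q η =
      ∑ q ∈ (qbox n T).filter (fun q => ∃ η, hcut Pr b q.2 (pw (-q.1) • gammaParam n η) ≠ 0),
        ∫ η, piece Pr b m F q η := by
    symm
    refine Finset.sum_subset (Finset.filter_subset _ _) fun q hq hq2 => ?_
    have h3 : ∀ η, hcut Pr b q.2 (pw (-q.1) • gammaParam n η) = 0 := by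
      intro η
      by_contra hne
      exact hq2 (Finset.mem_filter.2 ⟨hq, η, hne⟩)
    simp [piece, h3]
  rw [e1, e2]
  exact hD _ fun q hq => (Finset.mem_filter.1 hq).2

lemma lam_zero (m : (Fin n → ℝ) → ℂ) (F : Fin n → ℝ → ℂ) (i : Fin n) (h : F i =ᵐ[volume] 0) : Lam n m F = 0 := by
  have h1 : ∀ x, 𝓕 (F i) x = 0 := by
    intro x
    rw [Real.fourier_eq]
    refine integral_eq_zero_of_ae ?_
    filter_upwards [h] with v hv
    simp [hv]
  unfold Lam
  have : ∀ η, m (gammaParam n η) * ∏ i, 𝓕 (F i) (gammaParam n η i) = 0 := by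
    intro η
    rw [Finset.prod_eq_zero (Finset.mem_univ i) (h1 _), mul_zero]
  simp [this]

lemma bdd_supp_int {E : Set ℝ} (hE : MeasurableSet E) (hf : volume E < ⊤) {f : ℝ → ℂ} (hm : Measurable f)
    (h1 : ∀ x, ‖f x‖ ≤ 1) (h0 : ∀ x, x ∉ E → f x = 0) : Integrable f := by
  have h2 : Integrable (E.indicator fun _ => (1:ℝ)) :=
    (integrable_indicator_iff hE).2 (integrableOn_const hf.ne)
  refine h2.mono' hm.aestronglyMeasurable (Filter.Eventually.of_forall fun x => ?_)
  by_cases hx : x ∈ E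
  · rw [Set.indicator_of_mem hx]; exact h1 x
  · rw [h0 x hx, norm_zero, Set.indicator_of_notMem hx]

theorem main7 (n k : ℕ) (hn : 2 ≤ n) (hk : 1 ≤ k) (hkn : 2 * k < n) :
    ∃ M : ℕ, ∀ (Γ' : Submodule ℝ (Fin n → ℝ)),
      (Γ' : Set (Fin n → ℝ)) ⊆ GammaSet n →
      Module.finrank ℝ Γ' = k →
      NonDegenerate n k Γ' →
      ∀ a : Fin n → ℝ, Admissible n a →
      ∀ j : Fin n, a j < 0 →
        (∀ S : Finset (Fin n), S.Nonempty →
          ∑ i ∈ S, a i < ((n : ℝ) - 2 * k + S.card) / 2) →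
        ∀ B : ℝ, ∃ C : ℝ, ∀ m : (Fin n → ℝ) → ℂ,
          SymbolEst n Γ' M B m →
          RestrictedType n (Lam n m) a C := by
  refine ⟨2 * (n + 4) * n + n, fun Γ' hΓ hfr hnd a ha j haj hreg B => ?_⟩
  obtain ⟨ha1, hasum, huniq⟩ := ha
  have hapos : ∀ i, i ≠ j → 0 ≤ a i := fun i hij => by
    by_contra h
    exact hij (huniq i j (not_le.1 h) haj)
  obtain ⟨Pr, hP1, hP2⟩ := exists_Pr Γ'
  obtain ⟨b, C2, C3, ext, hb, hC2, hgeo⟩ := geo_exists Γ' hΓ hnd hP1 hP2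
  obtain ⟨CG, hCG, hGG⟩ := GG_decay hn hP2 hb (2 * (n + 4) * n + n) B
  have hK : (0:ℝ) ≤ (C2:ℝ) + 1 := by
    have : (7:ℝ) ≤ C2 := by exact_mod_cast hC2
    linarith
  obtain ⟨C0, hC0, hwp⟩ := wp_exists (n + 4) hK
  obtain ⟨C1, hC1, hB⟩ := thmB2 hk hkn C3 hC2 ha1 hasum j haj hapos hreg
  set A : ℝ := CG * (C0 * 4 ^ (n + 4)) ^ n * (∫ z : VV n, ((1 + ‖z‖) ^ n)⁻¹) with hA
  have hA0 : 0 ≤ A := by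
    have : 0 ≤ ∫ z : VV n, ((1 + ‖z‖) ^ n)⁻¹ := integral_nonneg fun z => by positivity
    positivity
  refine ⟨A * C1, fun m hm E hE hf => ?_⟩
  have hpr : 0 ≤ ∏ i, (volume (E i)).toReal ^ a i :=
    Finset.prod_nonneg fun i _ => Real.rpow_nonneg ENNReal.toReal_nonneg _
  by_cases h0 : ∃ i, volume (E i) = 0
  · obtain ⟨i, hi⟩ := h0
    refine ⟨E, hE, fun _ => subset_rfl, fun _ _ => rfl, fun i => ?_, fun F _ _ hF0 => ?_⟩
    · rw [two_mul]; exact le_add_self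
    · rw [lam_zero m F i ?_, norm_zero]
      · positivity
      · have : ∀ᵐ x, x ∉ E i := measure_eq_zero_iff_ae_notMem.1 hi
        filter_upwards [this] with x hx
        exact hF0 i x hx
  push Not at h0
  refine ⟨fun i => if i = j then E j \ Om E j else E i, fun i => ?_, fun i => ?_, fun i hi => ?_, fun i => ?_,
    fun F hFm hF1 hF0 => ?_⟩
  · dsimp only; split_ifs
    · exact (hE j).diff (Om_open j h0 hf).measurableSet
    · exact hE i
  · dsimp only; split_ifs with h
    · subst h; exact Set.sdiff_subset
    · exact subset_rfl
  · dsimp only; rw [if_neg]; rintro rfl; linarith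
  · dsimp only; split_ifs with h
    · subst h; exact Om_major i hE h0 hf
    · rw [two_mul]; exact le_add_self
  have hFE : ∀ i x, x ∉ E i → F i x = 0 := by
    intro i x hx
    apply hF0
    dsimp only; split_ifs with h
    · subst h; exact fun h => hx h.1
    · exact hx
  have hFO : ∀ x ∈ Om E j, F j x = 0 := by
    intro x hx
    apply hF0
    dsimp only
    rw [if_pos rfl]
    exact fun h => h.2 hx
  have hFi : ∀ i, Integrable (F i) := fun i => bdd_supp_int (hE i) (hf i) (hFm i) (hF1 i) (hFE i)
  rw [mul_assoc]
  refine lam_bound hn (by omega) hfr hP1 hb m F (by positivity) fun ℱ hℱ => ?_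
  refine sum_pieces hn rfl hCG (hGG m hm) F hFi hC0 hwp ℱ (by positivity) fun φ hφ ℙ hℙ => ?_
  refine hB E hE h0 hf F hFm hF1 hFE hFO φ hφ ℙ ext (hgeo ℙ fun P hP => ?_)
  obtain ⟨η, hη⟩ := hℱ _ (hℙ P hP)
  refine ⟨_, ?_, fun i => hcut_xt Pr b _ _ i hη, ?_, ?_⟩
  · simp only [Pi.smul_apply, smul_eq_mul]
    rw [← Finset.mul_sum, gammaParam_sum (by omega), mul_zero]
  · by_contra h
    exact hη (by unfold hcut; rw [tht_zero_lo hb (not_le.1 h).le, zero_mul])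
  · by_contra h
    exact hη (by unfold hcut; rw [tht_zero_hi hb (not_le.1 h).le, zero_mul])

end

/-- Lemma 2.9 (`badtuples`): `Λ_m` is of restricted type `α` for every bad
admissible tuple `α` satisfying the constraints (region-q). -/
theorem statement7 (n k : ℕ) (hn : 2 ≤ n) (hk : 1 ≤ k) (hkn : 2 * k < n) :
    ∃ M : ℕ, ∀ (Γ' : Submodule ℝ (Fin n → ℝ)),
      (Γ' : Set (Fin n → ℝ)) ⊆ GammaSet n →
      Module.finrank ℝ Γ' = k →
      NonDegenerate n k Γ' →
      ∀ a : Fin n → ℝ, Admissible n a →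
      ∀ j : Fin n, a j < 0 →
        (∀ S : Finset (Fin n), S.Nonempty →
          ∑ i ∈ S, a i < ((n : ℝ) - 2 * k + S.card) / 2) →
        ∀ B : ℝ, ∃ C : ℝ, ∀ m : (Fin n → ℝ) → ℂ,
          SymbolEst n Γ' M B m →
          RestrictedType n (Lam n m) a C := by
  exact main7 n k hn hk hkn
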